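/- Let q be a prime power and r a positive integer with gcd(q, (r+1)!) = 1. Let f, g ∈ F_q[X] be coprime polynomials with max(deg f, deg g) = r+1, set h = f/g, and let g = ∏_i g_i^{a_i} be the factorization of g into pairwise distinct monic irreducible polynomials g_i over F_q. Let t be transcendental over F_q and let M_h be the splitting field of f(X) − t·g(X) over F_q(t); assume the constant field of M_h is F_q (every element of M_h algebraic over F_q lies in F_q). Then the number of points b ∈ P¹(F_q) with #h⁻¹(b) = r+1 is at least (q − 2√q + 1)/(r+1)! − 2√q·(r−1) − (r + 1 + Σ_i deg g_i)/2 (an inequality of real numbers). -/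

import Mathlib

section RatEvalDef
open Polynomial Finset

/-- The map `P¹(F) → P¹(F)` induced by the rational function `f/g`
(with `none` playing the role of `∞`). -/
def ratEval {F : Type*} [Field F] [DecidableEq F] (f g : Polynomial F) :
    Option F → Option F
  | none =>
      if g.natDegree < f.natDegree then none
      else if f.natDegree = g.natDegree then some (f.leadingCoeff / g.leadingCoeff)
      else some 0
  | some x => if g.eval x = 0 then none else some (f.eval x / g.eval x)

end RatEvalDef


/-! ## Part 1: formal zeta function lemmas -/

section ZetaFormal

open PowerSeries in
/-- power sum generating series of a multiset -/
noncomputable def psumSeries (s : Multiset ℂ) : PowerSeries ℂ :=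
  PowerSeries.mk (fun j => if j = 0 then 0 else (s.map (fun a => a ^ j)).sum)

open PowerSeries in
noncomputable def eulerSeries (s : Multiset ℂ) : PowerSeries ℂ :=
  (s.map (fun a => (1 - PowerSeries.C a * PowerSeries.X))).prod

open PowerSeries in
theorem psumSeries_cons (a : ℂ) (s : Multiset ℂ) :
    (1 - C a * X) * psumSeries (a ::ₘ s) = C a * X + (1 - C a * X) * psumSeries s := by
  have h : psumSeries (a ::ₘ s) = psumSeries {a} + psumSeries s := by
    ext j
    simp only [psumSeries, coeff_mk, map_add]
    split_ifs <;> simp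
  have h2 : (1 - C a * X) * psumSeries {a} = C a * X := by
    ext j
    rw [sub_mul, one_mul, map_sub, mul_assoc, coeff_C_mul, coeff_C_mul]
    rcases j with _ | _ | j
    · simp [psumSeries]
    · simp [psumSeries, coeff_succ_X_mul]
    · rw [coeff_succ_X_mul]
      simp [psumSeries, coeff_X, pow_succ]
      ring
  rw [h, mul_add, h2]

open PowerSeries in
theorem eulerSeries_deriv (s : Multiset ℂ) :
    X * d⁄dX ℂ (eulerSeries s) = - (eulerSeries s * psumSeries s) := by
  induction s using Multiset.induction_on with
  | empty => simp [eulerSeries, psumSeries, show (PowerSeries.mk fun _ => (0:ℂ)) = 0 from rfl]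
  | cons a s ih =>
    have h1 : eulerSeries (a ::ₘ s) = (1 - C a * X) * eulerSeries s := by
      simp [eulerSeries]
    have h3 := psumSeries_cons a s
    have h2 : d⁄dX ℂ ((1 - C a * X) : PowerSeries ℂ) = - C a := by
      simp [Derivation.leibniz]
    rw [h1, Derivation.leibniz, h2, smul_eq_mul, smul_eq_mul]
    linear_combination (1 - C a * X) * ih + eulerSeries s * h3

theorem poly_euler (L : Polynomial ℂ) (h0 : L.coeff 0 = 1) :
    ∃ s : Multiset ℂ, s.card = L.natDegree ∧ (L : PowerSeries ℂ) = eulerSeries s := by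
  have hsp := IsAlgClosed.splits L
  have hL := hsp.eq_prod_roots
  refine ⟨L.roots.map (fun b => b⁻¹), ?_, ?_⟩
  · rw [Multiset.card_map]; exact hsp.natDegree_eq_card_roots.symm
  · have hLne : L ≠ 0 := by rintro rfl; simp at h0
    have hne : ∀ b ∈ L.roots, b ≠ 0 := by
      rintro b hb rfl
      rw [Polynomial.mem_roots hLne, Polynomial.IsRoot, ← Polynomial.coeff_zero_eq_eval_zero] at hb
      rw [h0] at hb; exact one_ne_zero hb
    have key : ∀ (s : Multiset ℂ), (∀ b ∈ s, b ≠ 0) →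
        (s.map (fun b => Polynomial.X - Polynomial.C b)).prod =
        Polynomial.C ((s.map (fun b => -b)).prod) *
          (s.map (fun b => 1 - Polynomial.C b⁻¹ * Polynomial.X)).prod := by
      intro s
      induction s using Multiset.induction_on with
      | empty => simp
      | cons a s ih =>
        intro h
        have ha : a ≠ 0 := h a (by simp)
        rw [Multiset.map_cons, Multiset.prod_cons, ih (fun b hb => h b (by simp [hb])),
          Multiset.map_cons, Multiset.prod_cons, Multiset.map_cons, Multiset.prod_cons]
        have : (Polynomial.X - Polynomial.C a : Polynomial ℂ) =
            Polynomial.C (-a) * (1 - Polynomial.C a⁻¹ * Polynomial.X) := by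
          rw [mul_sub, ← mul_assoc, ← Polynomial.C_mul, neg_mul, mul_inv_cancel₀ ha]
          simp; ring
        rw [this, Polynomial.C_mul]; ring
    rw [key _ hne, ← mul_assoc, ← Polynomial.C_mul] at hL
    set e := L.leadingCoeff * (L.roots.map (fun b => -b)).prod with he
    have he1 : e = 1 := by
      have := congrArg (fun p => p.coeff 0) hL
      simp only [h0, Polynomial.coeff_zero_eq_eval_zero, Polynomial.eval_mul, Polynomial.eval_C,
        Polynomial.eval_multiset_prod, Multiset.map_map] at this
      simpa [Function.comp_def] using this.symm
    rw [he1, map_one, one_mul] at hL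
    conv_lhs => rw [hL]
    rw [← Polynomial.coeToPowerSeries.ringHom_apply, map_multiset_prod]
    simp [eulerSeries, Multiset.map_map, Function.comp_def]

open PowerSeries in
theorem zeta_roots (q : ℕ) (A N : ℕ → ℕ)
    (h : ∀ d, d * A d = ∑ j ∈ Finset.Icc 1 d, N j * A (d - j)) (hA0 : A 0 = 1) (c : ℕ)
    (hrec : ∀ d, c ≤ d → (A (d + 2) : ℤ) - (q + 1) * A (d + 1) + q * A d = 0) :
    ∃ s : Multiset ℂ, s.card ≤ c + 1 ∧
      ∀ j, 1 ≤ j → (N j : ℂ) = q ^ j + 1 - (s.map (fun a => a ^ j)).sum := by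
  set 𝒜 : PowerSeries ℂ := PowerSeries.mk (fun d => (A d : ℂ)) with h𝒜
  set 𝒩 : PowerSeries ℂ := PowerSeries.mk (fun j => if j = 0 then 0 else (N j : ℂ)) with h𝒩
  have hder : X * d⁄dX ℂ 𝒜 = 𝒩 * 𝒜 := by
    ext d
    conv_rhs => rw [coeff_mul, Finset.Nat.sum_antidiagonal_eq_sum_range_succ
      (fun i j => coeff i 𝒩 * coeff j 𝒜)]
    rcases d with _ | d
    · simp [h𝒩]
    · rw [coeff_succ_X_mul, coeff_derivative]
      have := h (d + 1)
      have h2 : ((d + 1 : ℕ) : ℂ) * (A (d + 1) : ℂ) =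
          ∑ j ∈ Finset.Icc 1 (d + 1), (N j : ℂ) * (A (d + 1 - j) : ℂ) := by exact_mod_cast this
      rw [Finset.sum_range_succ', h𝒜]
      simp only [coeff_mk, h𝒩]
      rw [if_pos trivial, zero_mul, add_zero, mul_comm]
      push_cast at h2 ⊢
      rw [h2, Finset.sum_bij (fun j _ => j - 1)]
      · intro a ha; simp at ha ⊢; omega
      · intro a ha b hb; simp at ha hb; omega
      · intro b hb; simp at hb; exact ⟨b + 1, by simp; omega, by simp⟩
      · intro a ha; simp at ha
        have : a - 1 + 1 = a := by omega
        rw [this, show d + 1 - a = d - (a - 1) by omega]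
  set E : PowerSeries ℂ := eulerSeries {1, (q : ℂ)} with hE
  have hE' : E = (1 - C 1 * X) * (1 - C (q : ℂ) * X) := by simp [hE, eulerSeries]
  have hEA : ∀ d, c + 2 ≤ d → coeff d (E * 𝒜) = 0 := by
    intro d hd
    obtain ⟨d, rfl⟩ : ∃ e, d = e + 2 := ⟨d - 2, by omega⟩
    have : E * 𝒜 = 𝒜 - C ((q : ℂ) + 1) * (X * 𝒜) + C (q : ℂ) * (X * (X * 𝒜)) := by
      rw [hE']; simp; ring
    rw [this, map_add, map_sub, coeff_C_mul, coeff_C_mul, coeff_succ_X_mul, coeff_succ_X_mul,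
      coeff_succ_X_mul]
    simp only [h𝒜, coeff_mk]
    have := hrec d (by omega)
    exact_mod_cast this
  set L : Polynomial ℂ := PowerSeries.trunc (c + 2) (E * 𝒜) with hL
  have hLc : (L : PowerSeries ℂ) = E * 𝒜 := by
    ext d
    rw [Polynomial.coeff_coe, hL, coeff_trunc]
    split_ifs with hh
    · rfl
    · exact (hEA d (by omega)).symm
  have hL0 : L.coeff 0 = 1 := by
    rw [hL, coeff_trunc, if_pos (by omega), hE']
    simp [h𝒜, hA0, coeff_zero_eq_constantCoeff]
  obtain ⟨s, hs, hsL⟩ := poly_euler L hL0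
  refine ⟨s, ?_, ?_⟩
  · rw [hs]
    have := natDegree_trunc_lt (E * 𝒜) (c + 1)
    rw [← hL] at this; omega
  · have h1 := eulerSeries_deriv s
    have h2 := eulerSeries_deriv {1, (q : ℂ)}
    rw [← hsL, hLc, Derivation.leibniz, smul_eq_mul, smul_eq_mul] at h1
    rw [← hE] at h2
    have hne : E * 𝒜 ≠ 0 := by
      rw [← hLc]; intro h0
      have := congrArg (coeff 0) h0
      rw [Polynomial.coeff_coe, hL0] at this; simp at this
    have h3 : E * 𝒜 * (𝒩 - psumSeries {1, (q : ℂ)} + psumSeries s) = 0 := by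
      linear_combination h1 - E * hder - 𝒜 * h2
    have h4 := (mul_eq_zero.mp h3).resolve_left hne
    intro j hj
    have h5 := congrArg (coeff j) h4
    simp only [map_add, map_sub, h𝒩, psumSeries, coeff_mk, if_neg (show j ≠ 0 by omega)] at h5
    simp at h5
    linear_combination h5

/-- bounded power sums give bounded elements -/
theorem root_bound (s : Multiset ℂ) (R C : ℝ) (hR : 0 < R)
    (h : ∀ j, 1 ≤ j → ‖(s.map (fun a => a ^ j)).sum‖ ≤ C * R ^ j) :
    ∀ a ∈ s, ‖a‖ ≤ R := by
  classical
  intro b hb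
  set p : Polynomial ℂ := ∏ x ∈ s.toFinset.erase b, (Polynomial.X - Polynomial.C x) with hp
  have hpe : ∀ a ∈ s, a ≠ b → p.eval a = 0 := by
    intro a ha hab
    rw [hp, Polynomial.eval_prod]
    exact Finset.prod_eq_zero (i := a) (by simp [hab, ha]) (by simp)
  have hpb : p.eval b ≠ 0 := by
    rw [hp, Polynomial.eval_prod, Finset.prod_ne_zero_iff]
    intro x hx
    simp at hx
    simp [sub_eq_zero]; exact fun h => hx.1 h.symm
  have hsum : ∀ j, ∑ k ∈ Finset.range (p.natDegree + 1), p.coeff k *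
      (s.map (fun a => a ^ (j + k))).sum = s.count b * (p.eval b * b ^ j) := by
    intro j
    have h2 : ∀ f : ℂ → ℂ, (s.map f).sum = ∑ a ∈ s.toFinset, (s.count a : ℂ) * f a := by
      intro f
      rw [Finset.sum_multiset_map_count]
      simp
    simp_rw [h2, Finset.mul_sum]
    rw [Finset.sum_comm, Finset.sum_eq_single b]
    · rw [Polynomial.eval_eq_sum_range, Finset.sum_mul, Finset.mul_sum]
      exact Finset.sum_congr rfl fun k _ => by ring
    · intro a ha hab
      have := hpe a (by simpa using ha) hab
      rw [Polynomial.eval_eq_sum_range] at this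
      calc _ = ∑ k ∈ Finset.range (p.natDegree + 1), (s.count a * a ^ j) * (p.coeff k * a ^ k) :=
            Finset.sum_congr rfl fun k _ => by ring
        _ = 0 := by rw [← Finset.mul_sum, this, mul_zero]
    · intro hh; simp [hb] at hh
  have hcnt : 1 ≤ s.count b := Multiset.one_le_count_iff_mem.mpr hb
  set D : ℝ := (∑ k ∈ Finset.range (p.natDegree + 1), ‖p.coeff k‖ * (C * R ^ k)) / ‖p.eval b‖
    with hD
  have hpb' : 0 < ‖p.eval b‖ := norm_pos_iff.mpr hpb
  have hbd : ∀ j, 1 ≤ j → ‖b‖ ^ j ≤ D * R ^ j := by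
    intro j hj
    have h1 := congrArg norm (hsum j)
    have h2 : ‖∑ k ∈ Finset.range (p.natDegree + 1), p.coeff k *
      (s.map (fun a => a ^ (j + k))).sum‖ ≤
        (∑ k ∈ Finset.range (p.natDegree + 1), ‖p.coeff k‖ * (C * R ^ k)) * R ^ j := by
      refine (norm_sum_le _ _).trans ?_
      rw [Finset.sum_mul]
      refine Finset.sum_le_sum fun k _ => ?_
      rw [norm_mul, mul_assoc]
      refine mul_le_mul_of_nonneg_left ((h (j + k) (by omega)).trans (le_of_eq ?_)) (norm_nonneg _)
      ring
    rw [h1, norm_mul, norm_mul, norm_pow, Complex.norm_natCast] at h2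
    rw [hD, div_mul_eq_mul_div, le_div_iff₀ hpb']
    refine le_trans ?_ h2
    have : (1 : ℝ) ≤ s.count b := by exact_mod_cast hcnt
    nlinarith [mul_nonneg hpb'.le (pow_nonneg (norm_nonneg b) j)]
  by_contra hlt
  push Not at hlt
  have h1 : 1 < ‖b‖ / R := by rwa [one_lt_div hR]
  obtain ⟨j, hj⟩ := pow_unbounded_of_one_lt (max D 1) h1
  have hj1 : 1 ≤ j := by
    rcases Nat.eq_zero_or_pos j with rfl | h
    · simp at hj
    · exact h
  have h2 := hbd j hj1
  rw [← div_le_iff₀ (pow_pos hR j), ← div_pow] at h2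
  exact absurd (hj.trans_le h2) (not_lt.mpr (le_max_left _ _))

end ZetaFormal

section Comb
open Finset
variable {ι : Type*} (deg : ι → ℕ) (S : ℕ → Finset ι)

/-- degree of an effective divisor -/
def effDeg (E : ι →₀ ℕ) : ℕ := E.sum (fun P e => e * deg P)

open Classical in
noncomputable def effSet (d : ℕ) : Finset (ι →₀ ℕ) :=
  ((S d).finsupp (fun _ => range (d + 1))).filter (fun E => effDeg deg E = d)

theorem effDeg_add (E E' : ι →₀ ℕ) : effDeg deg (E + E') = effDeg deg E + effDeg deg E' := by
  classical
  exact Finsupp.sum_add_index' (by simp) (by intros; ring)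

theorem effDeg_single (P : ι) (k : ℕ) : effDeg deg (Finsupp.single P k) = k * deg P := by
  simp [effDeg]

variable {deg S}

theorem mul_deg_le_effDeg (E : ι →₀ ℕ) (P : ι) : E P * deg P ≤ effDeg deg E := by
  classical
  by_cases h : P ∈ E.support
  · exact Finset.single_le_sum (f := fun P => E P * deg P) (fun _ _ => Nat.zero_le _) h
  · simp at h; simp [h]

theorem mem_effSet (hdeg : ∀ P, 0 < deg P) (hS : ∀ d P, P ∈ S d ↔ deg P ≤ d) (d : ℕ) (E : ι →₀ ℕ) :
    E ∈ effSet deg S d ↔ effDeg deg E = d := by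
  classical
  simp only [effSet, mem_filter, and_iff_right_iff_imp]
  rintro rfl
  rw [Finset.mem_finsupp_iff]
  have h : ∀ P, E P ≤ effDeg deg E := fun P =>
    (Nat.le_mul_of_pos_right _ (hdeg P)).trans (mul_deg_le_effDeg E P)
  refine ⟨fun P hP => ?_, fun P _ => by simpa [Nat.lt_succ_iff] using h P⟩
  rw [hS]
  refine le_trans ?_ (mul_deg_le_effDeg (deg := deg) E P)
  exact Nat.le_mul_of_pos_left _ (Nat.pos_of_ne_zero (by simpa using hP))

open Classical in
noncomputable def ptCount (deg : ι → ℕ) (S : ℕ → Finset ι) (j : ℕ) : ℕ :=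
  ∑ P ∈ (S j).filter (fun P => deg P ∣ j), deg P

theorem effSet_zero (hdeg : ∀ P, 0 < deg P) (hS : ∀ d P, P ∈ S d ↔ deg P ≤ d) :
    (effSet deg S 0).card = 1 := by
  classical
  rw [Finset.card_eq_one]
  refine ⟨0, ?_⟩
  ext E
  rw [mem_effSet hdeg hS, mem_singleton]
  constructor
  · intro h
    ext P
    have := mul_deg_le_effDeg (deg := deg) E P
    rw [h] at this
    have h2 := hdeg P
    simp at this ⊢; omega
  · rintro rfl; simp [effDeg]

theorem effSet_identity (hdeg : ∀ P, 0 < deg P) (hS : ∀ d P, P ∈ S d ↔ deg P ≤ d) (d : ℕ) :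
    d * (effSet deg S d).card =
      ∑ j ∈ Icc 1 d, ptCount deg S j * (effSet deg S (d - j)).card := by
  classical
  have h1 : d * (effSet deg S d).card = ∑ E ∈ effSet deg S d, ∑ P ∈ S d, E P * deg P := by
    rw [Finset.sum_congr rfl (g := fun _ => d), sum_const, smul_eq_mul, mul_comm]
    intro E hE
    have hE' := (mem_effSet hdeg hS d E).mp hE
    conv_rhs => rw [← hE']
    rw [effDeg, Finsupp.sum]
    refine (Finset.sum_subset ?_ ?_).symm
    · simp only [effSet, mem_filter, mem_finsupp_iff] at hE
      exact hE.1.1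
    · intro P _ hP; simp at hP; simp [hP]
  have h2 : ∀ P, ∑ E ∈ effSet deg S d, E P = ∑ k ∈ Icc 1 d,
      if k * deg P ≤ d then (effSet deg S (d - k * deg P)).card else 0 := by
    intro P
    have h3 : ∀ E ∈ effSet deg S d, E P = ∑ k ∈ Icc 1 d, if k ≤ E P then 1 else 0 := by
      intro E hE
      have hE' := (mem_effSet hdeg hS d E).mp hE
      rw [← Finset.card_filter]
      have : (Icc 1 d).filter (fun k => k ≤ E P) = Icc 1 (E P) := by
        ext k; simp only [mem_filter, mem_Icc]
        have : E P ≤ d := by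
          rw [← hE']
          exact (Nat.le_mul_of_pos_right _ (hdeg P)).trans (mul_deg_le_effDeg E P)
        omega
      rw [this]; simp
    rw [Finset.sum_congr rfl h3, Finset.sum_comm]
    refine Finset.sum_congr rfl fun k hk => ?_
    rw [← Finset.card_filter]
    split_ifs with hkd
    · symm
      refine Finset.card_bij (fun E _ => E + Finsupp.single P k) ?_ ?_ ?_
      · intro E hE
        rw [mem_effSet hdeg hS] at hE
        rw [mem_filter, mem_effSet hdeg hS, effDeg_add, effDeg_single, hE]
        refine ⟨by omega, by simp⟩
      · intro E _ E' _ h; exact add_right_cancel h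
      · intro E hE
        rw [mem_filter, mem_effSet hdeg hS] at hE
        have hle : Finsupp.single P k ≤ E := by
          rw [Finsupp.single_le_iff]; exact hE.2
        refine ⟨E - Finsupp.single P k, ?_, tsub_add_cancel_of_le hle⟩
        rw [mem_effSet hdeg hS]
        have := effDeg_add deg (E - Finsupp.single P k) (Finsupp.single P k)
        rw [tsub_add_cancel_of_le hle, effDeg_single, hE.1] at this
        omega
    · rw [Finset.card_eq_zero, Finset.filter_eq_empty_iff]
      intro E hE hk'
      rw [mem_effSet hdeg hS] at hE
      have := mul_deg_le_effDeg (deg := deg) E P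
      have := Nat.mul_le_mul_right (deg P) hk'
      omega
  rw [h1, Finset.sum_comm]
  simp_rw [← Finset.sum_mul, h2]
  have h4 : ∀ P, ∑ k ∈ Icc 1 d, (if k * deg P ≤ d then (effSet deg S (d - k * deg P)).card else 0)
      = ∑ j ∈ (Icc 1 d).filter (fun j => deg P ∣ j), (effSet deg S (d - j)).card := by
    intro P
    rw [← Finset.sum_filter]
    refine Finset.sum_bij (fun k _ => k * deg P) ?_ ?_ ?_ ?_
    · intro k hk
      simp only [mem_filter, mem_Icc] at hk ⊢
      exact ⟨⟨Nat.mul_pos hk.1.1 (hdeg P), hk.2⟩, dvd_mul_left _ _⟩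
    · intro k _ k' _ h; exact Nat.eq_of_mul_eq_mul_right (hdeg P) h
    · intro j hj
      simp only [mem_filter, mem_Icc] at hj
      obtain ⟨k, rfl⟩ := hj.2
      refine ⟨k, ?_, mul_comm _ _⟩
      have := hdeg P
      simp only [mem_filter, mem_Icc]
      refine ⟨⟨?_, ?_⟩, by rw [mul_comm]; exact hj.1.2⟩
      · rcases Nat.eq_zero_or_pos k with rfl | h
        · simp at hj
        · exact h
      · exact (Nat.le_mul_of_pos_left _ this).trans hj.1.2
    · intros; rfl
  simp_rw [h4, Finset.sum_mul, Finset.sum_filter, ptCount, Finset.sum_mul]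
  rw [Finset.sum_comm]
  refine Finset.sum_congr rfl fun j hj => ?_
  rw [Finset.sum_filter, ← Finset.sum_filter, ← Finset.sum_filter]
  simp only [mem_Icc] at hj
  rw [show (S d).filter (fun P => deg P ∣ j) = (S j).filter (fun P => deg P ∣ j) from ?_]
  · exact Finset.sum_congr rfl fun _ _ => mul_comm _ _
  · ext P
    simp only [mem_filter, hS]
    constructor
    · rintro ⟨_, h⟩; exact ⟨Nat.le_of_dvd (by omega) h, h⟩
    · rintro ⟨h, h'⟩; exact ⟨by omega, h'⟩
end Comb

/-! ## Part 2: lattices -/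
section Lattice
open IsDedekindDomain WithZero

theorem relIndex_sup_inf {V : Type*} [AddCommGroup V] (I I' J : AddSubgroup V) (h : I ≤ I') :
    I.relIndex I' = (I ⊓ J).relIndex (I' ⊓ J) * (I ⊔ J).relIndex (I' ⊔ J) := by
  have h1 : I.relIndex (I ⊔ (I' ⊓ J)) = (I ⊓ J).relIndex (I' ⊓ J) := by
    rw [sup_comm, AddSubgroup.relIndex_sup_right, ← AddSubgroup.inf_relIndex_right,
      ← inf_assoc, inf_eq_left.mpr h]
  have h2 : (I ⊔ J).relIndex (I' ⊔ J) = (I ⊔ (I' ⊓ J)).relIndex I' := by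
    have : I' ⊔ J = I' ⊔ (I ⊔ J) := by rw [← sup_assoc, sup_eq_left.mpr h]
    rw [this, AddSubgroup.relIndex_sup_right, ← AddSubgroup.inf_relIndex_right]
    congr 1
    rw [sup_inf_assoc_of_le _ h, inf_comm I' J]
  rw [← h1, h2]
  exact (AddSubgroup.relIndex_mul_relIndex _ _ _ le_sup_left (sup_le h inf_le_left)).symm

variable {R : Type*} [CommRing R] [IsDedekindDomain R]
  (M : Type*) [Field M] [Algebra R M] [IsFractionRing R M]

/-- Elements with prescribed poles -/
def lat (D : HeightOneSpectrum R → ℤ) : AddSubgroup M where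
  carrier := {x | ∀ v : HeightOneSpectrum R, v.valuation M x ≤ exp (D v)}
  zero_mem' := by intro v; simp
  add_mem' := by
    intro x y hx hy v
    exact (Valuation.map_add _ x y).trans (max_le (hx v) (hy v))
  neg_mem' := by
    intro x hx v; rw [Valuation.map_neg]; exact hx v

variable {M}

theorem mem_lat {D : HeightOneSpectrum R → ℤ} {x : M} :
    x ∈ lat M D ↔ ∀ v : HeightOneSpectrum R, v.valuation M x ≤ exp (D v) := Iff.rfl

theorem lat_mono {D D' : HeightOneSpectrum R → ℤ} (h : ∀ v, D v ≤ D' v) : lat M D ≤ lat M D' :=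
  fun _ hx v => (hx v).trans (exp_le_exp.mpr (h v))

theorem mul_mem_lat {D D' : HeightOneSpectrum R → ℤ} {x y : M} (hx : x ∈ lat M D)
    (hy : y ∈ lat M D') : x * y ∈ lat M (D + D') := by
  intro v
  rw [map_mul, Pi.add_apply, exp_add]
  exact mul_le_mul' (hx v) (hy v)

theorem mem_lat_zero {x : M} : x ∈ lat M (0 : HeightOneSpectrum R → ℤ) ↔
    x ∈ (algebraMap R M).range := by
  constructor
  · intro h; exact HeightOneSpectrum.mem_integers_of_valuation_le_one M x (by simpa [mem_lat] using h)
  · rintro ⟨y, rfl⟩ v; simpa using v.valuation_le_one y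

/-- minus the divisor of `x` -/
noncomputable def vlog (R : Type*) [CommRing R] [IsDedekindDomain R] {M : Type*} [Field M]
    [Algebra R M] [IsFractionRing R M] (x : M) (v : HeightOneSpectrum R) : ℤ :=
  log (v.valuation M x)

theorem exp_vlog {x : M} (hx : x ≠ 0) (v : HeightOneSpectrum R) :
    exp (vlog R x v) = v.valuation M x :=
  exp_log ((Valuation.ne_zero_iff _).mpr hx)

theorem vlog_mul {x y : M} (hx : x ≠ 0) (hy : y ≠ 0) : vlog R (x * y) = vlog R x + vlog R y := by
  ext v
  rw [vlog, map_mul, log_mul ((Valuation.ne_zero_iff _).mpr hx) ((Valuation.ne_zero_iff _).mpr hy)]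
  rfl

theorem vlog_inv {x : M} : vlog R (x⁻¹) = - vlog R x := by
  ext v; simp [vlog, log_inv]

theorem vlog_pow {x : M} (n : ℕ) (v : HeightOneSpectrum R) :
    vlog R (x ^ n) v = n * vlog R x v := by
  simp [vlog, log_pow]

theorem mem_lat_iff {D : HeightOneSpectrum R → ℤ} {x : M} (hx : x ≠ 0) :
    x ∈ lat M D ↔ ∀ v, vlog R x v ≤ D v := by
  simp only [mem_lat, ← exp_vlog hx, exp_le_exp]

theorem mul_mem_lat_iff {D : HeightOneSpectrum R → ℤ} {x y : M} (hx : x ≠ 0) :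
    x * y ∈ lat M (vlog R x + D) ↔ y ∈ lat M D := by
  constructor
  · intro h v
    have := h v
    rw [map_mul, Pi.add_apply, exp_add, exp_vlog hx] at this
    exact (mul_le_mul_iff_right₀ (zero_lt_iff.mpr ((Valuation.ne_zero_iff _).mpr hx))).mp this
  · exact fun h => mul_mem_lat (fun v => (exp_vlog hx v).ge) h

theorem vlog_finite (x : M) : (Function.support (vlog R x)).Finite := by
  rcases eq_or_ne x 0 with rfl | hx
  · convert Set.finite_empty; ext v; simp [vlog]
  refine Set.Finite.subset ((HeightOneSpectrum.Support.finite R x).union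
    (HeightOneSpectrum.Support.finite R x⁻¹)) ?_
  intro v hv
  have h0 : vlog R x v ≠ 0 := hv
  simp only [Set.mem_union, HeightOneSpectrum.Support, Set.mem_ofPred_eq, map_inv₀,
    ← exp_vlog hx v]
  rw [← exp_neg, ← exp_zero, exp_lt_exp, exp_lt_exp]
  omega

theorem exists_int_valuation (D : HeightOneSpectrum R → ℤ) (hD : ∀ v, D v ≤ 0)
    (hf : (Function.support D).Finite) (P : HeightOneSpectrum R) :
    ∃ y : R, algebraMap R M y ∈ lat M D ∧ P.valuation M (algebraMap R M y) = exp (D P) := by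
  classical
  set s : Finset (HeightOneSpectrum R) := insert P hf.toFinset with hs
  obtain ⟨ϖ, hϖ⟩ := P.intValuation_exists_uniformizer
  set n : HeightOneSpectrum R → ℕ := fun v => (- D v).toNat with hn
  have hnD : ∀ v, D v = -(n v : ℤ) := by intro v; simp [hn, hD v]
  have hPv : P.intValuation (ϖ ^ n P) = exp (D P) := by
    rw [map_pow, hϖ, hnD P, ← exp_nsmul]; simp
  obtain ⟨y, hy⟩ := IsDedekindDomain.exists_forall_sub_mem_ideal (s := s)
    (fun v : HeightOneSpectrum R => v.asIdeal) (fun v => n v + 1) (fun v _ => v.prime)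
    (fun v _ w _ h h' => h (HeightOneSpectrum.ext h'))
    (fun v => if (v : HeightOneSpectrum R) = P then ϖ ^ n P else 0)
  have hP := hy P (by simp [hs])
  rw [if_pos rfl, ← HeightOneSpectrum.intValuation_le_pow_iff_mem] at hP
  have hPy : P.intValuation y = exp (D P) := by
    rw [← hPv]
    have : P.intValuation (y - ϖ ^ n P) < P.intValuation (ϖ ^ n P) := by
      refine hP.trans_lt ?_
      rw [hPv, hnD P, exp_lt_exp]; push_cast; omega
    have := Valuation.map_add_eq_of_lt_right (v := P.intValuation) this
    rwa [sub_add_cancel] at this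
  refine ⟨y, ?_, ?_⟩
  · intro v
    rw [HeightOneSpectrum.valuation_of_algebraMap]
    by_cases hvP : v = P
    · subst hvP; exact hPy.le
    by_cases hv : v ∈ s
    · have := hy v hv
      rw [if_neg hvP, sub_zero, ← HeightOneSpectrum.intValuation_le_pow_iff_mem] at this
      refine this.trans ?_
      rw [hnD v, exp_le_exp]; push_cast; omega
    · have : D v = 0 := by
        by_contra h; exact hv (by simp [hs, h])
      rw [this]; simpa using v.intValuation_le_one y
  · rw [HeightOneSpectrum.valuation_of_algebraMap, hPy]

theorem exists_denom (D : HeightOneSpectrum R → ℤ) (hf : (Function.support D).Finite) :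
    ∃ c : R, c ≠ 0 ∧ ∀ v, vlog R (algebraMap R M c) v ≤ - D v := by
  classical
  rcases isEmpty_or_nonempty (HeightOneSpectrum R) with hE | ⟨⟨P⟩⟩
  · exact ⟨1, one_ne_zero, fun v => (IsEmpty.false v).elim⟩
  obtain ⟨y, hy, hP⟩ := exists_int_valuation (M := M) (fun v => min 0 (- D v)) (fun v => by simp)
    (hf.subset (by intro v hv; simp only [Function.mem_support] at hv ⊢; rintro h; simp [h] at hv)) P
  have hy0 : algebraMap R M y ≠ 0 := by
    intro h; rw [h, map_zero] at hP; exact exp_ne_zero hP.symm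
  refine ⟨y, fun h => hy0 (by simp [h]), fun v => ?_⟩
  exact ((mem_lat_iff hy0).mp hy v).trans (min_le_right _ _)

theorem exists_valuation_eq (D : HeightOneSpectrum R → ℤ)
    (hf : (Function.support D).Finite) (P : HeightOneSpectrum R) :
    ∃ y : M, y ∈ lat M D ∧ P.valuation M y = exp (D P) := by
  obtain ⟨c, hc, hcD⟩ := exists_denom (M := M) D hf
  have hc' : algebraMap R M c ≠ 0 := by
    rwa [Ne, IsFractionRing.to_map_eq_zero_iff]
  obtain ⟨y, hy, hP⟩ := exists_int_valuation (M := M) (vlog R (algebraMap R M c) + D)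
    (fun v => by have := hcD v; simp; omega)
    (((vlog_finite (R := R) (algebraMap R M c)).union hf).subset
      (Function.support_add _ _)) P
  refine ⟨(algebraMap R M c)⁻¹ * algebraMap R M y, ?_, ?_⟩
  · rw [← mul_mem_lat_iff hc', mul_inv_cancel_left₀ hc']; exact hy
  · rw [map_mul, hP, map_inv₀, Pi.add_apply, exp_add, exp_vlog hc',
      inv_mul_cancel_left₀ ((Valuation.ne_zero_iff _).mpr hc')]

theorem relIndex_lat [DecidableEq (HeightOneSpectrum R)] (D : HeightOneSpectrum R → ℤ)
    (hf : (Function.support D).Finite) (P : HeightOneSpectrum R) :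
    (lat M D).relIndex (lat M (D + Pi.single P 1)) = Nat.card (R ⧸ P.asIdeal) := by
  set D' := D + Pi.single P 1 with hD'
  have hD'P : D' P = D P + 1 := by simp [hD']
  have hD'v : ∀ v, v ≠ P → D' v = D v := by intro v hv; simp [hD', hv]
  have hfin : (Function.support D').Finite := by
    refine (hf.union (Set.finite_singleton P)).subset ?_
    intro v hv
    by_cases h : v = P
    · simp [h]
    · left; rw [Function.mem_support, hD'v v h] at hv; exact hv
  obtain ⟨y, hy, hyP⟩ := exists_valuation_eq (M := M) D' hfin P
  have hy0 : P.valuation M y ≠ 0 := by rw [hyP]; exact exp_ne_zero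
  let φ : R →+ lat M D' := 
    { toFun := fun a => ⟨algebraMap R M a * y, by
        have := mul_mem_lat (mem_lat_zero.mpr ⟨a, rfl⟩) hy
        rwa [zero_add] at this⟩
      map_zero' := by simp
      map_add' := by intro a b; ext; simp [add_mul] }
  let ψ : R →+ (lat M D' ⧸ (lat M D).addSubgroupOf (lat M D')) :=
    (QuotientAddGroup.mk' _).comp φ
  have hlat : ∀ x ∈ lat M D', x ∈ lat M D ↔ P.valuation M x < exp (D' P) := by
    intro x hx
    constructor
    · intro h; refine (h P).trans_lt ?_
      rw [hD'P, exp_lt_exp]; omega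
    · intro h v
      by_cases hv : v = P
      · subst hv
        rw [hD'P] at h
        rcases eq_or_ne x 0 with rfl | h0
        · simp
        rw [← exp_vlog h0, exp_lt_exp] at h
        rw [← exp_vlog h0, exp_le_exp]; omega
      · rw [← hD'v v hv]; exact hx v
  have hker : ψ.ker = P.asIdeal.toAddSubgroup := by
    ext a
    rw [AddMonoidHom.mem_ker]
    have : ψ a = 0 ↔ algebraMap R M a * y ∈ lat M D := by
      show QuotientAddGroup.mk (φ a) = 0 ↔ _
      rw [QuotientAddGroup.eq_zero_iff, AddSubgroup.mem_addSubgroupOf]; rfl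
    have h2 : a ∈ Submodule.toAddSubgroup P.asIdeal ↔ P.valuation M (algebraMap R M a) < 1 :=
      (HeightOneSpectrum.valuation_lt_one_iff_mem (K := M) P a).symm
    rw [this, hlat (algebraMap R M a * y) (φ a).2, map_mul, hyP, h2]
    constructor
    · intro h; by_contra h'
      push Not at h'
      exact absurd h (not_lt.mpr (le_mul_of_one_le_left' h'))
    · intro h; exact mul_lt_of_lt_one_left (by simp) h
  have hsurj : Function.Surjective ψ := by
    intro z
    obtain ⟨⟨x, hx⟩, rfl⟩ := QuotientAddGroup.mk_surjective z
    have hxy : P.valuation M (x / y) ≤ 1 := by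
      rw [map_div₀, hyP]
      exact div_le_one_of_le₀ (hx P) zero_le
    obtain ⟨a, ha⟩ := P.exists_valuation_sub_lt_of_integer (K := M) hxy 1
    refine ⟨a, ?_⟩
    show QuotientAddGroup.mk (φ a) = _
    rw [QuotientAddGroup.eq, AddSubgroup.mem_addSubgroupOf]
    have hmem := (-φ a + ⟨x, hx⟩).2
    rw [hlat _ hmem]
    have hy00 : y ≠ 0 := by rintro rfl; simp at hy0
    have : ((-φ a + ⟨x, hx⟩ : lat M D') : M) = - ((algebraMap R M a - x / y) * y) := by
      show - (algebraMap R M a * y) + x = _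
      field_simp; ring
    rw [this, Valuation.map_neg, map_mul, hyP]
    exact mul_lt_of_lt_one_left (by simp) ha
  have e := QuotientAddGroup.quotientKerEquivOfSurjective ψ hsurj
  rw [AddSubgroup.relIndex, AddSubgroup.index, ← Nat.card_congr e.toEquiv, hker]
  rfl

end Lattice

set_option linter.all false
/-! ## Part 3: Riemann-Roch type counting -/
section Global
open IsDedekindDomain WithZero

variable (R R' : Type*) [CommRing R] [IsDedekindDomain R] [CommRing R'] [IsDedekindDomain R']
  (M : Type*) [Field M] [Algebra R M] [IsFractionRing R M] [Algebra R' M] [IsFractionRing R' M]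

abbrev Pl := HeightOneSpectrum R ⊕ HeightOneSpectrum R'

variable {R R'}

noncomputable def resCard : Pl R R' → ℕ :=
  Sum.elim (fun P => Nat.card (R ⧸ P.asIdeal)) (fun P => Nat.card (R' ⧸ P.asIdeal))

/-- degree of a place -/
noncomputable def plDeg (q : ℕ) (P : Pl R R') : ℕ := Nat.log q (resCard P)

def Ls (D : Pl R R' → ℤ) : AddSubgroup M :=
  lat M (fun v : HeightOneSpectrum R => D (.inl v)) ⊓
    lat M (fun v : HeightOneSpectrum R' => D (.inr v))

def Ss (D : Pl R R' → ℤ) : AddSubgroup M :=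
  lat M (fun v : HeightOneSpectrum R => D (.inl v)) ⊔
    lat M (fun v : HeightOneSpectrum R' => D (.inr v))

/-- degree of a divisor -/
noncomputable def dvDeg (q : ℕ) (D : Pl R R' →₀ ℤ) : ℤ := D.sum (fun P e => e * plDeg q P)

theorem dvDeg_add (q : ℕ) (D E : Pl R R' →₀ ℤ) : dvDeg q (D + E) = dvDeg q D + dvDeg q E := by
  classical
  exact Finsupp.sum_add_index' (by simp) (by intros; ring)

theorem dvDeg_single (q : ℕ) (P : Pl R R') (k : ℤ) :
    dvDeg q (Finsupp.single P k) = k * plDeg q P := by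
  simp [dvDeg]

theorem dvDeg_zero (q : ℕ) : dvDeg q (0 : Pl R R' →₀ ℤ) = 0 := by simp [dvDeg]

theorem dvDeg_neg (q : ℕ) (D : Pl R R' →₀ ℤ) : dvDeg q (-D) = - dvDeg q D := by
  have := dvDeg_add q D (-D)
  rw [add_neg_cancel, dvDeg_zero] at this; omega

theorem dvDeg_sub (q : ℕ) (D E : Pl R R' →₀ ℤ) : dvDeg q (D - E) = dvDeg q D - dvDeg q E := by
  rw [sub_eq_add_neg, dvDeg_add, dvDeg_neg]; rfl

theorem dvDeg_nsmul (q : ℕ) (D : Pl R R' →₀ ℤ) (k : ℕ) : dvDeg q (k • D) = k * dvDeg q D := by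
  induction k with
  | zero => simp [dvDeg_zero]
  | succ k ih => rw [succ_nsmul, dvDeg_add, ih]; push_cast; ring

theorem dvDeg_zsmul (q : ℕ) (D : Pl R R' →₀ ℤ) (k : ℤ) : dvDeg q (k • D) = k * dvDeg q D := by
  obtain ⟨n, rfl | rfl⟩ := k.eq_nat_or_neg
  · simp [dvDeg_nsmul]
  · simp [dvDeg_neg, dvDeg_nsmul]

theorem finsupp_step_induction {ι : Type*} (Q : (ι →₀ ℤ) → Prop)
    (h : ∀ D P, Q D ↔ Q (D + Finsupp.single P 1)) (D₀ : ι →₀ ℤ) (h0 : Q D₀) (D : ι →₀ ℤ) : Q D := by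
  classical
  have key : ∀ E : ι →₀ ℤ, ∀ D, Q D → Q (D + E) := by
    intro E
    induction E using Finsupp.induction_linear with
    | zero => intro D hD; simpa using hD
    | add f g hf hg => intro D hD; rw [← add_assoc]; exact hg _ (hf _ hD)
    | single P k =>
      induction k using Int.induction_on with
      | zero => intro D hD; simpa using hD
      | succ k ih =>
        intro D hD
        rw [Finsupp.single_add, ← add_assoc]; exact (h _ _).mp (ih D hD)
      | pred k ih =>
        intro D hD
        refine (h _ P).mpr ?_
        rw [add_assoc, ← Finsupp.single_add]; simpa using ih D hD
  simpa using key (D - D₀) D₀ h0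

variable {q : ℕ} {M}

theorem resCard_eq (hpow : ∀ P : Pl R R', ∃ k, 0 < k ∧ resCard P = q ^ k) (hq : 1 < q)
    (P : Pl R R') : resCard P = q ^ plDeg q P := by
  obtain ⟨k, _, hk⟩ := hpow P
  rw [plDeg, hk, Nat.log_pow hq]

theorem plDeg_pos (hpow : ∀ P : Pl R R', ∃ k, 0 < k ∧ resCard P = q ^ k) (hq : 1 < q)
    (P : Pl R R') : 0 < plDeg q P := by
  obtain ⟨k, h, hk⟩ := hpow P
  rw [plDeg, hk, Nat.log_pow hq]; exact h

theorem Ls_mono {D E : Pl R R' → ℤ} (h : ∀ v, D v ≤ E v) : Ls M D ≤ Ls M E :=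
  inf_le_inf (lat_mono fun _ => h _) (lat_mono fun _ => h _)

theorem Ss_mono {D E : Pl R R' → ℤ} (h : ∀ v, D v ≤ E v) : Ss M D ≤ Ss M E :=
  sup_le_sup (lat_mono fun _ => h _) (lat_mono fun _ => h _)

theorem step_relIndex (D : Pl R R' →₀ ℤ) (P : Pl R R') :
    resCard P = (Ls M D).relIndex (Ls M (D + Finsupp.single P 1 : Pl R R' →₀ ℤ)) *
      (Ss M D).relIndex (Ss M (D + Finsupp.single P 1 : Pl R R' →₀ ℤ)) := by
  classical
  have hf1 : (Function.support (fun v : HeightOneSpectrum R => D (.inl v))).Finite :=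
    Set.Finite.preimage Sum.inl_injective.injOn (D.hasFiniteSupport)
  have hf2 : (Function.support (fun v : HeightOneSpectrum R' => D (.inr v))).Finite :=
    Set.Finite.preimage Sum.inr_injective.injOn (D.hasFiniteSupport)
  rcases P with P | P
  · have e1 : (fun v : HeightOneSpectrum R => (D + Finsupp.single (Sum.inl P) 1 : Pl R R' →₀ ℤ) (.inl v))
      = (fun v : HeightOneSpectrum R => D (.inl v)) + Pi.single P 1 := by
      ext v
      simp [Finsupp.single_apply, Pi.single_apply, eq_comm]
    have e2 : (fun v : HeightOneSpectrum R' => (D + Finsupp.single (Sum.inl P) 1 : Pl R R' →₀ ℤ) (.inr v))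
      = (fun v : HeightOneSpectrum R' => D (.inr v)) := by
      ext v
      simp [Finsupp.single_apply]
    simp only [Ls, Ss, e1, e2]
    rw [← relIndex_sup_inf, relIndex_lat _ hf1]
    · rfl
    · refine lat_mono fun v => ?_
      by_cases h : v = P
      · subst h; simp
      · simp [h]
  · have e1 : (fun v : HeightOneSpectrum R' => (D + Finsupp.single (Sum.inr P) 1 : Pl R R' →₀ ℤ) (.inr v))
      = (fun v : HeightOneSpectrum R' => D (.inr v)) + Pi.single P 1 := by
      ext v
      simp [Finsupp.single_apply, Pi.single_apply, eq_comm]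
    have e2 : (fun v : HeightOneSpectrum R => (D + Finsupp.single (Sum.inr P) 1 : Pl R R' →₀ ℤ) (.inl v))
      = (fun v : HeightOneSpectrum R => D (.inl v)) := by
      ext v
      simp [Finsupp.single_apply]
    simp only [Ls, Ss, e1, e2]
    rw [inf_comm (lat M fun v : HeightOneSpectrum R => D (.inl v)), 
      inf_comm (lat M fun v : HeightOneSpectrum R => D (.inl v)), 
      sup_comm (lat M fun v : HeightOneSpectrum R => D (.inl v)), 
      sup_comm (lat M fun v : HeightOneSpectrum R => D (.inl v)), 
      ← relIndex_sup_inf, relIndex_lat _ hf2]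
    · rfl
    · refine lat_mono fun v => ?_
      by_cases h : v = P
      · subst h; simp
      · simp [h]

theorem relIndex_mul_card' {V : Type*} [AddGroup V] (H K : AddSubgroup V) (h : H ≤ K) :
    H.relIndex K * Nat.card H = Nat.card K := by
  have := AddSubgroup.relIndex_mul_relIndex ⊥ H K bot_le h
  rw [AddSubgroup.relIndex_bot_left, AddSubgroup.relIndex_bot_left] at this
  rw [← this, mul_comm]

theorem le_add_single (D : Pl R R' →₀ ℤ) (P : Pl R R') (v) :
    D v ≤ (D + Finsupp.single P 1 : Pl R R' →₀ ℤ) v := by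
  classical
  rw [Finsupp.add_apply, Finsupp.single_apply]; split_ifs <;> simp

section
variable (hpow : ∀ P : Pl R R', ∃ k, 0 < k ∧ resCard P = q ^ k) (hq : 1 < q)
include hpow hq

theorem card_Ls_ne (h0 : Nat.card (Ls M (0 : Pl R R' → ℤ)) ≠ 0) (D : Pl R R' →₀ ℤ) :
    Nat.card (Ls M D) ≠ 0 := by
  refine finsupp_step_induction (fun D => Nat.card (Ls M D) ≠ 0) ?_ 0 h0 D
  intro D P
  have h1 := relIndex_mul_card' (Ls M D) _ (Ls_mono (le_add_single D P))
  have h2 := step_relIndex (M := M) D P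
  rw [resCard_eq hpow hq] at h2
  have : q ^ plDeg q P ≠ 0 := pow_ne_zero _ (by omega)
  rw [h2] at this
  have ha := left_ne_zero_of_mul this
  simp only [← h1]
  exact ⟨fun h => mul_ne_zero ha h, fun h => right_ne_zero_of_mul h⟩

theorem index_Ss_ne (W : Pl R R' →₀ ℤ) (hW : Ss M W = ⊤) (D : Pl R R' →₀ ℤ) :
    (Ss M D).index ≠ 0 := by
  refine finsupp_step_induction (fun D => (Ss M D).index ≠ 0) ?_ W (by simp [hW]) D
  intro D P
  have h1 := AddSubgroup.relIndex_mul_index (Ss_mono (M := M) (le_add_single D P))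
  have h2 := step_relIndex (M := M) D P
  rw [resCard_eq hpow hq] at h2
  have : q ^ plDeg q P ≠ 0 := pow_ne_zero _ (by omega)
  rw [h2] at this
  have ha := right_ne_zero_of_mul this
  simp only [← h1]
  exact ⟨fun h => right_ne_zero_of_mul h, fun h => mul_ne_zero ha h⟩

/-- Riemann's theorem -/
theorem card_Ls (h0 : Nat.card (Ls M (0 : Pl R R' → ℤ)) ≠ 0) (W : Pl R R' →₀ ℤ)
    (hW : Ss M W = ⊤) (l : ℕ) (hl : Nat.card (Ls M W) = q ^ l) (D : Pl R R' →₀ ℤ) :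
    (Nat.card (Ls M D) : ℚ) =
      (q : ℚ) ^ (dvDeg q D - dvDeg q W + l) * ((Ss M D).index : ℚ) := by
  have hq0 : (q : ℚ) ≠ 0 := by exact_mod_cast (by omega : q ≠ 0)
  refine finsupp_step_induction (fun D => (Nat.card (Ls M D) : ℚ) =
      (q : ℚ) ^ (dvDeg q D - dvDeg q W + l) * ((Ss M D).index : ℚ)) ?_ W ?_ D
  · intro D P
    have h1 := AddSubgroup.relIndex_mul_index (Ss_mono (M := M) (le_add_single D P))
    have h1' := relIndex_mul_card' (Ls M D) _ (Ls_mono (le_add_single D P))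
    have h2 := step_relIndex (M := M) D P
    rw [resCard_eq hpow hq] at h2
    have : q ^ plDeg q P ≠ 0 := pow_ne_zero _ (by omega)
    rw [h2] at this
    have ha := left_ne_zero_of_mul this
    have hb := right_ne_zero_of_mul this
    have e : dvDeg q (D + Finsupp.single P 1) - dvDeg q W + l =
      (dvDeg q D - dvDeg q W + l) + (plDeg q P : ℕ) := by
      rw [dvDeg_add, dvDeg_single]; ring
    rw [e, zpow_add₀ hq0 (dvDeg q D - dvDeg q W + l), zpow_natCast (q : ℚ) (plDeg q P)]
    set a := (Ls M D).relIndex (Ls M (D + Finsupp.single P 1 : Pl R R' →₀ ℤ))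
    set b := (Ss M D).relIndex (Ss M (D + Finsupp.single P 1 : Pl R R' →₀ ℤ))
    have h2' : (q : ℚ) ^ plDeg q P = a * b := by exact_mod_cast h2
    rw [← h1, ← h1', h2']
    have ha' : (a : ℚ) ≠ 0 := by exact_mod_cast ha
    rw [Nat.cast_mul, Nat.cast_mul]
    constructor
    · intro h; rw [h]; ring
    · intro h
      apply mul_left_cancel₀ ha'
      rw [h]; ring
  · simp [hW, hl]

end

/-- minus the divisor of `x` -/
noncomputable def pdiv (R R' : Type*) [CommRing R] [IsDedekindDomain R] [CommRing R']
    [IsDedekindDomain R'] {M : Type*} [Field M] [Algebra R M] [IsFractionRing R M]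
    [Algebra R' M] [IsFractionRing R' M] (x : M) : Pl R R' →₀ ℤ :=
  Finsupp.ofSupportFinite (Sum.elim (vlog R x) (vlog R' x)) (by
    refine ((vlog_finite (R := R) x).image Sum.inl |>.union
      ((vlog_finite (R := R') x).image Sum.inr)).subset ?_
    rintro (v | v) hv
    · left; exact ⟨v, hv, rfl⟩
    · right; exact ⟨v, hv, rfl⟩)

theorem pdiv_inl (x : M) (v : HeightOneSpectrum R) : pdiv R R' x (.inl v) = vlog R x v := rfl
theorem pdiv_inr (x : M) (v : HeightOneSpectrum R') : pdiv R R' x (.inr v) = vlog R' x v := rfl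

theorem pdiv_mul {x y : M} (hx : x ≠ 0) (hy : y ≠ 0) :
    pdiv R R' (x * y) = pdiv R R' x + pdiv R R' y := by
  ext (v | v)
  · simp [pdiv_inl, vlog_mul hx hy]
  · simp [pdiv_inr, vlog_mul hx hy]

theorem pdiv_inv {x : M} : pdiv R R' (x⁻¹) = - pdiv R R' x := by
  ext (v | v)
  · simp [pdiv_inl, vlog_inv]
  · simp [pdiv_inr, vlog_inv]

theorem pdiv_one : pdiv R R' (1 : M) = 0 := by
  ext (v | v)
  · simp [pdiv_inl, vlog]
  · simp [pdiv_inr, vlog]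

theorem mem_Ls_iff {D : Pl R R' → ℤ} {x : M} (hx : x ≠ 0) :
    x ∈ Ls M D ↔ ∀ v, pdiv R R' x v ≤ D v := by
  simp only [Ls, AddSubgroup.mem_inf, mem_lat_iff hx, Sum.forall, pdiv_inl, pdiv_inr]

theorem mul_mem_Ls {D E : Pl R R' → ℤ} {x y : M} (hx : x ∈ Ls M D) (hy : y ∈ Ls M E) :
    x * y ∈ Ls M (D + E) :=
  ⟨mul_mem_lat hx.1 hy.1, mul_mem_lat hx.2 hy.2⟩

theorem Ls_scale {x : M} (hx : x ≠ 0) (D : Pl R R' → ℤ) (y : M) :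
    x * y ∈ Ls M (⇑(pdiv R R' x) + D) ↔ y ∈ Ls M D :=
  and_congr (mul_mem_lat_iff hx) (mul_mem_lat_iff hx)

theorem Ls_scale_map {x : M} (hx : x ≠ 0) (D : Pl R R' → ℤ) :
    Ls M (⇑(pdiv R R' x) + D) = (Ls M D).map (AddMonoidHom.mulLeft x) := by
  ext y
  rw [AddSubgroup.mem_map]
  constructor
  · intro h
    refine ⟨x⁻¹ * y, ?_, by simp [mul_inv_cancel_left₀ hx]⟩
    rw [← Ls_scale hx, mul_inv_cancel_left₀ hx]; exact h
  · rintro ⟨z, hz, rfl⟩; exact (Ls_scale hx D z).mpr hz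

theorem lat_scale_map {x : M} (hx : x ≠ 0) (D : HeightOneSpectrum R → ℤ) :
    lat M (vlog R x + D) = (lat M D).map (AddMonoidHom.mulLeft x) := by
  ext y
  rw [AddSubgroup.mem_map]
  constructor
  · intro h
    refine ⟨x⁻¹ * y, ?_, by simp [mul_inv_cancel_left₀ hx]⟩
    rw [← mul_mem_lat_iff hx, mul_inv_cancel_left₀ hx]; exact h
  · rintro ⟨z, hz, rfl⟩; exact (mul_mem_lat_iff hx).mpr hz

theorem Ss_scale_map {x : M} (hx : x ≠ 0) (D : Pl R R' → ℤ) :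
    Ss M (⇑(pdiv R R' x) + D) = (Ss M D).map (AddMonoidHom.mulLeft x) := by
  rw [Ss, Ss, AddSubgroup.map_sup, ← lat_scale_map hx, ← lat_scale_map hx]
  rfl

theorem mulLeft_bij {x : M} (hx : x ≠ 0) : Function.Bijective (AddMonoidHom.mulLeft x) :=
  ⟨fun a b h => mul_left_cancel₀ hx h, fun y => ⟨x⁻¹ * y, mul_inv_cancel_left₀ hx y⟩⟩

section
variable (hpow : ∀ P : Pl R R', ∃ k, 0 < k ∧ resCard P = q ^ k) (hq : 1 < q)
  (h0 : Nat.card (Ls M (0 : Pl R R' → ℤ)) = q) (W : Pl R R' →₀ ℤ)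
  (hW : Ss M W = ⊤) (l : ℕ) (hl : Nat.card (Ls M W) = q ^ l)
include hpow hq h0 hW hl

/-- product formula -/
theorem dvDeg_pdiv {x : M} (hx : x ≠ 0) : dvDeg q (pdiv R R' x) = 0 := by
  have h0' : Nat.card (Ls M (0 : Pl R R' → ℤ)) ≠ 0 := by omega
  have h1 := card_Ls hpow hq h0' W hW l hl (pdiv R R' x)
  have h2 := card_Ls hpow hq h0' W hW l hl 0
  have e1 : Nat.card (Ls M (pdiv R R' x : Pl R R' → ℤ)) = Nat.card (Ls M (0 : Pl R R' → ℤ)) := by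
    have := Ls_scale_map hx (0 : Pl R R' → ℤ)
    rw [add_zero] at this
    rw [this]
    exact (Nat.card_congr ((Ls M (0 : Pl R R' → ℤ)).equivMapOfInjective _
      (mulLeft_bij hx).1).toEquiv).symm
  have e2 : (Ss M (pdiv R R' x : Pl R R' → ℤ)).index = (Ss M (0 : Pl R R' → ℤ)).index := by
    have := Ss_scale_map hx (0 : Pl R R' → ℤ)
    rw [add_zero] at this
    rw [this]
    exact AddSubgroup.index_map_of_bijective (mulLeft_bij hx) _
  rw [e1, e2] at h1
  have hi := index_Ss_ne hpow hq W hW 0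
  simp only [Finsupp.coe_zero] at h2 hi
  rw [h1] at h2
  have h3 := mul_right_cancel₀ (by exact_mod_cast hi) h2
  have h4 := (zpow_right_inj₀ (by exact_mod_cast (by omega : 0 < q)) (by exact_mod_cast hq.ne')).mp h3
  rw [dvDeg_zero] at h4; omega

theorem Ss_eq_top (D : Pl R R' →₀ ℤ) (hD : 2 * dvDeg q W - l + 1 ≤ dvDeg q D) : Ss M D = ⊤ := by
  have h0' : Nat.card (Ls M (0 : Pl R R' → ℤ)) ≠ 0 := by omega
  have h1 := card_Ls hpow hq h0' W hW l hl (D - W)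
  rw [dvDeg_sub] at h1
  have hq1 : (1 : ℚ) < q := by exact_mod_cast hq
  have hi : 1 ≤ ((Ss M (D - W : Pl R R' →₀ ℤ)).index : ℚ) := by
    exact_mod_cast Nat.one_le_iff_ne_zero.mpr (index_Ss_ne hpow hq W hW (D - W))
  have h2 : (1 : ℚ) < Nat.card (Ls M (D - W : Pl R R' →₀ ℤ)) := by
    rw [h1]
    have : (1 : ℚ) < (q : ℚ) ^ (dvDeg q D - dvDeg q W - dvDeg q W + l) :=
      one_lt_zpow₀ hq1 (by omega)
    nlinarith
  have h3 : 1 < Nat.card (Ls M (D - W : Pl R R' →₀ ℤ)) := by exact_mod_cast h2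
  have : Nontrivial (Ls M (D - W : Pl R R' →₀ ℤ)) := by
    have : Finite (Ls M (D - W : Pl R R' →₀ ℤ)) := Nat.finite_of_card_ne_zero (by omega)
    exact Finite.one_lt_card_iff_nontrivial.mp h3
  obtain ⟨⟨s, hs⟩, hs0⟩ := exists_ne (0 : Ls M (D - W : Pl R R' →₀ ℤ))
  have hs0' : s ≠ 0 := fun h => hs0 (Subtype.ext h)
  rw [mem_Ls_iff hs0'] at hs
  rw [eq_top_iff]
  calc ⊤ = (Ss M W).map (AddMonoidHom.mulLeft s) := by
        rw [hW, AddSubgroup.map_top_of_surjective _ (mulLeft_bij hs0').2]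
    _ = Ss M (⇑(pdiv R R' s) + ⇑W) := (Ss_scale_map hs0' _).symm
    _ ≤ Ss M D := Ss_mono fun v => by
        have := hs v
        simp only [Finsupp.coe_sub, Pi.sub_apply, Pi.add_apply] at this ⊢; omega

end

end Global

set_option linter.all false
section Global2
open IsDedekindDomain WithZero

variable {R R' : Type*} [CommRing R] [IsDedekindDomain R] [CommRing R'] [IsDedekindDomain R']
  {M : Type*} [Field M] [Algebra R M] [IsFractionRing R M] [Algebra R' M] [IsFractionRing R' M]
  {q : ℕ}

/-- integer divisor of an effective divisor -/
noncomputable def toDiv (E : Pl R R' →₀ ℕ) : Pl R R' →₀ ℤ := Finsupp.mapRange (fun n : ℕ => (n : ℤ)) rfl E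

theorem toDiv_apply (E : Pl R R' →₀ ℕ) (P) : toDiv E P = E P := rfl

theorem dvDeg_toDiv (E : Pl R R' →₀ ℕ) : dvDeg q (toDiv E) = effDeg (plDeg q) E := by
  rw [dvDeg, toDiv, Finsupp.sum_mapRange_index (by simp), effDeg, Finsupp.sum, Finsupp.sum]
  push_cast; rfl

theorem toDiv_inj {E E' : Pl R R' →₀ ℕ} (h : toDiv E = toDiv E') : E = E' := by
  ext P
  have := DFunLike.congr_fun h P
  simpa [toDiv_apply] using this

theorem exists_toDiv (D : Pl R R' →₀ ℤ) (hD : ∀ P, 0 ≤ D P) : ∃ E, toDiv E = D := by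
  refine ⟨D.mapRange Int.toNat rfl, ?_⟩
  ext P
  simp [toDiv_apply, hD P]

/-- principal divisors -/
def prin (R R' M : Type*) [CommRing R] [IsDedekindDomain R] [CommRing R'] [IsDedekindDomain R']
  [Field M] [Algebra R M] [IsFractionRing R M] [Algebra R' M] [IsFractionRing R' M] :
    AddSubgroup (Pl R R' →₀ ℤ) where
  carrier := {D | ∃ x : M, x ≠ 0 ∧ pdiv R R' x = D}
  zero_mem' := ⟨1, one_ne_zero, pdiv_one⟩
  add_mem' := by
    rintro _ _ ⟨x, hx, rfl⟩ ⟨y, hy, rfl⟩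
    exact ⟨x * y, mul_ne_zero hx hy, pdiv_mul hx hy⟩
  neg_mem' := by
    rintro _ ⟨x, hx, rfl⟩
    exact ⟨x⁻¹, inv_ne_zero hx, pdiv_inv⟩

section
variable (hpow : ∀ P : Pl R R', ∃ k, 0 < k ∧ resCard P = q ^ k) (hq : 1 < q)
  (h0 : Nat.card (Ls M (0 : Pl R R' → ℤ)) = q) (W : Pl R R' →₀ ℤ)
  (hW : Ss M W = ⊤) (l : ℕ) (hl : Nat.card (Ls M W) = q ^ l)
include hpow hq

theorem dv_eq_zero_of_nonpos (D : Pl R R' →₀ ℤ) (h : ∀ P, D P ≤ 0) (hd : dvDeg q D = 0) : D = 0 := by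
  ext P
  by_contra hP
  have : dvDeg q D < 0 := by
    rw [dvDeg, Finsupp.sum]
    refine Finset.sum_neg' (fun Q _ => mul_nonpos_of_nonpos_of_nonneg (h Q) (by positivity))
      ⟨P, by simpa using hP, ?_⟩
    have h1 : D P < 0 := lt_of_le_of_ne (h P) hP
    have h2 : (0 : ℤ) < plDeg q P := by exact_mod_cast plDeg_pos hpow hq P
    exact mul_neg_of_neg_of_pos h1 h2
  omega

variable {S : ℕ → Finset (Pl R R')} (hS : ∀ d P, P ∈ S d ↔ plDeg q P ≤ d)
include h0 hW hl hS

open Classical in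
theorem class_count (D : Pl R R' →₀ ℤ) (d : ℕ) (hd : dvDeg q D = d) :
    Nat.card (Ls M D) - 1 =
      (q - 1) * ((effSet (plDeg q) S d).filter (fun E => toDiv E - D ∈ prin R R' M)).card := by
  have hdeg := plDeg_pos hpow hq
  have hfin : ∀ D : Pl R R' →₀ ℤ, (Ls M D : Set M).Finite := fun D => by
    have : Finite (Ls M D) := Nat.finite_of_card_ne_zero (card_Ls_ne hpow hq (by omega) D)
    exact Set.toFinite _
  have hpd : ∀ u : M, u ≠ 0 → u ∈ Ls M (0 : Pl R R' → ℤ) → pdiv R R' u = 0 := by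
    intro u hu hu0
    rw [mem_Ls_iff hu] at hu0
    exact dv_eq_zero_of_nonpos hpow hq _ hu0 (dvDeg_pdiv hpow hq h0 W hW l hl hu)
  have hcard : ∀ D : Pl R R' →₀ ℤ, ((hfin D).toFinset.erase 0).card = Nat.card (Ls M D) - 1 := by
    intro D
    rw [Finset.card_erase_of_mem (by simp [zero_mem])]
    rw [← Set.ncard_eq_toFinset_card _ (hfin D)]; rfl
  have hex : ∀ s : M, s ≠ 0 → s ∈ Ls M D → ∃ E, toDiv E = D - pdiv R R' s := by
    intro s hs hsD
    rw [mem_Ls_iff hs] at hsD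
    exact exists_toDiv _ fun P => by have := hsD P; simp; omega
  choose! φ hφ using hex
  rw [← hcard, Finset.card_eq_sum_card_fiberwise (f := φ) (t :=
    (effSet (plDeg q) S d).filter (fun E => toDiv E - D ∈ prin R R' M)), Finset.sum_const_nat
      (m := q - 1), mul_comm]
  · intro E hE
    rw [Finset.mem_filter, mem_effSet hdeg hS] at hE
    obtain ⟨hEd, x, hx, hxE⟩ := hE
    have hx' : pdiv R R' x⁻¹ = D - toDiv E := by rw [pdiv_inv, hxE]; abel
    have hx0 := inv_ne_zero hx
    have h00 : ((hfin 0).toFinset.erase 0).card = q - 1 := by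
      rw [hcard, show Nat.card (Ls M ((0 : Pl R R' →₀ ℤ) : Pl R R' → ℤ)) = q from h0]
    rw [← h00]
    symm
    refine Finset.card_bij (fun u _ => x⁻¹ * u) ?_ ?_ ?_
    · intro u hu
      simp only [Finset.mem_erase, Set.Finite.mem_toFinset, SetLike.mem_coe] at hu
      have hpu := hpd u hu.1 hu.2
      have hne := mul_ne_zero hx0 hu.1
      have hpm : pdiv R R' (x⁻¹ * u) = D - toDiv E := by rw [pdiv_mul hx0 hu.1, hpu, hx', add_zero]
      have hmem : x⁻¹ * u ∈ Ls M D := by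
        rw [mem_Ls_iff hne, hpm]
        intro P; simp [toDiv_apply]
      simp only [Finset.mem_filter, Finset.mem_erase, Set.Finite.mem_toFinset, SetLike.mem_coe]
      refine ⟨⟨hne, hmem⟩, toDiv_inj ?_⟩
      rw [hφ _ hne hmem, hpm]; abel
    · intro u _ u' _ h; exact mul_left_cancel₀ hx0 h
    · intro s hs
      simp only [Finset.mem_filter, Finset.mem_erase, Set.Finite.mem_toFinset, SetLike.mem_coe] at hs
      obtain ⟨⟨hs0, hsD⟩, hsE⟩ := hs
      refine ⟨x * s, ?_, by rw [inv_mul_cancel_left₀ hx]⟩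
      have h1 := hφ s hs0 hsD
      rw [hsE] at h1
      have h2 : pdiv R R' (x * s) = 0 := by
        rw [pdiv_mul hx hs0, hxE, h1]; abel
      simp only [Finset.mem_erase, Set.Finite.mem_toFinset, SetLike.mem_coe]
      refine ⟨mul_ne_zero hx hs0, ?_⟩
      rw [mem_Ls_iff (mul_ne_zero hx hs0), h2]; simp
  · intro s hs
    simp only [Finset.coe_erase, Set.Finite.coe_toFinset, Set.mem_diff, SetLike.mem_coe, Set.mem_singleton_iff] at hs
    rw [Finset.mem_coe, Finset.mem_filter, mem_effSet hdeg hS]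
    have h1 := hφ s hs.2 hs.1
    constructor
    · have h2 := dvDeg_toDiv (q := q) (φ s)
      rw [h1, dvDeg_sub, dvDeg_pdiv hpow hq h0 W hW l hl hs.2, hd] at h2
      simp at h2; omega
    · rw [h1]
      exact ⟨s⁻¹, inv_ne_zero hs.2, by rw [pdiv_inv]; abel⟩

theorem eff_count (δ : Pl R R' →₀ ℤ) (hδ : dvDeg q δ = 1) (hW0 : 0 ≤ dvDeg q W) :
    ∃ h : ℕ, ∀ d : ℕ, 2 * dvDeg q W - l + 1 ≤ d → ∃ k : ℕ, (k : ℤ) = d - dvDeg q W + l ∧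
      (q - 1) * (effSet (plDeg q) S d).card = h * (q ^ k - 1) := by
  classical
  have hdeg := plDeg_pos hpow hq
  set Z : Set ((Pl R R' →₀ ℤ) ⧸ prin R R' M) := QuotientAddGroup.mk '' {D | dvDeg q D = 0} with hZ
  refine ⟨Z.ncard, fun d hd => ?_⟩
  obtain ⟨k, hk⟩ : ∃ k : ℕ, (k : ℤ) = d - dvDeg q W + l := ⟨(d - dvDeg q W + l).toNat, by omega⟩
  have hk1 : 1 ≤ k := by omega
  refine ⟨k, hk, ?_⟩
  have hcardL : ∀ D : Pl R R' →₀ ℤ, dvDeg q D = d → Nat.card (Ls M D) = q ^ k := by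
    intro D hD
    have h1 := card_Ls hpow hq (by omega) W hW l hl D
    rw [Ss_eq_top hpow hq h0 W hW l hl D (by omega), hD, ← hk] at h1
    simp at h1
    exact_mod_cast h1
  let φ : (Pl R R' →₀ ℕ) → ((Pl R R' →₀ ℤ) ⧸ prin R R' M) :=
    fun E => QuotientAddGroup.mk (toDiv E - d • δ)
  have hq2 : 1 < q ^ k := Nat.one_lt_pow (by omega) hq
  have hfib : ∀ D : Pl R R' →₀ ℤ, dvDeg q D = 0 →
      (q - 1) * ((effSet (plDeg q) S d).filter (fun E => φ E = QuotientAddGroup.mk D)).card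
        = q ^ k - 1 := by
    intro D hD
    have hD' : dvDeg q (D + d • δ) = d := by rw [dvDeg_add, dvDeg_nsmul, hD, hδ]; ring
    rw [← hcardL _ hD', class_count hpow hq h0 W hW l hl hS _ d hD']
    congr 2
    refine Finset.filter_congr fun E _ => ?_
    show QuotientAddGroup.mk _ = QuotientAddGroup.mk _ ↔ _
    rw [eq_comm, QuotientAddGroup.eq]
    rw [show -D + (toDiv E - d • δ) = toDiv E - (D + d • δ) by abel]
  have himg : ((effSet (plDeg q) S d).image φ : Set _) = Z := by
    ext z
    simp only [Finset.coe_image, Set.mem_image, Finset.mem_coe, mem_effSet hdeg hS, hZ, Set.mem_ofPred_eq]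
    constructor
    · rintro ⟨E, hE, rfl⟩
      exact ⟨_, by rw [dvDeg_sub, dvDeg_nsmul, hδ, dvDeg_toDiv, hE]; ring, rfl⟩
    · rintro ⟨D, hD, rfl⟩
      have h1 := hfib D hD
      have : 0 < ((effSet (plDeg q) S d).filter (fun E => φ E = QuotientAddGroup.mk D)).card := by
        rcases Nat.eq_zero_or_pos ((effSet (plDeg q) S d).filter (fun E => φ E = QuotientAddGroup.mk D)).card with h | h
        · rw [h] at h1; omega
        · exact h
      obtain ⟨E, hE⟩ := Finset.card_pos.mp this
      rw [Finset.mem_filter, mem_effSet hdeg hS] at hE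
      exact ⟨E, hE⟩
  rw [Finset.card_eq_sum_card_image φ, Finset.mul_sum, ← himg, Set.ncard_coe_finset]
  rw [Finset.sum_const_nat (m := q ^ k - 1)]
  intro z hz
  have : z ∈ Z := by rw [← himg]; exact hz
  obtain ⟨D, hD, rfl⟩ := this
  exact hfib D hD

theorem weil_abstract (c : ℕ) (hc : 2 * dvDeg q W - l + 1 ≤ c) (hW0 : 0 ≤ dvDeg q W) (C : ℝ)
    (hC : ∀ m, 1 ≤ m → |(ptCount (plDeg q) S m : ℝ) - q ^ m| ≤ C * (Real.sqrt q) ^ m) :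
    (q : ℝ) + 1 - (c + 1) * Real.sqrt q ≤ ptCount (plDeg q) S 1 := by
  classical
  have hdeg := plDeg_pos hpow hq
  have hq1 : (1 : ℝ) < q := by exact_mod_cast hq
  have hs1 : 1 < Real.sqrt q := by
    rw [← Real.sqrt_one]; exact Real.sqrt_lt_sqrt (by norm_num) hq1
  have hs0 : 0 < Real.sqrt q := by linarith
  -- points exist in all large degrees
  obtain ⟨m₀, hm₀⟩ := pow_unbounded_of_one_lt (max C 1) hs1
  have hpt : ∀ m, m₀ ≤ m → 1 ≤ m → ∃ P : Pl R R', plDeg q P ∣ m := by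
    intro m hm hm1
    by_contra hno
    push Not at hno
    have h1 := hC m hm1
    have : ptCount (plDeg q) S m = 0 := by
      rw [ptCount, Finset.filter_false_of_mem (fun P _ => hno P), Finset.sum_empty]
    rw [this, Nat.cast_zero, zero_sub, abs_neg, abs_of_nonneg (by positivity)] at h1
    have h2 : (q : ℝ) ^ m = Real.sqrt q ^ m * Real.sqrt q ^ m := by
      rw [← mul_pow, Real.mul_self_sqrt (by positivity)]
    rw [h2] at h1
    have h3 := le_of_mul_le_mul_right h1 (pow_pos hs0 m)
    have h4 : Real.sqrt q ^ m₀ ≤ Real.sqrt q ^ m := pow_le_pow_right₀ hs1.le hm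
    linarith [le_max_left C 1]
  obtain ⟨P₁, hP₁⟩ := hpt (m₀ + 1) (by omega) (by omega)
  obtain ⟨P₂, hP₂⟩ := hpt (m₀ + 2) (by omega) (by omega)
  obtain ⟨a, ha⟩ := hP₁
  obtain ⟨b, hb⟩ := hP₂
  have hδ : dvDeg q (Finsupp.single P₂ (b : ℤ) - Finsupp.single P₁ (a : ℤ)) = 1 := by
    rw [dvDeg_sub, dvDeg_single, dvDeg_single]
    have ha' : ((m₀ + 1 : ℕ) : ℤ) = plDeg q P₁ * a := by exact_mod_cast ha
    have hb' : ((m₀ + 2 : ℕ) : ℤ) = plDeg q P₂ * b := by exact_mod_cast hb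
    push_cast at ha' hb'
    linarith
  obtain ⟨h, hh⟩ := eff_count hpow hq h0 W hW l hl hS _ hδ hW0
  have hrec : ∀ d, c ≤ d → ((effSet (plDeg q) S (d + 2)).card : ℤ) -
      (q + 1) * (effSet (plDeg q) S (d + 1)).card + q * (effSet (plDeg q) S d).card = 0 := by
    intro d hd
    obtain ⟨k, hk, e⟩ := hh d (by omega)
    obtain ⟨k1, hk1, e1⟩ := hh (d + 1) (by push_cast; omega)
    obtain ⟨k2, hk2, e2⟩ := hh (d + 2) (by push_cast; omega)
    have : k1 = k + 1 := by push_cast at hk1; omega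
    have : k2 = k + 2 := by push_cast at hk2; omega
    subst k1 k2
    have hz : ∀ j, ((q ^ j - 1 : ℕ) : ℤ) = (q : ℤ) ^ j - 1 := by
      intro j; rw [Nat.cast_sub (Nat.one_le_pow _ _ (by omega))]; push_cast; rfl
    have hqz : ((q - 1 : ℕ) : ℤ) = (q : ℤ) - 1 := by rw [Nat.cast_sub (by omega)]; rfl
    have e' := congrArg (Nat.cast (R := ℤ)) e
    have e1' := congrArg (Nat.cast (R := ℤ)) e1
    have e2' := congrArg (Nat.cast (R := ℤ)) e2
    rw [Nat.cast_mul, Nat.cast_mul, hz, hqz] at e' e1' e2'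
    have hne : (q : ℤ) - 1 ≠ 0 := by omega
    apply mul_left_cancel₀ hne
    linear_combination e2' - (q + 1) * e1' + q * e'
  obtain ⟨s, hsc, hs⟩ := zeta_roots q (fun d => (effSet (plDeg q) S d).card) (ptCount (plDeg q) S)
    (effSet_identity hdeg hS) (effSet_zero hdeg hS) c hrec
  have hroot : ∀ a ∈ s, ‖a‖ ≤ Real.sqrt q := by
    refine root_bound s (Real.sqrt q) (C + 1) hs0 fun j hj => ?_
    have h1 := hs j hj
    have h2 : (s.map (fun a => a ^ j)).sum = (((q : ℝ) ^ j - ptCount (plDeg q) S j + 1 : ℝ) : ℂ) := by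
      push_cast; linear_combination h1
    rw [h2, Complex.norm_real, Real.norm_eq_abs]
    calc _ ≤ |(q : ℝ) ^ j - ptCount (plDeg q) S j| + |1| := abs_add_le _ _
      _ ≤ C * Real.sqrt q ^ j + Real.sqrt q ^ j := by
        rw [abs_sub_comm, abs_one]
        exact add_le_add (hC j hj) (one_le_pow₀ hs1.le)
      _ = _ := by ring
  have h1 := hs 1 le_rfl
  have hsum : ‖(s.map (fun a => a ^ 1)).sum‖ ≤ (c + 1) * Real.sqrt q := by
    have h2 : ∀ t : Multiset ℂ, (∀ a ∈ t, ‖a‖ ≤ Real.sqrt q) →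
        ‖(t.map (fun a => a ^ 1)).sum‖ ≤ t.card * Real.sqrt q := by
      intro t
      induction t using Multiset.induction_on with
      | empty => simp
      | cons a t ih =>
        intro h
        rw [Multiset.map_cons, Multiset.sum_cons, Multiset.card_cons]
        refine (norm_add_le _ _).trans ?_
        have := ih (fun b hb => h b (by simp [hb]))
        have := h a (by simp)
        push_cast; rw [pow_one]; linarith
    refine (h2 s hroot).trans ?_
    have : (s.card : ℝ) ≤ c + 1 := by exact_mod_cast hsc
    exact mul_le_mul_of_nonneg_right this hs0.le
  have h3 : (s.map (fun a => a ^ 1)).sum = (((q : ℝ) + 1 - ptCount (plDeg q) S 1 : ℝ) : ℂ) := by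
    push_cast; linear_combination h1
  rw [h3, Complex.norm_real, Real.norm_eq_abs] at hsum
  linarith [le_abs_self ((q : ℝ) + 1 - ptCount (plDeg q) S 1)]

end
end Global2

set_option linter.all false
/-! ## Part 4a: the ring at infinity -/
section Infty
open Polynomial
variable (F : Type*) [Field F]

/-- the local ring at infinity of the rational function field -/
def Oinf : Subalgebra F (RatFunc F) where
  carrier := {x | x.intDegree ≤ 0}
  mul_mem' := by
    intro x y hx hy
    simp only [Set.mem_ofPred_eq] at *
    rcases eq_or_ne x 0 with rfl | hx0
    · simp
    rcases eq_or_ne y 0 with rfl | hy0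
    · simp
    rw [RatFunc.intDegree_mul hx0 hy0]; omega
  add_mem' := by
    intro x y hx hy
    simp only [Set.mem_ofPred_eq] at *
    rcases eq_or_ne y 0 with rfl | hy0
    · simpa using hx
    rcases eq_or_ne (x + y) 0 with h | h
    · simp [h]
    exact (RatFunc.intDegree_add_le hy0 h).trans (max_le hx hy)
  algebraMap_mem' := by
    intro c
    have : (algebraMap F (RatFunc F)) c = RatFunc.C c := rfl
    simp [this]

variable {F}
theorem mem_Oinf {x : RatFunc F} : x ∈ Oinf F ↔ x.intDegree ≤ 0 := Iff.rfl

theorem intDegree_inv' (x : RatFunc F) : x⁻¹.intDegree = - x.intDegree := by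
  rcases eq_or_ne x 0 with rfl | hx
  · simp
  have := RatFunc.intDegree_mul hx (inv_ne_zero hx)
  rw [mul_inv_cancel₀ hx, RatFunc.intDegree_one] at this
  omega

theorem intDegree_pow' (x : RatFunc F) (k : ℕ) : (x ^ k).intDegree = k * x.intDegree := by
  rcases eq_or_ne x 0 with rfl | hx
  · rcases k with _ | k <;> simp
  induction k with
  | zero => simp
  | succ k ih => rw [pow_succ, RatFunc.intDegree_mul (pow_ne_zero _ hx) hx, ih]; push_cast; ring

/-- the uniformizer `1/t` -/
noncomputable def unif (F : Type*) [Field F] : Oinf F := ⟨(RatFunc.X)⁻¹, by rw [mem_Oinf, intDegree_inv']; simp⟩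

theorem unif_coe : ((unif F : Oinf F) : RatFunc F) = RatFunc.X⁻¹ := rfl

theorem isUnit_Oinf {x : Oinf F} : IsUnit x ↔ x ≠ 0 ∧ (x : RatFunc F).intDegree = 0 := by
  constructor
  · intro h
    obtain ⟨y, hy⟩ := h.exists_right_inv
    have hx : x ≠ 0 := h.ne_zero
    have hy0 : y ≠ 0 := by rintro rfl; simp at hy
    have h1 := congrArg (fun z : Oinf F => (z : RatFunc F).intDegree) hy
    simp only [MulMemClass.coe_mul, OneMemClass.coe_one, RatFunc.intDegree_one] at h1
    rw [RatFunc.intDegree_mul (by simpa using hx) (by simpa using hy0)] at h1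
    have h2 := mem_Oinf.mp x.2
    have h3 := mem_Oinf.mp y.2
    exact ⟨hx, by omega⟩
  · rintro ⟨hx, h⟩
    have hx' : (x : RatFunc F) ≠ 0 := by simpa using hx
    refine IsUnit.of_mul_eq_one ⟨(x : RatFunc F)⁻¹, by rw [mem_Oinf, intDegree_inv']; omega⟩ ?_
    ext; simp [hx']

theorem unif_ne_zero : unif F ≠ 0 := by
  intro h
  have := congrArg (fun z : Oinf F => (z : RatFunc F)) h
  exact RatFunc.X_ne_zero (by simpa [unif_coe] using this)

theorem unif_irreducible : Irreducible (unif F) := by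
  constructor
  · rw [isUnit_Oinf, unif_coe, intDegree_inv']; simp
  · intro a b hab
    have ha : a ≠ 0 := by rintro rfl; exact unif_ne_zero (by simpa using hab)
    have hb : b ≠ 0 := by rintro rfl; exact unif_ne_zero (by simpa using hab)
    have h1 := congrArg (fun z : Oinf F => (z : RatFunc F).intDegree) hab
    simp only [MulMemClass.coe_mul, unif_coe] at h1
    rw [RatFunc.intDegree_mul (by simpa using ha) (by simpa using hb), intDegree_inv', RatFunc.intDegree_X] at h1
    rw [isUnit_Oinf, isUnit_Oinf]
    have h2 := mem_Oinf.mp a.2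
    have h3 := mem_Oinf.mp b.2
    by_cases h : (a : RatFunc F).intDegree = 0
    · exact Or.inl ⟨ha, h⟩
    · exact Or.inr ⟨hb, by omega⟩

instance : IsDiscreteValuationRing (Oinf F) := by
  refine IsDiscreteValuationRing.ofHasUnitMulPowIrreducibleFactorization ⟨unif F, unif_irreducible, ?_⟩
  intro x hx
  have hx' : (x : RatFunc F) ≠ 0 := by simpa using hx
  have h0 := mem_Oinf.mp x.2
  obtain ⟨k, hk⟩ : ∃ k : ℕ, (x : RatFunc F).intDegree = - k := ⟨(- (x : RatFunc F).intDegree).toNat, by omega⟩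
  have hX : (RatFunc.X : RatFunc F) ≠ 0 := RatFunc.X_ne_zero
  have hd : ((x : RatFunc F) * RatFunc.X ^ k).intDegree = 0 := by
    rw [RatFunc.intDegree_mul hx' (pow_ne_zero _ hX), intDegree_pow', RatFunc.intDegree_X, hk]; ring
  have hu : IsUnit (⟨(x : RatFunc F) * RatFunc.X ^ k, by rw [mem_Oinf]; omega⟩ : Oinf F) := by
    rw [isUnit_Oinf]
    refine ⟨?_, hd⟩
    intro h
    have := congrArg (fun z : Oinf F => (z : RatFunc F)) h
    simp [hX, hx] at this
  refine ⟨k, hu.unit, ?_⟩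
  ext
  simp [unif_coe]
  field_simp

instance : IsFractionRing (Oinf F) (RatFunc F) := by
  refine IsFractionRing.of_field _ _ fun z => ?_
  by_cases hz : z.intDegree ≤ 0
  · exact ⟨⟨z, hz⟩, 1, by simp [Subalgebra.algebraMap_def]⟩
  · refine ⟨1, ⟨z⁻¹, by rw [mem_Oinf, intDegree_inv']; omega⟩, by simp [Subalgebra.algebraMap_def]⟩

/-- polynomial plus proper fraction -/
theorem ratFunc_split (x : RatFunc F) : ∃ (p : F[X]) (y : Oinf F),
    x = algebraMap F[X] (RatFunc F) p + RatFunc.X⁻¹ * (y : RatFunc F) := by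
  have hd : x.denom ≠ 0 := x.denom_ne_zero
  have hX : (RatFunc.X : RatFunc F) ≠ 0 := RatFunc.X_ne_zero
  have hdX : algebraMap F[X] (RatFunc F) x.denom ≠ 0 := by simpa using hd
  have hx := RatFunc.num_div_denom x
  refine ⟨x.num / x.denom, ⟨RatFunc.X * (algebraMap F[X] (RatFunc F) (x.num % x.denom) / algebraMap F[X] (RatFunc F) x.denom), ?_⟩, ?_⟩
  · rw [mem_Oinf]
    rcases eq_or_ne (x.num % x.denom) 0 with h | h
    · simp [h]
    have hr : algebraMap F[X] (RatFunc F) (x.num % x.denom) ≠ 0 := by simpa using h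
    rw [RatFunc.intDegree_mul hX (div_ne_zero hr hdX), div_eq_mul_inv, RatFunc.intDegree_mul hr (inv_ne_zero hdX),
      intDegree_inv', RatFunc.intDegree_X, RatFunc.intDegree_polynomial, RatFunc.intDegree_polynomial]
    have := Polynomial.natDegree_lt_natDegree h (EuclideanDomain.mod_lt x.num hd)
    omega
  · conv_lhs => rw [← hx]
    conv_lhs => rw [← EuclideanDomain.div_add_mod x.num x.denom]
    rw [map_add, map_mul, inv_mul_cancel_left₀ hX]
    field_simp

theorem poly_mem_Oinf {p : F[X]} : algebraMap F[X] (RatFunc F) p ∈ Oinf F ↔ ∃ c, p = C c := by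
  rw [mem_Oinf, RatFunc.intDegree_polynomial]
  constructor
  · intro h; exact ⟨_, Polynomial.eq_C_of_natDegree_eq_zero (by omega)⟩
  · rintro ⟨c, rfl⟩; simp

theorem Oinf_split (x : Oinf F) : ∃ (c : F) (y : Oinf F), x = algebraMap F (Oinf F) c + unif F * y := by
  obtain ⟨p, y, h⟩ := ratFunc_split (x : RatFunc F)
  have : algebraMap F[X] (RatFunc F) p ∈ Oinf F := by
    have : algebraMap F[X] (RatFunc F) p = (x : RatFunc F) - (unif F : RatFunc F) * y := by
      rw [h, unif_coe]; ring
    rw [this]; exact sub_mem x.2 (mul_mem (unif F).2 y.2)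
  obtain ⟨c, rfl⟩ := poly_mem_Oinf.mp this
  refine ⟨c, y, ?_⟩
  ext
  rw [h]
  rfl
end Infty

set_option linter.all false
/-! ## Part 4b: residue fields, degree at infinity -/
section Curve
open Polynomial IsDedekindDomain WithZero

theorem res_finite {A R : Type*} [CommRing A] [CommRing R] [Algebra A R] [Module.Finite A R]
    (v : Ideal R) [Finite (A ⧸ v.under A)] : Finite (R ⧸ v) := by
  have : Module.Finite (A ⧸ v.under A) (R ⧸ v) := inferInstance
  exact Module.finite_of_finite (A ⧸ v.under A)

theorem res_card {F R : Type*} [Field F] [Finite F] [CommRing R] [Algebra F R]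
    (v : Ideal R) [hv : v.IsMaximal] [Finite (R ⧸ v)] :
    ∃ k, 0 < k ∧ Nat.card (R ⧸ v) = Nat.card F ^ k := by
  refine ⟨Module.finrank F (R ⧸ v), Module.finrank_pos, Module.natCard_eq_pow_finrank⟩

theorem under_ne_bot {A R : Type*} [CommRing A] [Nontrivial A] [CommRing R] [IsDomain R] [Algebra A R]
    [Module.Finite A R] (v : Ideal R) (hv : v ≠ ⊥) : v.under A ≠ ⊥ := by
  obtain ⟨x, hx, hx0⟩ := Submodule.exists_mem_ne_zero_of_ne_bot hv
  exact Ideal.comap_ne_bot_of_integral_mem hx0 hx (Algebra.IsIntegral.isIntegral x)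

theorem finite_polyquot {F : Type*} [Field F] [Finite F] (I : Ideal F[X]) (hI : I ≠ ⊥) :
    Finite (F[X] ⧸ I) := by
  obtain ⟨a, rfl⟩ := IsPrincipalIdealRing.principal I |>.principal
  have ha : a ≠ 0 := by rintro rfl; simp at hI
  have : Module.Finite F (AdjoinRoot a) := (AdjoinRoot.powerBasis ha).finite
  exact (Module.finite_of_finite F : Finite (AdjoinRoot a))

theorem resF_finite {F R : Type*} [Field F] [Finite F] [CommRing R] [IsDedekindDomain R]
    [Algebra F[X] R] [Module.Finite F[X] R] (v : HeightOneSpectrum R) : Finite (R ⧸ v.asIdeal) := by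
  have := finite_polyquot _ (under_ne_bot (A := F[X]) v.asIdeal v.ne_bot)
  exact res_finite (A := F[X]) v.asIdeal

theorem Oinf_max {F : Type*} [Field F] : IsLocalRing.maximalIdeal (Oinf F) = Ideal.span {unif F} :=
  (IsDiscreteValuationRing.irreducible_iff_uniformizer _).mp unif_irreducible

theorem Oinf_quot_bij {F : Type*} [Field F] : Function.Bijective
    (algebraMap F (Oinf F ⧸ IsLocalRing.maximalIdeal (Oinf F))) := by
  have hnt : Nontrivial (Oinf F ⧸ IsLocalRing.maximalIdeal (Oinf F)) :=
    Ideal.Quotient.nontrivial_iff.mpr (Ideal.IsPrime.ne_top inferInstance)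
  refine ⟨RingHom.injective _, fun x => ?_⟩
  obtain ⟨x, rfl⟩ := Ideal.Quotient.mk_surjective x
  obtain ⟨c, y, rfl⟩ := Oinf_split x
  refine ⟨c, ?_⟩
  have h : Ideal.Quotient.mk (IsLocalRing.maximalIdeal (Oinf F)) (unif F * y) = 0 := by
    rw [Ideal.Quotient.eq_zero_iff_mem, Oinf_max]
    exact Ideal.mul_mem_right _ _ (Ideal.mem_span_singleton_self _)
  rw [map_add, h, add_zero]
  rfl

theorem Oinf_quot_card {F : Type*} [Field F] :
    Nat.card (Oinf F ⧸ IsLocalRing.maximalIdeal (Oinf F)) = Nat.card F :=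
  (Nat.card_congr (Equiv.ofBijective _ Oinf_quot_bij)).symm

theorem under_Oinf {F R : Type*} [Field F] [CommRing R] [IsDedekindDomain R]
    [Algebra (Oinf F) R] [Module.Finite (Oinf F) R] (v : HeightOneSpectrum R) :
    v.asIdeal.under (Oinf F) = IsLocalRing.maximalIdeal (Oinf F) := by
  have := under_ne_bot (A := Oinf F) v.asIdeal v.ne_bot
  have hp : (v.asIdeal.under (Oinf F)).IsPrime := inferInstance
  exact IsLocalRing.eq_maximalIdeal (hp.isMaximal this)

theorem resO_finite {F R : Type*} [Field F] [Finite F] [CommRing R] [IsDedekindDomain R]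
    [Algebra (Oinf F) R] [Module.Finite (Oinf F) R] (v : HeightOneSpectrum R) : Finite (R ⧸ v.asIdeal) := by
  have : Finite (Oinf F ⧸ v.asIdeal.under (Oinf F)) := by
    rw [under_Oinf]
    exact Finite.of_surjective _ Oinf_quot_bij.2
  exact res_finite (A := Oinf F) v.asIdeal

theorem unif_mem {F R : Type*} [Field F] [CommRing R] [IsDedekindDomain R]
    [Algebra (Oinf F) R] [Module.Finite (Oinf F) R] (v : HeightOneSpectrum R) :
    algebraMap (Oinf F) R (unif F) ∈ v.asIdeal := by
  have : unif F ∈ v.asIdeal.under (Oinf F) := by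
    rw [under_Oinf, Oinf_max]; exact Ideal.mem_span_singleton_self _
  exact this

theorem finite_containing {R : Type*} [CommRing R] [IsDedekindDomain R] {x : R} (hx : x ≠ 0) :
    {v : HeightOneSpectrum R | x ∈ v.asIdeal}.Finite := by
  have := Ideal.finite_factors (I := Ideal.span {x}) (by simpa using hx)
  refine this.subset fun v hv => ?_
  simpa [Ideal.dvd_span_singleton] using hv

theorem relIndex_lat_finsupp {R M : Type*} [CommRing R] [IsDedekindDomain R] [Field M] [Algebra R M]
    [IsFractionRing R M] (E : HeightOneSpectrum R →₀ ℕ) :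
    ∀ D : HeightOneSpectrum R → ℤ, (Function.support D).Finite →
    (lat M D).relIndex (lat M (fun v => D v + (E v : ℤ))) =
      E.prod (fun P k => Nat.card (R ⧸ P.asIdeal) ^ k) := by
  classical
  induction E using Finsupp.induction_linear with
  | zero => intro D hD; simp
  | add E E' h h' =>
    intro D hD
    rw [Finsupp.prod_add_index' (by simp) (by intros; rw [pow_add])]
    have hs : (Function.support (fun v => D v + (E v : ℤ))).Finite := by
      refine (hD.union E.hasFiniteSupport).subset fun v hv => ?_
      simp only [Function.mem_support, Set.mem_union] at hv ⊢
      by_contra hc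
      push Not at hc
      simp [hc.1, hc.2] at hv
    rw [← h D hD, ← h' _ hs, AddSubgroup.relIndex_mul_relIndex _ _ _ (lat_mono fun v => by omega)
      (lat_mono fun v => by omega)]
    simp [add_assoc]
  | single P k =>
    induction k with
    | zero => intro D hD; simp
    | succ k ih =>
      intro D hD
      rw [Finsupp.prod_single_index (by simp), pow_succ]
      have h1 := ih D hD
      rw [Finsupp.prod_single_index (by simp)] at h1
      have hs : (Function.support (fun v => D v + ((Finsupp.single P k) v : ℤ))).Finite := by
        refine (hD.union (Finsupp.single P k).hasFiniteSupport).subset fun v hv => ?_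
        simp only [Function.mem_support, Set.mem_union] at hv ⊢
        by_contra hc
        push Not at hc
        rw [hc.1, hc.2] at hv
        simp at hv
      have h2 := relIndex_lat (M := M) _ hs P
      rw [← h1, ← h2]
      have e : (fun v => D v + (((Finsupp.single P (k + 1)) v : ℕ) : ℤ)) =
          (fun v => D v + (((Finsupp.single P k) v : ℕ) : ℤ)) + Pi.single P 1 := by
        ext v
        by_cases hv : v = P
        · subst hv; simp; ring
        · simp [hv]
      rw [e]
      refine (AddSubgroup.relIndex_mul_relIndex _ _ _ (lat_mono fun v => by omega)
        (lat_mono fun v => ?_)).symm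
      by_cases hv : v = P
      · subst hv; simp
      · simp [hv]
end Curve

set_option linter.all false
/-! ## Part 4c: the curve -/
theorem card_quot_map {A S K L : Type*} [CommRing A] [CommRing S] [IsDomain A] [IsDedekindDomain A] [Algebra A S]
    [Field K] [Field L] [Algebra A K] [IsFractionRing A K] [Algebra S L] [IsFractionRing S L]
    [Algebra A L] [IsScalarTower A S L] [Algebra K L] [IsScalarTower A K L] [Module.Finite A S] [IsDomain S] [Module.IsTorsionFree A S]
    (p : Ideal A) [p.IsMaximal] : Nat.card (S ⧸ p.map (algebraMap A S)) = Nat.card (A ⧸ p) ^ Module.finrank K L := by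
  have h6 := Ideal.finrank_quotient_map (R := A) (S := S) (p := p) K L
  letI := Ideal.Quotient.field p
  rw [← h6]
  exact Module.natCard_eq_pow_finrank (K := A ⧸ p)
section Curve2
open Polynomial IsDedekindDomain WithZero

variable {F : Type*} [Field F] {M : Type*} [Field M] [Algebra (RatFunc F) M]
  [Algebra F M] [IsScalarTower F (RatFunc F) M]
  [Algebra F[X] M] [IsScalarTower F[X] (RatFunc F) M]
  {R R' : Type*} [CommRing R] [IsDedekindDomain R] [Algebra R M] [IsFractionRing R M]
  [Algebra F[X] R] [Module.Finite F[X] R] [IsScalarTower F[X] R M] 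
  [Algebra F R] [IsScalarTower F R M]
  [CommRing R'] [IsDedekindDomain R'] [Algebra R' M] [IsFractionRing R' M]
  [Algebra (Oinf F) R'] [Module.Finite (Oinf F) R'] [IsScalarTower (Oinf F) R' M] 
  [Algebra F R'] [IsScalarTower F R' M]

variable (F) in
theorem curve_hpow [Finite F] (P : Pl R R') : ∃ k, 0 < k ∧ resCard P = (Nat.card F) ^ k := by
  rcases P with v | v
  · have := resF_finite (F := F) v
    have := v.isMaximal
    exact res_card (F := F) v.asIdeal
  · have := resO_finite (F := F) v
    have := v.isMaximal
    exact res_card (F := F) v.asIdeal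

variable (F M) in
/-- the parameter -/
noncomputable def tM : M := algebraMap (RatFunc F) M RatFunc.X

theorem tM_ne : tM F M ≠ 0 := by simp [tM, RatFunc.X_ne_zero]

theorem tM_eq : tM F M = algebraMap F[X] M X := by
  rw [tM, IsScalarTower.algebraMap_apply F[X] (RatFunc F) M, RatFunc.algebraMap_X]

theorem tM_eqR : tM F M = algebraMap R M (algebraMap F[X] R X) := by
  rw [tM_eq, ← IsScalarTower.algebraMap_apply]

theorem tM_inv : (tM F M)⁻¹ = algebraMap R' M (algebraMap (Oinf F) R' (unif F)) := by
  rw [← IsScalarTower.algebraMap_apply, IsScalarTower.algebraMap_apply (Oinf F) (RatFunc F) M, tM,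
    ← map_inv₀]
  rfl

variable (M) in
include M in
theorem algMap_inj : Function.Injective (algebraMap F[X] R) := by
  have : Function.Injective (algebraMap F[X] M) := by
    rw [IsScalarTower.algebraMap_eq F[X] (RatFunc F) M]
    exact (algebraMap (RatFunc F) M).injective.comp (RatFunc.algebraMap_injective F)
  rw [IsScalarTower.algebraMap_eq F[X] R M] at this
  exact Function.Injective.of_comp this

include M in
variable (F M) in
theorem places_finite [Finite F] : ∃ S : ℕ → Finset (Pl R R'), ∀ d P, P ∈ S d ↔ plDeg (Nat.card F) P ≤ d := by
  suffices h : ∀ d, {P : Pl R R' | plDeg (Nat.card F) P ≤ d}.Finite by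
    exact ⟨fun d => (h d).toFinset, fun d P => by simp⟩
  intro d
  have hq : 1 < Nat.card F := Finite.one_lt_card
  have h1 : (⋃ δ ∈ Finset.Icc 1 d, {v : HeightOneSpectrum R | algebraMap F[X] R (X ^ (Nat.card F ^ δ) - X) ∈ v.asIdeal}).Finite := by
    refine Set.Finite.biUnion (Finset.finite_toSet _) fun δ hδ => finite_containing ?_
    rw [Ne, map_eq_zero_iff _ (algMap_inj M)]
    refine FiniteField.X_pow_card_pow_sub_X_ne_zero F (by simp at hδ; omega) hq
  have h2 : {v : HeightOneSpectrum R' | algebraMap (Oinf F) R' (unif F) ∈ v.asIdeal}.Finite := by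
    refine finite_containing fun h => ?_
    have := tM_inv (F := F) (M := M) (R' := R')
    rw [h, map_zero] at this
    exact inv_ne_zero tM_ne this
  refine ((h1.image Sum.inl).union (h2.image Sum.inr)).subset ?_
  rintro (v | v) hv
  · left
    refine ⟨v, ?_, rfl⟩
    simp only [Set.mem_iUnion]
    have hv' := plDeg_pos (curve_hpow F) hq (Sum.inl v : Pl R R')
    refine ⟨_, Finset.mem_Icc.mpr ⟨hv', hv⟩, ?_⟩
    have := resF_finite (F := F) v
    have := v.isMaximal
    letI := Ideal.Quotient.field v.asIdeal
    have hc : Nat.card (R ⧸ v.asIdeal) = _ := resCard_eq (curve_hpow F) hq (Sum.inl v : Pl R R')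
    rw [Set.mem_ofPred_eq, ← Ideal.Quotient.eq_zero_iff_mem, map_sub, map_pow, map_sub, map_pow, ← hc]
    letI := Fintype.ofFinite (R ⧸ v.asIdeal)
    rw [Nat.card_eq_fintype_card, FiniteField.pow_card, sub_self]
  · right
    exact ⟨v, unif_mem v, rfl⟩

variable (F M R R') in
/-- pole divisor of the parameter -/
noncomputable def Tinf : Pl R R' →₀ ℤ := (pdiv R R' (tM F M)).filter (fun P => P.isRight)

theorem Tinf_inl (v) : Tinf F M R R' (.inl v) = 0 := by simp [Tinf]
theorem Tinf_inr (v) : Tinf F M R R' (.inr v) = vlog R' (tM F M) v := by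
  rw [Tinf, Finsupp.filter_apply_pos (fun P : Pl R R' => P.isRight = true) _ rfl]; rfl

theorem Tinf_nonneg (P) : 0 ≤ Tinf F M R R' P := by
  rcases P with v | v
  · rw [Tinf_inl]
  · rw [Tinf_inr]
    have h := (mem_lat_iff (inv_ne_zero (tM_ne (F := F) (M := M)))).mp
      (mem_lat_zero.mpr ⟨_, (tM_inv (F := F) (M := M) (R' := R')).symm⟩) v
    rw [vlog_inv] at h
    simpa using h

variable (F M R R') in
/-- functions with poles of order at most `k` times the pole divisor of the parameter -/
noncomputable def Lk (k : ℕ) : AddSubgroup M := Ls M (k • Tinf F M R R')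

theorem mem_Lk {k : ℕ} {x : M} : x ∈ Lk F M R R' k ↔
    x ∈ (algebraMap R M).range ∧ x * (tM F M)⁻¹ ^ k ∈ (algebraMap R' M).range := by
  rw [← mem_lat_zero, ← mem_lat_zero, Lk, Ls, AddSubgroup.mem_inf]
  refine and_congr ?_ ?_
  · have : (fun v : HeightOneSpectrum R => (k • Tinf F M R R') (Sum.inl v)) = 0 := by
      ext v; simp [Tinf_inl]
    rw [this]
  · have h0 := mul_mem_lat_iff (R := R') (D := 0) (y := x * (tM F M)⁻¹ ^ k) (pow_ne_zero k (tM_ne (F := F) (M := M)))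
    have : (fun v : HeightOneSpectrum R' => (k • Tinf F M R R') (Sum.inr v)) = 
        vlog R' (tM F M ^ k) + 0 := by
      ext v; simp [Tinf_inr, vlog_pow]
    rw [this]
    rw [show tM F M ^ k * (x * (tM F M)⁻¹ ^ k) = x by
      rw [mul_left_comm, ← mul_pow, mul_inv_cancel₀ tM_ne, one_pow, mul_one]] at h0
    exact h0

theorem Lk_mul {a b : ℕ} {x y : M} (hx : x ∈ Lk F M R R' a) (hy : y ∈ Lk F M R R' b) :
    x * y ∈ Lk F M R R' (a + b) := by
  rw [mem_Lk] at *
  refine ⟨mul_mem hx.1 hy.1, ?_⟩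
  rw [show x * y * (tM F M)⁻¹ ^ (a + b) = (x * (tM F M)⁻¹ ^ a) * (y * (tM F M)⁻¹ ^ b) by ring]
  exact mul_mem hx.2 hy.2

theorem Lk_one : (1 : M) ∈ Lk F M R R' 0 := by
  rw [mem_Lk]; exact ⟨one_mem _, by simpa using one_mem _⟩

theorem Lk_pow {a : ℕ} {x : M} (hx : x ∈ Lk F M R R' a) (k : ℕ) : x ^ k ∈ Lk F M R R' (a * k) := by
  induction k with
  | zero => simpa using Lk_one
  | succ k ih => rw [pow_succ, mul_add_one]; exact Lk_mul ih hx

theorem Lk_mono {a b : ℕ} (h : a ≤ b) : Lk F M R R' a ≤ Lk F M R R' b := by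
  refine Ls_mono fun v => ?_
  have := Tinf_nonneg (F := F) (M := M) v
  simp only [Finsupp.coe_smul, Pi.smul_apply, nsmul_eq_mul]
  exact mul_le_mul_of_nonneg_right (by exact_mod_cast h) this

theorem Lk_const (c : F) : algebraMap F M c ∈ Lk F M R R' 0 := by
  rw [mem_Lk]
  refine ⟨⟨algebraMap F R c, by rw [← IsScalarTower.algebraMap_apply]⟩, ?_⟩
  rw [pow_zero, mul_one]
  exact ⟨algebraMap F R' c, by rw [← IsScalarTower.algebraMap_apply]⟩

theorem Lk_t : tM F M ∈ Lk F M R R' 1 := by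
  rw [mem_Lk]
  refine ⟨⟨_, tM_eqR.symm⟩, ?_⟩
  rw [pow_one, mul_inv_cancel₀ tM_ne]; exact one_mem _

theorem deg_Tinf [Finite F] [FiniteDimensional (RatFunc F) M] :
    dvDeg (Nat.card F) (Tinf F M R R') = Module.finrank (RatFunc F) M := by
  classical
  have hq : 1 < Nat.card F := Finite.one_lt_card
  -- index computation
  set s : R' := algebraMap (Oinf F) R' (unif F) with hs
  have hst : algebraMap R' M s = (tM F M)⁻¹ := tM_inv.symm
  have hsurj : ∃ E : HeightOneSpectrum R' →₀ ℕ, ∀ v, (E v : ℤ) = vlog R' (tM F M) v := by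
    refine ⟨Finsupp.ofSupportFinite (fun v => (vlog R' (tM F M) v).toNat)
      ((vlog_finite (R := R') (tM F M)).subset fun v hv => ?_), fun v => ?_⟩
    · simp only [Function.mem_support] at hv ⊢
      intro h; simp [h] at hv
    · have := Tinf_nonneg (F := F) (M := M) (R := R) (Sum.inr v : Pl R R')
      rw [Tinf_inr] at this
      show (((vlog R' (tM F M) v).toNat : ℕ) : ℤ) = _
      omega
  obtain ⟨E, hE⟩ := hsurj
  have h1 := relIndex_lat_finsupp (M := M) E 0 (by simp)
  simp only [Pi.zero_apply, zero_add, hE] at h1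
  -- degree
  have h2 : dvDeg (Nat.card F) (Tinf F M R R') = (E.sum fun P k => k * plDeg (Nat.card F) (Sum.inr P : Pl R R') : ℕ) := by
    have : Tinf F M R R' = (E.mapDomain Sum.inr).mapRange (fun n : ℕ => (n : ℤ)) rfl := by
      ext (v | v)
      · rw [Tinf_inl, Finsupp.mapRange_apply, Finsupp.mapDomain_notin_range _ _ (by simp)]; rfl
      · rw [Tinf_inr, Finsupp.mapRange_apply, Finsupp.mapDomain_apply Sum.inr_injective, hE]
    rw [this, dvDeg, Finsupp.sum_mapRange_index (by simp), Finsupp.sum_mapDomain_index (by simp)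
      (by intros; push_cast; ring)]
    simp [Finsupp.sum]
  have h3 : E.prod (fun P k => Nat.card (R' ⧸ P.asIdeal) ^ k) =
      Nat.card F ^ (E.sum fun P k => k * plDeg (Nat.card F) (Sum.inr P : Pl R R') : ℕ) := by
    rw [Finsupp.sum, ← Finset.prod_pow_eq_pow_sum, Finsupp.prod]
    refine Finset.prod_congr rfl fun P _ => ?_
    have := resCard_eq (curve_hpow F) hq (Sum.inr P : Pl R R')
    change Nat.card (R' ⧸ P.asIdeal) = _ at this
    rw [this, ← pow_mul, mul_comm]
  -- left side
  have h4 : (lat M (0 : HeightOneSpectrum R' → ℤ)).relIndex (lat M (fun v => vlog R' (tM F M) v)) =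
      Nat.card (R' ⧸ Ideal.span {s}) := by
    have hb := mulLeft_bij (tM_ne (F := F) (M := M))
    have e1 : lat M (fun v => vlog R' (tM F M) v) = (lat M (0 : HeightOneSpectrum R' → ℤ)).map (AddMonoidHom.mulLeft (tM F M)) := by
      rw [← lat_scale_map tM_ne, add_zero]
    have e0 : lat M (0 : HeightOneSpectrum R' → ℤ) = (⊤ : AddSubgroup R').map (algebraMap R' M).toAddMonoidHom := by
      ext x; rw [mem_lat_zero]; simp [AddSubgroup.mem_map]
    have e2 : lat M (0 : HeightOneSpectrum R' → ℤ) = ((Ideal.span {s} : Ideal R').toAddSubgroup.map (algebraMap R' M).toAddMonoidHom).map (AddMonoidHom.mulLeft (tM F M)) := by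
      ext x
      rw [mem_lat_zero]
      simp only [AddSubgroup.mem_map, Submodule.mem_toAddSubgroup, Ideal.mem_span_singleton']
      constructor
      · rintro ⟨y, rfl⟩
        refine ⟨_, ⟨y * s, ⟨y, rfl⟩, rfl⟩, ?_⟩
        simp [hst]
        field_simp [tM_ne (F := F) (M := M)]
      · rintro ⟨_, ⟨_, ⟨y, rfl⟩, rfl⟩, rfl⟩
        refine ⟨y, ?_⟩
        simp [hst]
        rw [mul_left_comm, mul_inv_cancel₀ tM_ne, mul_one]
    have e3 : (lat M (0 : HeightOneSpectrum R' → ℤ)).relIndex (lat M (fun v => vlog R' (tM F M) v)) = AddSubgroup.relIndex (((Ideal.span {s} : Ideal R').toAddSubgroup.map (algebraMap R' M).toAddMonoidHom).map (AddMonoidHom.mulLeft (tM F M))) (((⊤ : AddSubgroup R').map (algebraMap R' M).toAddMonoidHom).map (AddMonoidHom.mulLeft (tM F M))) := by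
      rw [e1, ← e2, ← e0]
    rw [e3, AddSubgroup.relIndex_map_map_of_injective _ _ hb.1,
      AddSubgroup.relIndex_map_map_of_injective _ _ (IsFractionRing.injective R' M), AddSubgroup.relIndex_top_right]
    rfl
  -- count
  have h5 : Nat.card (R' ⧸ Ideal.span {s}) = Nat.card F ^ Module.finrank (RatFunc F) M := by
    have hm : Ideal.map (algebraMap (Oinf F) R') (IsLocalRing.maximalIdeal (Oinf F)) = Ideal.span {s} := by
      rw [Oinf_max, Ideal.map_span, Set.image_singleton]
    have : Module.IsTorsionFree (Oinf F) R' := by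
      have hinj : Function.Injective (algebraMap (Oinf F) R') := by
        have : Function.Injective (algebraMap (Oinf F) M) := by
          rw [IsScalarTower.algebraMap_eq (Oinf F) (RatFunc F) M]
          exact (algebraMap (RatFunc F) M).injective.comp Subtype.val_injective
        rw [IsScalarTower.algebraMap_eq (Oinf F) R' M] at this
        exact Function.Injective.of_comp this
      have : FaithfulSMul (Oinf F) R' := (faithfulSMul_iff_algebraMap_injective _ _).mpr hinj
      exact Module.isTorsionFree_iff_faithfulSMul.mpr this
    rw [← hm, card_quot_map (K := RatFunc F) (L := M), Oinf_quot_card]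
  change (lat M (0 : HeightOneSpectrum R' → ℤ)).relIndex (lat M (fun v => vlog R' (tM F M) v)) = _ at h1
  rw [h4, h5, h3] at h1
  rw [h2, Nat.pow_right_injective hq h1]
end Curve2

set_option linter.all false
/-! ## Part 4d: constants, generators -/
section ValW
open Polynomial
variable {F M Γ : Type*} [Field F] [Field M] [Algebra F M] [LinearOrderedCommGroupWithZero Γ]
  (v : Valuation M Γ) (hF : ∀ c : F, v (algebraMap F M c) ≤ 1)
include hF

theorem val_const {c : F} (hc : c ≠ 0) : v (algebraMap F M c) = 1 := by
  refine le_antisymm (hF c) ?_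
  have h := hF c⁻¹
  rw [map_inv₀, map_inv₀] at h
  exact (inv_le_one₀ (zero_lt_iff.mpr (by simpa using hc))).mp h

theorem val_aeval_le (p : F[X]) {x : M} (hx : v x ≤ 1) : v (aeval x p) ≤ 1 := by
  rw [aeval_eq_sum_range]
  refine v.map_sum_le fun i _ => ?_
  rw [Algebra.smul_def, map_mul, map_pow]
  exact mul_le_one' (hF _) (pow_le_one' hx _)

theorem val_aeval_gt {p : F[X]} (hp : p ≠ 0) {x : M} (hx : 1 < v x) :
    v (aeval x p) = v x ^ p.natDegree := by
  have hx0 : v x ≠ 0 := (zero_lt_one.trans hx).ne'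
  rw [aeval_eq_sum_range, Finset.sum_range_succ]
  have h1 : v (p.coeff p.natDegree • x ^ p.natDegree) = v x ^ p.natDegree := by
    rw [Algebra.smul_def, map_mul, map_pow, val_const v hF (by simpa using hp), one_mul]
  have h2 : v (∑ i ∈ Finset.range p.natDegree, p.coeff i • x ^ i) < v x ^ p.natDegree := by
    refine v.map_sum_lt (pow_ne_zero _ hx0) fun i hi => ?_
    rw [Algebra.smul_def, map_mul, map_pow]
    refine (mul_le_of_le_one_left' (hF _)).trans_lt ?_
    exact pow_lt_pow_right₀ hx (Finset.mem_range.mp hi)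
  rw [v.map_add_eq_of_lt_right (by rw [h1]; exact h2), h1]

/-- the key estimate -/
theorem val_w {f g : F[X]} (hcop : IsCoprime f g) {d : ℕ} (hd : max f.natDegree g.natDegree = d) (hd0 : 0 < d)
    {x t : M} (ht : v t ≤ 1) (hx : aeval x f = t * aeval x g) {i : ℕ} (hi : i ≤ d) :
    v (x ^ i) ≤ v (aeval x g) := by
  rw [map_pow]
  rcases le_or_gt (v x) 1 with h | h
  · obtain ⟨a, b, hab⟩ := hcop
    have h1 : (aeval x a * t + aeval x b) * aeval x g = 1 := by
      rw [add_mul, mul_assoc, ← hx, ← map_mul, ← map_mul, ← map_add, hab, map_one]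
    have h2 : v (aeval x a * t + aeval x b) ≤ 1 := by
      refine v.map_add_le ?_ (val_aeval_le v hF b h)
      rw [map_mul]; exact mul_le_one' (val_aeval_le v hF a h) ht
    have h3 := congrArg v h1
    rw [map_mul, map_one] at h3
    refine (pow_le_one' h _).trans ?_
    rw [← h3]; exact mul_le_of_le_one_left' h2
  · rcases le_total f.natDegree g.natDegree with h' | h'
    · rw [max_eq_right h'] at hd
      rw [val_aeval_gt v hF (by rintro rfl; simp at hd; omega) h, hd]
      exact pow_le_pow_right₀ h.le hi
    · rw [max_eq_left h'] at hd
      have h4 := val_aeval_gt v hF (p := f) (by rintro rfl; simp at hd; omega) h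
      rw [hx, hd, map_mul] at h4
      refine (pow_le_pow_right₀ h.le hi).trans ?_
      rw [← h4]
      exact mul_le_of_le_one_left' ht
end ValW

section Curve3
open Polynomial IsDedekindDomain WithZero

variable {F : Type*} [Field F] {M : Type*} [Field M] [Algebra (RatFunc F) M]
  [Algebra F M] [IsScalarTower F (RatFunc F) M]
  [Algebra F[X] M] [IsScalarTower F[X] (RatFunc F) M]
  {R R' : Type*} [CommRing R] [IsDedekindDomain R] [Algebra R M] [IsFractionRing R M]
  [Algebra F[X] R] [Module.Finite F[X] R] [IsScalarTower F[X] R M] 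
  [Algebra F R] [IsScalarTower F R M]
  [CommRing R'] [IsDedekindDomain R'] [Algebra R' M] [IsFractionRing R' M]
  [Algebra (Oinf F) R'] [Module.Finite (Oinf F) R'] [IsScalarTower (Oinf F) R' M] 
  [Algebra F R'] [IsScalarTower F R' M]

theorem mem_range_R_of_val {x : M} (h : ∀ v : HeightOneSpectrum R, v.valuation M x ≤ 1) :
    x ∈ (algebraMap R M).range := by
  rw [← mem_lat_zero]
  intro v
  simpa using h v

theorem val_le_one_of_mem {x : M} (h : x ∈ (algebraMap R M).range) (v : HeightOneSpectrum R) :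
    v.valuation M x ≤ 1 := by
  obtain ⟨y, rfl⟩ := h
  exact v.valuation_le_one y

theorem Lk_w {f g : F[X]} (hcop : IsCoprime f g) {d : ℕ} (hd : max f.natDegree g.natDegree = d)
    (hd0 : 0 < d) {x : M} (hx : aeval x f = tM F M * aeval x g) {i : ℕ} (hi : i ≤ d) :
    aeval x g ≠ 0 ∧ x ^ i * (aeval x g)⁻¹ ∈ Lk F M R R' 1 := by
  have hg : aeval x g ≠ 0 := by
    intro h
    rw [h, mul_zero] at hx
    obtain ⟨a, b, hab⟩ := hcop
    have := congrArg (aeval x) hab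
    simp [hx, h] at this
  have hx' : aeval x g = (tM F M)⁻¹ * aeval x f := by
    rw [hx, ← mul_assoc, inv_mul_cancel₀ tM_ne, one_mul]
  refine ⟨hg, ?_⟩
  rw [mem_Lk]
  constructor
  · refine mem_range_R_of_val fun v => ?_
    rw [map_mul, map_inv₀]
    refine mul_inv_le_one_of_le₀ (val_w (v.valuation M) (fun c => ?_) hcop hd hd0 ?_ hx hi) zero_le
    · exact val_le_one_of_mem ⟨algebraMap F R c, by rw [← IsScalarTower.algebraMap_apply]⟩ v
    · exact val_le_one_of_mem ⟨_, tM_eqR.symm⟩ v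
  · refine mem_range_R_of_val fun v => ?_
    have e : x ^ i * (aeval x g)⁻¹ * (tM F M)⁻¹ ^ 1 = x ^ i * (aeval x f)⁻¹ := by
      rw [hx, pow_one, mul_inv]; ring
    rw [e, map_mul, map_inv₀]
    refine mul_inv_le_one_of_le₀ (val_w (v.valuation M) (fun c => ?_) hcop.symm (by rw [max_comm]; exact hd) hd0 ?_ hx' hi) zero_le
    · exact val_le_one_of_mem ⟨algebraMap F R' c, by rw [← IsScalarTower.algebraMap_apply]⟩ v
    · exact val_le_one_of_mem ⟨_, tM_inv.symm⟩ v

/-- constants -/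
theorem mem_L0 [Algebra.IsAlgebraic (RatFunc F) M] (hconst : ∀ z : M, IsAlgebraic F z → ∃ c : F, algebraMap F M c = z) {x : M}
    (hx : x ∈ Lk F M R R' 0) : ∃ c : F, algebraMap F M c = x := by
  apply hconst
  rw [mem_Lk, pow_zero, mul_one] at hx
  obtain ⟨⟨y, hy⟩, ⟨z, hz⟩⟩ := hx
  have i1 : IsIntegral F[X] x := by
    rw [← hy]; exact (Algebra.IsIntegral.isIntegral y).algebraMap
  have i2 : IsIntegral (Oinf F) x := by
    rw [← hz]; exact (Algebra.IsIntegral.isIntegral z).algebraMap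
  have m1 := minpoly.isIntegrallyClosed_eq_field_fractions (RatFunc F) M i1
  have m2 := minpoly.isIntegrallyClosed_eq_field_fractions (RatFunc F) M i2
  rw [Algebra.algebraMap_self_apply] at m1 m2
  have hc : ∀ i, ∃ c : F, (minpoly F[X] x).coeff i = C c := by
    intro i
    rw [← poly_mem_Oinf]
    have : (minpoly (RatFunc F) x).coeff i = algebraMap F[X] (RatFunc F) ((minpoly F[X] x).coeff i) := by
      rw [m1, coeff_map]
    rw [← this, m2, coeff_map]
    exact Subtype.property _
  have hl : minpoly F[X] x ∈ lifts (C : F →+* F[X]) := by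
    rw [lifts_iff_coeff_lifts]
    intro i
    obtain ⟨c, hc⟩ := hc i
    exact ⟨c, hc.symm⟩
  obtain ⟨p, hp⟩ := hl
  refine ⟨p, ?_, ?_⟩
  · rintro rfl
    have := minpoly.ne_zero i1
    rw [← hp] at this
    simp at this
  · have h1 := minpoly.aeval F[X] x
    rw [← hp] at h1
    have h2 : (algebraMap F[X] M).comp C = algebraMap F M := by
      rw [IsScalarTower.algebraMap_eq F[X] (RatFunc F) M, IsScalarTower.algebraMap_eq F (RatFunc F) M]
      rfl
    rw [aeval_def] at h1 ⊢
    simp only [coe_mapRingHom, eval₂_map, h2] at h1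
    exact h1

theorem card_L0 [Algebra.IsAlgebraic (RatFunc F) M] (hconst : ∀ z : M, IsAlgebraic F z → ∃ c : F, algebraMap F M c = z) :
    Nat.card (Ls M (0 : Pl R R' → ℤ)) = Nat.card F := by
  have h : Lk F M R R' 0 = Ls M (0 : Pl R R' → ℤ) := by rw [Lk, zero_smul]; rfl
  rw [← h]
  refine (Nat.card_congr (Equiv.ofBijective (fun c : F => (⟨algebraMap F M c, Lk_const c⟩ : Lk F M R R' 0)) ⟨?_, ?_⟩)).symm
  · intro a b hab
    exact (algebraMap F M).injective (congrArg Subtype.val hab)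
  · rintro ⟨x, hx⟩
    obtain ⟨c, rfl⟩ := mem_L0 hconst hx
    exact ⟨c, rfl⟩

variable (F M R R') in
/-- F-space version -/
noncomputable def LkF (k : ℕ) : Submodule F M where
  __ := Lk F M R R' k
  smul_mem' := by
    intro c x hx
    rw [Algebra.smul_def]
    have := Lk_mul (Lk_const c) hx
    rwa [zero_add] at this

theorem mem_LkF {k : ℕ} {x : M} : x ∈ LkF F M R R' k ↔ x ∈ Lk F M R R' k := Iff.rfl

theorem Lk_finite [Finite F] (h0 : Nat.card (Ls M (0 : Pl R R' → ℤ)) = Nat.card F) (k : ℕ) :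
    Finite (Lk F M R R' k) := by
  refine Nat.finite_of_card_ne_zero (card_Ls_ne (curve_hpow F) Finite.one_lt_card (by rw [h0]; exact Nat.card_pos.ne') (k • Tinf F M R R'))

theorem tM_poly (p : F[X]) : aeval (tM F M) p = algebraMap F[X] M p := by
  have h2 : (algebraMap F[X] M).comp C = algebraMap F M := by
    rw [IsScalarTower.algebraMap_eq F[X] (RatFunc F) M, IsScalarTower.algebraMap_eq F (RatFunc F) M]
    rfl
  have : (aeval (tM F M)).toRingHom = algebraMap F[X] M := by
    refine ringHom_ext' ?_ ?_
    · rw [h2]; ext; simp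
    · simp [tM_eq]
  rw [← this]; rfl

theorem Lk_poly {k : ℕ} {p : F[X]} (hp : p.natDegree ≤ k) : aeval (tM F M) p ∈ Lk F M R R' k := by
  rw [aeval_eq_sum_range]
  refine AddSubgroup.sum_mem _ fun i hi => ?_
  rw [Algebra.smul_def]
  have h1 := Lk_mul (Lk_const (p.coeff i)) (Lk_pow (Lk_t (F := F) (M := M) (R := R) (R' := R')) i)
  exact Lk_mono (by simp at hi; omega) h1

theorem algMapM_inj : Function.Injective (algebraMap F[X] M) := by
    rw [IsScalarTower.algebraMap_eq F[X] (RatFunc F) M]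
    exact (algebraMap (RatFunc F) M).injective.comp (RatFunc.algebraMap_injective F)

theorem card_Lk [Finite F] (h0 : Nat.card (Ls M (0 : Pl R R' → ℤ)) = Nat.card F) (k : ℕ) :
    ∃ l : ℕ, k + 1 ≤ l ∧ Nat.card (Lk F M R R' k) = Nat.card F ^ l := by
  have := Lk_finite (F := F) h0 k
  have : Finite (LkF F M R R' k) := this
  have h1 : Nat.card (LkF F M R R' k) = _ := Module.natCard_eq_pow_finrank (K := F)
  refine ⟨_, ?_, h1⟩
  rw [← Nat.pow_le_pow_iff_right (a := Nat.card F) Finite.one_lt_card, ← h1]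
  have h2 : Nat.card (degreeLT F (k + 1)) = Nat.card F ^ (k + 1) := by
    rw [Nat.card_congr (degreeLTEquiv F (k+1)).toEquiv, Nat.card_fun]; simp
  rw [← h2]
  refine Nat.card_le_card_of_injective (fun p => ⟨aeval (tM F M) (p : F[X]), Lk_poly ?_⟩) ?_
  · have := mem_degreeLT.mp p.2
    by_cases hp : (p : F[X]) = 0
    · simp [hp]
    · rw [← natDegree_lt_iff_degree_lt hp] at this; omega
  · intro a b hab
    have := congrArg Subtype.val hab
    simp only [tM_poly] at this
    exact Subtype.ext (algMapM_inj this)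
end Curve3

set_option linter.all false
/-! ## Part 4e: spanning -/
section Curve4
open Polynomial IsDedekindDomain WithZero

variable {F : Type*} [Field F] {M : Type*} [Field M] [Algebra (RatFunc F) M]
  [Algebra F M] [IsScalarTower F (RatFunc F) M]
  [Algebra F[X] M] [IsScalarTower F[X] (RatFunc F) M]
  {R R' : Type*} [CommRing R] [IsDedekindDomain R] [Algebra R M] [IsFractionRing R M]
  [Algebra F[X] R] [Module.Finite F[X] R] [IsScalarTower F[X] R M] 
  [Algebra F R] [IsScalarTower F R M]
  [CommRing R'] [IsDedekindDomain R'] [Algebra R' M] [IsFractionRing R' M]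
  [Algebra (Oinf F) R'] [Module.Finite (Oinf F) R'] [IsScalarTower (Oinf F) R' M] 
  [Algebra F R'] [IsScalarTower F R' M]

variable (F M R R') in
/-- span over the rational function field -/
noncomputable def Vk (k : ℕ) : Submodule (RatFunc F) M := Submodule.span _ (Lk F M R R' k : Set M)

theorem Vk_mul {a b : ℕ} {x y : M} (hx : x ∈ Vk F M R R' a) (hy : y ∈ Vk F M R R' b) :
    x * y ∈ Vk F M R R' (a + b) := by
  have h := Submodule.mul_mem_mul hx hy
  rw [Vk, Vk, Submodule.span_mul_span] at h
  refine Submodule.span_mono ?_ h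
  rintro _ ⟨u, hu, v, hv, rfl⟩
  exact Lk_mul hu hv

theorem Vk_adjoin {f g : F[X]} (hcop : IsCoprime f g) {d : ℕ} (hd : max f.natDegree g.natDegree = d)
    (hd0 : 0 < d) {P : (RatFunc F)[X]} (hPd : P.natDegree = d) {x : M} (hPx : aeval x P = 0)
    (hx : aeval x f = tM F M * aeval x g) {y : M} (hy : y ∈ Algebra.adjoin (RatFunc F) {x}) :
    (aeval x g)⁻¹ * y ∈ Vk F M R R' 1 := by
  rw [Algebra.adjoin_singleton_eq_range_aeval] at hy
  obtain ⟨p, rfl⟩ := hy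
  have hP0 : P ≠ 0 := by rintro rfl; simp at hPd; omega
  have e : aeval x p = aeval x (p % P) := by
    conv_lhs => rw [← EuclideanDomain.div_add_mod p P]
    simp [hPx]
  change (aeval x g)⁻¹ * aeval x p ∈ _
  rw [e, aeval_eq_sum_range' (p := p % P) (n := d + 1), Finset.mul_sum]
  · refine Submodule.sum_mem _ fun i hi => ?_
    rw [mul_smul_comm, mul_comm]
    refine Submodule.smul_mem _ _ (Submodule.subset_span ?_)
    exact (Lk_w hcop hd hd0 hx (by simp at hi; omega)).2
  · have h := natDegree_mod_lt p (q := P) (by omega)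
    omega

theorem Vk_top {f g : F[X]} (hcop : IsCoprime f g) {d : ℕ} (hd : max f.natDegree g.natDegree = d)
    (hd0 : 0 < d) {P : (RatFunc F)[X]} (hPd : P.natDegree = d)  (s : Multiset M)
    (hs : ∀ x ∈ s, aeval x P = 0 ∧ aeval x f = tM F M * aeval x g) :
    ∃ u : M, u ≠ 0 ∧ ∀ y ∈ Algebra.adjoin (RatFunc F) {x | x ∈ s}, u * y ∈ Vk F M R R' s.card := by
  induction s using Multiset.induction_on with
  | empty =>
    refine ⟨1, one_ne_zero, fun y hy => ?_⟩
    simp only [Multiset.notMem_zero, Set.ofPred_false, Algebra.adjoin_empty] at hy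
    obtain ⟨c, rfl⟩ := Algebra.mem_bot.mp hy
    rw [one_mul, Algebra.algebraMap_eq_smul_one]
    exact Submodule.smul_mem _ _ (Submodule.subset_span Lk_one)
  | cons x s ih =>
    obtain ⟨u, hu, h⟩ := ih fun y hy => hs y (Multiset.mem_cons_of_mem hy)
    obtain ⟨h1, h2⟩ := hs x (Multiset.mem_cons_self x s)
    refine ⟨u * (aeval x g)⁻¹, mul_ne_zero hu (inv_ne_zero (Lk_w (R := R) (R' := R') hcop hd hd0 h2 (Nat.zero_le _)).1), fun y hy => ?_⟩
    have e : {y | y ∈ x ::ₘ s} = {y | y ∈ s} ∪ {x} := by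
      ext y; simp [or_comm]
    rw [e, ← Subalgebra.mem_toSubmodule, Algebra.adjoin_union_coe_submodule] at hy
    rw [Multiset.card_cons]
    induction hy using Submodule.mul_induction_on' with
    | mem_mul_mem a ha b hb =>
      rw [show u * (aeval x g)⁻¹ * (a * b) = (u * a) * ((aeval x g)⁻¹ * b) by ring]
      exact Vk_mul (h a ha) (Vk_adjoin hcop hd hd0 hPd h1 h2 hb)
    | add a _ b _ ha hb => rw [mul_add]; exact add_mem ha hb

theorem Ss_of_Vk {k : ℕ} (h : Vk F M R R' (k + 1) = ⊤) : Ss M (k • Tinf F M R R') = ⊤ := by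
  rw [eq_top_iff]
  intro z _
  have hz : z ∈ Vk F M R R' (k + 1) := by rw [h]; trivial
  -- description of the two pieces
  have hl : ∀ x ∈ (algebraMap R M).range, x ∈ Ss M (k • Tinf F M R R') := by
    intro x hx
    refine AddSubgroup.mem_sup_left ?_
    have : (fun v : HeightOneSpectrum R => (k • Tinf F M R R') (Sum.inl v)) = 0 := by
      ext v; simp [Tinf_inl]
    rw [this, mem_lat_zero]; exact hx
  have hr : ∀ x : M, x * (tM F M)⁻¹ ^ k ∈ (algebraMap R' M).range → x ∈ Ss M (k • Tinf F M R R') := by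
    intro x hx
    refine AddSubgroup.mem_sup_right ?_
    have h0 := mul_mem_lat_iff (R := R') (D := 0) (y := x * (tM F M)⁻¹ ^ k) (pow_ne_zero k (tM_ne (F := F) (M := M)))
    have : (fun v : HeightOneSpectrum R' => (k • Tinf F M R R') (Sum.inr v)) = 
        vlog R' (tM F M ^ k) + 0 := by
      ext v; simp [Tinf_inr, vlog_pow]
    rw [this]
    rw [show tM F M ^ k * (x * (tM F M)⁻¹ ^ k) = x by
      rw [mul_left_comm, ← mul_pow, mul_inv_cancel₀ tM_ne, one_pow, mul_one]] at h0
    exact h0.mpr (mem_lat_zero.mpr hx)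
  rw [Vk] at hz
  induction hz using Submodule.span_induction with
  | zero => exact zero_mem _
  | add x y _ _ hx hy => exact add_mem (hx trivial) (hy trivial)
  | mem x hx =>
    exact hl x (mem_Lk.mp hx).1
  | smul c x hx ih => 
    clear ih
    have key : ∀ (c : RatFunc F) (x : M), x ∈ Lk F M R R' (k + 1) → c • x ∈ Ss M (k • Tinf F M R R') := by
      intro c x hx
      obtain ⟨p, y, rfl⟩ := ratFunc_split c
      obtain ⟨h1, h2⟩ := mem_Lk.mp hx
      rw [add_smul]
      refine add_mem (hl _ ?_) (hr _ ?_)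
      · rw [Algebra.smul_def, ← IsScalarTower.algebraMap_apply, IsScalarTower.algebraMap_apply F[X] R M]
        exact mul_mem ⟨_, rfl⟩ h1
      · have e : (RatFunc.X⁻¹ * (y : RatFunc F)) • x * (tM F M)⁻¹ ^ k = algebraMap R' M (algebraMap (Oinf F) R' y) * (x * (tM F M)⁻¹ ^ (k + 1)) := by
          rw [← IsScalarTower.algebraMap_apply, IsScalarTower.algebraMap_apply (Oinf F) (RatFunc F) M, Algebra.smul_def, map_mul, map_inv₀, tM]
          change _ * algebraMap (RatFunc F) M y * _ * _ = _
          simp only [Subalgebra.algebraMap_def, Algebra.algebraMap_self_apply]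
          ring
        rw [e]
        exact mul_mem ⟨_, rfl⟩ h2
    induction hx using Submodule.span_induction generalizing c with
    | zero => rw [smul_zero]; exact zero_mem _
    | add x y _ _ hx hy => rw [smul_add]; exact add_mem (hx _ trivial) (hy _ trivial)
    | mem x hx => exact key c x hx
    | smul c' x hx ih => rw [smul_smul]; exact ih _ trivial
end Curve4

set_option linter.all false
/-! ## Part 4f: splitting field -/
section Curve5
open Polynomial IsDedekindDomain WithZero

variable {F : Type*} [Field F] {M : Type*} [Field M] [Algebra (RatFunc F) M]
  [Algebra F M] [IsScalarTower F (RatFunc F) M]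
  [Algebra F[X] M] [IsScalarTower F[X] (RatFunc F) M]
  {R R' : Type*} [CommRing R] [IsDedekindDomain R] [Algebra R M] [IsFractionRing R M]
  [Algebra F[X] R] [Module.Finite F[X] R] [IsScalarTower F[X] R M] 
  [Algebra F R] [IsScalarTower F R M]
  [CommRing R'] [IsDedekindDomain R'] [Algebra R' M] [IsFractionRing R' M]
  [Algebra (Oinf F) R'] [Module.Finite (Oinf F) R'] [IsScalarTower (Oinf F) R' M] 
  [Algebra F R'] [IsScalarTower F R' M]


theorem P_natDegree {f g : F[X]} {d : ℕ} (hd : max f.natDegree g.natDegree = d) (hd0 : 0 < d) {P : (RatFunc F)[X]}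
    (hP : P = f.map (algebraMap F (RatFunc F)) - C RatFunc.X * g.map (algebraMap F (RatFunc F))) :
    P.natDegree = d := by
  refine le_antisymm ?_ ?_
  · rw [hP]
    refine (natDegree_sub_le _ _).trans ?_
    refine max_le ?_ ?_
    · rw [natDegree_map, ← hd]; exact le_max_left _ _
    · refine (natDegree_C_mul_le _ _).trans ?_
      rw [natDegree_map, ← hd]; exact le_max_right _ _
  · refine le_natDegree_of_ne_zero ?_
    rw [hP, coeff_sub, coeff_C_mul, coeff_map, coeff_map]
    intro h
    have h2 : algebraMap F[X] (RatFunc F) (C (f.coeff d) - X * C (g.coeff d)) = 0 := by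
      rw [map_sub, map_mul, RatFunc.algebraMap_X]
      exact h
    rw [map_eq_zero_iff _ (RatFunc.algebraMap_injective F)] at h2
    have e0 := congrArg (fun p => coeff p 0) h2
    have e1 := congrArg (fun p => coeff p 1) h2
    simp [coeff_C] at e0 e1
    rcases max_choice f.natDegree g.natDegree with h3 | h3
    · rw [← hd, h3] at e0
      simp at e0
      rw [hd] at h3
      rw [e0] at h3; simp at h3; omega
    · rw [← hd, h3] at e1
      simp at e1
      rw [hd] at h3
      rw [e1] at h3; simp at h3; omega

theorem P_aeval {f g : F[X]} {P : (RatFunc F)[X]}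
    (hP : P = f.map (algebraMap F (RatFunc F)) - C RatFunc.X * g.map (algebraMap F (RatFunc F))) (x : M) :
    aeval x P = 0 ↔ aeval x f = tM F M * aeval x g := by
  rw [hP, map_sub, map_mul, aeval_C, aeval_map_algebraMap, aeval_map_algebraMap, sub_eq_zero, tM]

theorem W_top {f g : F[X]} (hcop : IsCoprime f g) {r : ℕ} (hr : 0 < r) (hd : max f.natDegree g.natDegree = r + 1)
    {P : (RatFunc F)[X]}
    (hP : P = f.map (algebraMap F (RatFunc F)) - C RatFunc.X * g.map (algebraMap F (RatFunc F)))
    [P.IsSplittingField (RatFunc F) M] : Ss M ((r - 1) • Tinf F M R R') = ⊤ := by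
  apply Ss_of_Vk
  rw [Nat.sub_add_cancel hr]
  have hPd := P_natDegree hd (by omega) hP
  have hP0 : P ≠ 0 := by rintro rfl; simp at hPd
  have hs := IsSplittingField.splits M P
  have hcard := hs.natDegree_eq_card_roots
  rw [natDegree_map, hPd] at hcard
  obtain ⟨x, hx0⟩ := Multiset.card_pos_iff_exists_mem.mp (show 0 < (P.map (algebraMap (RatFunc F) M)).roots.card by omega)
  obtain ⟨s, hxs⟩ := Multiset.exists_cons_of_mem hx0
  have hsc : s.card = r := by rw [hxs] at hcard; simp at hcard; omega
  have hroot : ∀ y ∈ (P.map (algebraMap (RatFunc F) M)).roots, aeval y P = 0 := by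
    intro y hy
    rw [mem_roots (map_ne_zero hP0), IsRoot, eval_map_algebraMap] at hy
    exact hy
  obtain ⟨u, hu, h⟩ := Vk_top (R := R) (R' := R') hcop hd (by omega) hPd s (fun y hy => by
    have := hroot y (by rw [hxs]; exact Multiset.mem_cons_of_mem hy)
    exact ⟨this, (P_aeval hP y).mp this⟩)
  have htop : Algebra.adjoin (RatFunc F) {x | x ∈ s} = ⊤ := by
    rw [eq_top_iff, ← IsSplittingField.adjoin_rootSet M P]
    refine Algebra.adjoin_le ?_
    intro y hy
    rw [mem_rootSet] at hy
    have hy' : y ∈ (P.map (algebraMap (RatFunc F) M)).roots := by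
      rw [mem_roots (map_ne_zero hP0), IsRoot, eval_map_algebraMap]; exact hy.2
    rw [hxs, Multiset.mem_cons] at hy'
    rcases hy' with rfl | hy'
    · have h1 := hs.nextCoeff_eq_neg_sum_roots_mul_leadingCoeff
      rw [hxs, Multiset.sum_cons] at h1
      have hl : (P.map (algebraMap (RatFunc F) M)).leadingCoeff ≠ 0 := by simpa using hP0
      have h2 : y = - algebraMap (RatFunc F) M (P.nextCoeff / P.leadingCoeff) - s.sum := by
        rw [nextCoeff_map (algebraMap (RatFunc F) M).injective, leadingCoeff_map] at h1
        have h3 : algebraMap (RatFunc F) M P.leadingCoeff ≠ 0 := by simpa using hP0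
        rw [map_div₀, h1]
        field_simp
        ring
      rw [h2]
      refine sub_mem (neg_mem (Subalgebra.algebraMap_mem _ _)) (multiset_sum_mem _ fun z hz => Algebra.subset_adjoin hz)
    · exact Algebra.subset_adjoin hy'
  rw [eq_top_iff]
  intro z _
  have := h (u⁻¹ * z) (by rw [htop]; trivial)
  rwa [← mul_assoc, mul_inv_cancel₀ hu, one_mul, hsc] at this
end Curve5

set_option linter.all false
/-! ## Part 5a: independence -/
section Indep
open Polynomial

theorem coprime_of_const {F M : Type*} [Field F] [Field M] [Algebra F M]
    (hconst : ∀ z : M, IsAlgebraic F z → ∃ c : F, algebraMap F M c = z)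
    {h : F[X]} (hm : h.Monic) (hirr : Irreducible h) {G : M[X]} (hG : G ≠ 0) (hdeg : G.natDegree < h.natDegree) :
    IsCoprime G (h.map (algebraMap F M)) := by
  classical
  set d := EuclideanDomain.gcd G (h.map (algebraMap F M)) with hd
  rw [← EuclideanDomain.gcd_isUnit_iff, ← hd]
  have hd1 : d ∣ G := EuclideanDomain.gcd_dvd_left _ _
  have hd2 : d ∣ h.map (algebraMap F M) := EuclideanDomain.gcd_dvd_right _ _
  have hd0 : d ≠ 0 := fun h0 => hG (by rw [h0] at hd1; exact zero_dvd_iff.mp hd1)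
  have hdm : (normalize d).Monic := monic_normalize hd0
  have hlift := integralClosure.mem_lifts_of_monic_of_dvd_map M hm hdm (by rwa [normalize_dvd_iff])
  have hlift2 : normalize d ∈ lifts (algebraMap F M) := by
    rw [lifts_iff_coeff_lifts] at hlift ⊢
    intro i
    obtain ⟨y, hy⟩ := hlift i
    obtain ⟨c, hc⟩ := hconst y (y.2.isAlgebraic)
    exact ⟨c, by rw [hc, ← hy]; rfl⟩
  obtain ⟨e, he⟩ := hlift2
  simp only [coe_mapRingHom] at he
  have hed : e ∣ h := by
    rw [← map_dvd_map' (algebraMap F M), he, normalize_dvd_iff]; exact hd2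
  have hdn : (normalize d).natDegree = d.natDegree := natDegree_eq_of_degree_eq (degree_normalize)
  rcases (hirr.dvd_iff.mp hed) with hu | hass
  · have : IsUnit (normalize d) := by rw [← he]; exact hu.map (mapRingHom (algebraMap F M))
    exact (normalize_associated d).isUnit this
  · exfalso
    have h1 : e.natDegree = h.natDegree := natDegree_eq_of_degree_eq (degree_eq_degree_of_associated hass.symm)
    have h2 := natDegree_le_of_dvd hd1 hG
    rw [← hdn, ← he, natDegree_map, h1] at h2
    omega

theorem det_ne {F M κ J : Type*} [Field F] [Field M] [Algebra F M] [Field κ] [Algebra F κ] [Fintype J]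
    (hconst : ∀ z : M, IsAlgebraic F z → ∃ c : F, algebraMap F M c = z)
    (pb : PowerBasis F κ) (C : J → M) (hC : LinearIndependent F C) (a : J → κ) (ha : ∃ j, a j ≠ 0) :
    (∑ j, C j • (Algebra.leftMulMatrix pb.basis (a j)).map (algebraMap F M)).det ≠ 0 := by
  classical
  have : FiniteDimensional F κ := pb.finite
  -- polynomials
  have hp : ∀ x : κ, ∃ p : F[X], p.degree < pb.dim ∧ aeval pb.gen p = x := by
    intro x
    obtain ⟨p, hx⟩ := pb.exists_eq_aeval' x
    refine ⟨p %ₘ minpoly F pb.gen, ?_, ?_⟩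
    · refine (degree_modByMonic_lt _ (minpoly.monic pb.isIntegral_gen)).trans_eq ?_
      exact pb.degree_minpoly
    · rw [hx, aeval_modByMonic_eq_self_of_root (minpoly.aeval _ _)]
  choose p hpd hpa using fun j => hp (a j)
  set G : M[X] := ∑ j, Polynomial.C (C j) * (p j).map (algebraMap F M) with hG
  set H : Matrix (Fin pb.dim) (Fin pb.dim) M := (Algebra.leftMulMatrix pb.basis pb.gen).map (algebraMap F M) with hH
  have hmapH : ∀ x : F[X], (Algebra.leftMulMatrix pb.basis (aeval pb.gen x)).map (algebraMap F M) = aeval H (x.map (algebraMap F M)) := by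
    intro x
    have e1 : Algebra.leftMulMatrix pb.basis (aeval pb.gen x) = aeval (Algebra.leftMulMatrix pb.basis pb.gen) x := 
      (aeval_algHom_apply (Algebra.leftMulMatrix pb.basis) pb.gen x).symm
    rw [e1, aeval_map_algebraMap]
    have e2 := aeval_algHom_apply ((Algebra.ofId F M).mapMatrix (m := Fin pb.dim)) (Algebra.leftMulMatrix pb.basis pb.gen) x
    exact e2.symm
  have hA : (∑ j, C j • (Algebra.leftMulMatrix pb.basis (a j)).map (algebraMap F M)) = aeval H G := by
    rw [hG, map_sum]
    refine Finset.sum_congr rfl fun j _ => ?_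
    rw [map_mul, aeval_C, ← hmapH, hpa, ← Algebra.smul_def]
  have hG0 : G ≠ 0 := by
    obtain ⟨j, hj⟩ := ha
    intro h0
    apply hj
    rw [← hpa j]
    have : p j = 0 := by
      ext k
      have hk := congrArg (fun P => coeff P k) h0
      simp only [hG, finsetSum_coeff, coeff_C_mul, coeff_map, coeff_zero] at hk
      have := Fintype.linearIndependent_iff.mp hC (fun j => (p j).coeff k) (by
        rw [← hk]; refine Finset.sum_congr rfl fun i _ => ?_
        rw [Algebra.smul_def, mul_comm]) j
      simpa using this
    rw [this, map_zero]
  have hm := minpoly.monic pb.isIntegral_gen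
  have hdeg : G.natDegree < (minpoly F pb.gen).natDegree := by
    rw [pb.natDegree_minpoly, natDegree_lt_iff_degree_lt hG0]
    refine (degree_sum_le _ _).trans_lt ?_
    rw [Finset.sup_lt_iff (by exact WithBot.bot_lt_coe _)]
    intro j _
    refine (degree_mul_le _ _).trans_lt ?_
    rw [degree_map]
    refine lt_of_le_of_lt ?_ (hpd j)
    calc _ ≤ 0 + (p j).degree := by gcongr; exact degree_C_le
      _ = _ := zero_add _
  obtain ⟨u, v, huv⟩ := coprime_of_const hconst hm (minpoly.irreducible pb.isIntegral_gen) hG0 hdeg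
  have h1 := congrArg (aeval H) huv
  rw [map_add, map_mul, map_mul, ← hmapH, minpoly.aeval, map_zero, Matrix.map_zero _ (map_zero _), mul_zero, add_zero, map_one, ← hA] at h1
  exact (Matrix.isUnit_det_of_left_inverse h1).ne_zero

theorem det_zero {F S κ J : Type*} [Field F] [CommRing S] [Algebra F S] [CommRing κ] [Algebra F κ] [Fintype J]
    {n : Type*} [Fintype n] [DecidableEq n] (b : Module.Basis n F κ) (φ : κ →ₐ[F] S) (c : J → S) (a : J → κ)
    (h : ∑ j, φ (a j) * c j = 0) :
    (∑ j, c j • (Algebra.leftMulMatrix b (a j)).map (algebraMap F S)).det = 0 := by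
  set A : Matrix n n S := ∑ j, c j • (Algebra.leftMulMatrix b (a j)).map (algebraMap F S) with hA
  set w : n → S := fun i => φ (b i) with hw
  have h1 : Matrix.vecMul w A = 0 := by
    ext k
    have h2 : ∀ x : κ, ∑ i, φ (b i) * algebraMap F S (Algebra.leftMulMatrix b x i k) = φ (x * b k) := by
      intro x
      conv_rhs => rw [← b.sum_repr (x * b k)]
      rw [map_sum]
      refine Finset.sum_congr rfl fun i _ => ?_
      rw [Algebra.leftMulMatrix_eq_repr_mul, map_smul, Algebra.smul_def, mul_comm]
    simp only [Matrix.vecMul, dotProduct, hA, Matrix.sum_apply, Matrix.smul_apply, Matrix.map_apply, smul_eq_mul, Finset.mul_sum, Pi.zero_apply, hw]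
    rw [Finset.sum_comm]
    have : ∀ j, ∑ i, φ (b i) * (c j * algebraMap F S (Algebra.leftMulMatrix b (a j) i k)) = φ (a j) * c j * φ (b k) := by
      intro j
      rw [mul_right_comm, ← map_mul, ← h2, Finset.sum_mul]
      exact Finset.sum_congr rfl fun i _ => by ring
    simp only [this]
    rw [← Finset.sum_mul, h, zero_mul]
  have h3 : Matrix.vecMul w (A * A.adjugate) = 0 := by
    rw [← Matrix.vecMul_vecMul, h1, Matrix.zero_vecMul]
  rw [Matrix.mul_adjugate, Matrix.vecMul_smul, Matrix.vecMul_one] at h3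
  have h4 : ∑ i, algebraMap F S (b.repr 1 i) * w i = 1 := by
    rw [← map_one φ]
    conv_rhs => rw [← b.sum_repr 1]
    rw [map_sum]
    exact Finset.sum_congr rfl fun i _ => by rw [map_smul, Algebra.smul_def]
  calc A.det = A.det * ∑ i, algebraMap F S (b.repr 1 i) * w i := by rw [h4, mul_one]
    _ = ∑ i, algebraMap F S (b.repr 1 i) * (A.det • w) i := by
        rw [Finset.mul_sum]; exact Finset.sum_congr rfl fun i _ => by simp; ring
    _ = 0 := by rw [h3]; simp

theorem frob_lift {F R : Type*} [Field F] [Finite F] [CommRing R] [Algebra F R] (P : Ideal R) (s : ℕ) :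
    ∃ φ : (R ⧸ P) →ₐ[F] (R ⧸ P ^ (Nat.card F ^ s)), ∀ x : R, φ (Ideal.Quotient.mk _ x) = Ideal.Quotient.mk _ (x ^ (Nat.card F ^ s)) := by
  letI := Fintype.ofFinite F
  have h : ∀ x : R, ((FiniteField.frobeniusAlgHom F R) ^ s) x = x ^ (Nat.card F ^ s) := by
    intro x
    rw [AlgHom.coe_pow, FiniteField.coe_frobeniusAlgHom, pow_iterate, Nat.card_eq_fintype_card]
  refine ⟨Ideal.Quotient.liftₐ P ((Ideal.Quotient.mkₐ F _).comp ((FiniteField.frobeniusAlgHom F R) ^ s)) ?_, ?_⟩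
  · intro x hx
    rw [AlgHom.comp_apply, h, Ideal.Quotient.mkₐ_eq_mk, Ideal.Quotient.eq_zero_iff_mem]
    exact Ideal.pow_mem_pow hx _
  · intro x
    rw [← h]; rfl
end Indep

set_option linter.all false
/-! ## Part 5b: zero counting and independence on the curve -/
section ZeroCount
open IsDedekindDomain WithZero
theorem dvDeg_mono {R R' : Type*} [CommRing R] [IsDedekindDomain R] [CommRing R'] [IsDedekindDomain R'] (q : ℕ)
    {D E : Pl R R' →₀ ℤ} (h : ∀ v, D v ≤ E v) : dvDeg q D ≤ dvDeg q E := by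
  rw [← sub_nonneg, ← dvDeg_sub, dvDeg]
  refine Finsupp.sum_nonneg fun v _ => mul_nonneg ?_ (by positivity)
  have := h v
  simp only [Finsupp.coe_sub, Pi.sub_apply]; omega

theorem dvDeg_sum {R R' ι : Type*} [CommRing R] [IsDedekindDomain R] [CommRing R'] [IsDedekindDomain R'] (q : ℕ)
    (s : Finset ι) (D : ι → Pl R R' →₀ ℤ) : dvDeg q (∑ i ∈ s, D i) = ∑ i ∈ s, dvDeg q (D i) := 
  map_sum (AddMonoidHom.mk' (dvDeg q) (dvDeg_add q)) D s

theorem vlog_le_of_mem {R M : Type*} [CommRing R] [IsDedekindDomain R] [Field M] [Algebra R M] [IsFractionRing R M]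
    {v : HeightOneSpectrum R} {y : R} (hy : y ≠ 0) {e : ℕ} (h : y ∈ v.asIdeal ^ e) :
    vlog R (algebraMap R M y) v ≤ -(e : ℤ) := by
  have hy' : algebraMap R M y ≠ 0 := by simpa using hy
  rw [← exp_le_exp, exp_vlog hy', HeightOneSpectrum.valuation_of_algebraMap, HeightOneSpectrum.intValuation_le_pow_iff_mem]
  exact h
end ZeroCount
section Curve6
open Polynomial IsDedekindDomain WithZero

variable {F : Type*} [Field F] {M : Type*} [Field M] [Algebra (RatFunc F) M]
  [Algebra F M] [IsScalarTower F (RatFunc F) M]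
  [Algebra F[X] M] [IsScalarTower F[X] (RatFunc F) M]
  {R R' : Type*} [CommRing R] [IsDedekindDomain R] [Algebra R M] [IsFractionRing R M]
  [Algebra F[X] R] [Module.Finite F[X] R] [IsScalarTower F[X] R M] 
  [Algebra F R] [IsScalarTower F R M]
  [CommRing R'] [IsDedekindDomain R'] [Algebra R' M] [IsFractionRing R' M]
  [Algebra (Oinf F) R'] [Module.Finite (Oinf F) R'] [IsScalarTower (Oinf F) R' M] 
  [Algebra F R'] [IsScalarTower F R' M]

theorem zero_count [Finite F] [FiniteDimensional (RatFunc F) M]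
    (h0 : Nat.card (Ls M (0 : Pl R R' → ℤ)) = Nat.card F) (W : Pl R R' →₀ ℤ)
    (hW : Ss M W = ⊤) (l : ℕ) (hl : Nat.card (Ls M W) = Nat.card F ^ l)
    {k : ℕ} {x : M} (hx : x ≠ 0) (hxk : x ∈ Lk F M R R' k) (T : Finset (HeightOneSpectrum R))
    (e : HeightOneSpectrum R → ℕ) (he : ∀ v ∈ T, vlog R x v ≤ -(e v : ℤ)) :
    ∑ v ∈ T, e v * plDeg (Nat.card F) (.inl v : Pl R R') ≤ Module.finrank (RatFunc F) M * k := by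
  classical
  have h1 := dvDeg_pdiv (curve_hpow F) Finite.one_lt_card h0 W hW l hl hx
  have h2 : dvDeg (Nat.card F) (pdiv R R' x) ≤ dvDeg (Nat.card F) (k • Tinf F M R R' - ∑ v ∈ T, Finsupp.single (.inl v : Pl R R') (e v : ℤ)) := by
    refine dvDeg_mono _ fun P => ?_
    have h3 := (mem_Ls_iff hx).mp hxk P
    simp only [Finsupp.coe_sub, Pi.sub_apply, Finsupp.coe_finset_sum, Finset.sum_apply]
    rcases P with v | v
    · simp only [Finsupp.single_apply, Sum.inl.injEq, Finset.sum_ite_eq']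
      split_ifs with hv
      · rw [Finsupp.smul_apply, Tinf_inl, smul_zero, pdiv_inl]
        have := he v hv; omega
      · simpa using h3
    · simpa [Finsupp.single_apply] using h3
  rw [h1, dvDeg_sub, dvDeg_nsmul, deg_Tinf, dvDeg_sum] at h2
  simp only [dvDeg_single] at h2
  rw [mul_comm]
  zify
  linarith

theorem Lk_sum_det {d c : ℕ} {A : Matrix (Fin d) (Fin d) M} (hA : ∀ i j, A i j ∈ Lk F M R R' c) :
    A.det ∈ Lk F M R R' (c * d) := by
  rw [Matrix.det_apply]
  refine AddSubgroup.sum_mem _ fun σ _ => ?_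
  have hp : ∀ s : Finset (Fin d), ∏ i ∈ s, A (σ i) i ∈ Lk F M R R' (c * s.card) := by
    intro s
    induction s using Finset.induction_on with
    | empty => simpa using Lk_one
    | insert a s ha ih =>
      rw [Finset.prod_insert ha, Finset.card_insert_of_notMem ha, mul_add_one, add_comm]
      exact Lk_mul (hA _ _) ih
  have := hp Finset.univ
  rw [Finset.card_univ, Fintype.card_fin] at this
  rcases Int.units_eq_one_or (Equiv.Perm.sign σ) with h | h <;> rw [h]
  · simpa using this
  · simpa using neg_mem this

variable (F M) in
include F M in
theorem exists_avoid {x : R} (hx : x ≠ 0) : ∃ v : HeightOneSpectrum R, x ∉ v.asIdeal := by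
  have hj : IsJacobsonRing R := isJacobsonRing_of_isIntegral (R := F[X])
  have h1 : x ∉ (⊥ : Ideal R).jacobson := by
    rw [← Ideal.radical_eq_jacobson, (Ideal.isPrime_bot (α := R)).radical]; simpa using hx
  rw [Ideal.jacobson, Ideal.mem_sInf] at h1
  push Not at h1
  obtain ⟨P, ⟨_, hP⟩, hxP⟩ := h1
  refine ⟨⟨P, hP.isPrime, ?_⟩, hxP⟩
  rintro rfl
  have hf : IsField R := by
    exact Ring.isField_iff_maximal_bot.mpr hP
  have := (Algebra.IsIntegral.of_finite F[X] R).isField_iff_isField (algMap_inj M)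
  exact Polynomial.not_isField F (this.mpr hf)

theorem indep [Finite F] [FiniteDimensional (RatFunc F) M]
    (hconst : ∀ z : M, IsAlgebraic F z → ∃ c : F, algebraMap F M c = z)
    (h0 : Nat.card (Ls M (0 : Pl R R' → ℤ)) = Nat.card F) (W : Pl R R' →₀ ℤ)
    (hW : Ss M W = ⊤) (l : ℕ) (hl : Nat.card (Ls M W) = Nat.card F ^ l)
    {J : Type*} [Fintype J] {c s : ℕ} (hcs : Module.finrank (RatFunc F) M * c < Nat.card F ^ s)
    (C : J → M) (hC : LinearIndependent F C) (hCc : ∀ j, C j ∈ Lk F M R R' c) (A : J → R) (hA : ∃ j, A j ≠ 0) :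
    ∑ j, (algebraMap R M (A j)) ^ (Nat.card F ^ s) * C j ≠ 0 := by
  intro hsum
  obtain ⟨j0, hj0⟩ := hA
  obtain ⟨v, hv⟩ := exists_avoid F M hj0
  have := resF_finite (F := F) v
  have := v.isMaximal
  letI := Ideal.Quotient.field v.asIdeal
  set Q := Nat.card F ^ s
  obtain ⟨φ, hφ⟩ := frob_lift (F := F) v.asIdeal s
  choose cc hcc using fun j => (mem_Lk.mp (hCc j)).1
  have : FiniteDimensional F (R ⧸ v.asIdeal) := Module.Finite.of_finite
  have : Algebra.IsSeparable F (R ⧸ v.asIdeal) := inferInstance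
  let pb : PowerBasis F (R ⧸ v.asIdeal) := Field.powerBasisOfFiniteOfSeparable F (R ⧸ v.asIdeal)
  let a : J → R ⧸ v.asIdeal := fun j => Ideal.Quotient.mk _ (A j)
  have hsumR : ∑ j, A j ^ Q * cc j = 0 := by
    apply IsFractionRing.injective R M
    rw [map_sum, map_zero, ← hsum]
    exact Finset.sum_congr rfl fun j _ => by rw [map_mul, map_pow, hcc]
  have hz : ∑ j, φ (a j) * Ideal.Quotient.mk (v.asIdeal ^ Q) (cc j) = 0 := by
    have := congrArg (Ideal.Quotient.mk (v.asIdeal ^ Q)) hsumR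
    rw [map_sum, map_zero] at this
    rw [← this]
    exact Finset.sum_congr rfl fun j _ => by rw [map_mul, hφ]
  have d1 := det_zero pb.basis φ _ a hz
  have d2 := det_ne hconst pb C hC a ⟨j0, by simpa [a, Ideal.Quotient.eq_zero_iff_mem] using hv⟩
  set B : Matrix (Fin pb.dim) (Fin pb.dim) R := ∑ j, cc j • (Algebra.leftMulMatrix pb.basis (a j)).map (algebraMap F R) with hB
  have e1 : (Ideal.Quotient.mk (v.asIdeal ^ Q)).mapMatrix B = ∑ j, Ideal.Quotient.mk (v.asIdeal ^ Q) (cc j) • (Algebra.leftMulMatrix pb.basis (a j)).map (algebraMap F (R ⧸ v.asIdeal ^ Q)) := by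
    ext i k
    simp [hB, Matrix.sum_apply]
  have e2 : (algebraMap R M).mapMatrix B = ∑ j, C j • (Algebra.leftMulMatrix pb.basis (a j)).map (algebraMap F M) := by
    ext i k
    simp [hB, Matrix.sum_apply, hcc, ← IsScalarTower.algebraMap_apply]
  rw [← e1, ← RingHom.map_det, Ideal.Quotient.eq_zero_iff_mem] at d1
  have hdM := Lk_sum_det (R := R) (R' := R') (F := F) (c := c) (A := (algebraMap R M).mapMatrix B) (by
    rw [e2]
    intro i k
    rw [Matrix.sum_apply]
    refine AddSubgroup.sum_mem _ fun j _ => ?_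
    have := Lk_mul (hCc j) (Lk_const (Algebra.leftMulMatrix pb.basis (a j) i k))
    simpa using this)
  rw [← e2] at d2
  have hB0 : B.det ≠ 0 := by
    intro h; apply d2; rw [← RingHom.map_det, h, map_zero]
  rw [← RingHom.map_det] at hdM d2
  have hcnt := zero_count h0 W hW l hl d2 hdM {v} (fun _ => Q) (by
    intro w hw
    rw [Finset.mem_singleton] at hw
    subst hw
    exact vlog_le_of_mem hB0 d1)
  rw [Finset.sum_singleton] at hcnt
  have hdim : plDeg (Nat.card F) (Sum.inl v : Pl R R') = pb.dim := by
    have h3 : Nat.card (R ⧸ v.asIdeal) = _ := resCard_eq (curve_hpow F) Finite.one_lt_card (Sum.inl v : Pl R R')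
    rw [Module.natCard_eq_pow_finrank (K := F), pb.finrank] at h3
    exact (Nat.pow_right_injective Finite.one_lt_card h3).symm
  have hpos := plDeg_pos (curve_hpow F) Finite.one_lt_card (Sum.inl v : Pl R R')
  rw [hdim] at hcnt hpos
  rw [← mul_assoc] at hcnt
  have := Nat.le_of_mul_le_mul_right hcnt hpos
  omega
end Curve6

set_option linter.all false
/-! ## Part 5c: Stepanov argument -/
section Curve7
open Polynomial IsDedekindDomain WithZero

variable {F : Type*} [Field F] {M : Type*} [Field M] [Algebra (RatFunc F) M]
  [Algebra F M] [IsScalarTower F (RatFunc F) M]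
  [Algebra F[X] M] [IsScalarTower F[X] (RatFunc F) M]
  {R R' : Type*} [CommRing R] [IsDedekindDomain R] [Algebra R M] [IsFractionRing R M]
  [Algebra F[X] R] [Module.Finite F[X] R] [IsScalarTower F[X] R M] 
  [Algebra F R] [IsScalarTower F R M]
  [CommRing R'] [IsDedekindDomain R'] [Algebra R' M] [IsFractionRing R' M]
  [Algebra (Oinf F) R'] [Module.Finite (Oinf F) R'] [IsScalarTower (Oinf F) R' M] 
  [Algebra F R'] [IsScalarTower F R' M]

theorem mem_range_iff_int {x : M} : x ∈ (algebraMap R M).range ↔ IsIntegral F[X] x := by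
  constructor
  · rintro ⟨y, rfl⟩
    exact (Algebra.IsIntegral.isIntegral y).algebraMap
  · intro h
    have h2 : IsIntegral R x := h.tower_top
    exact IsIntegrallyClosed.isIntegral_iff.mp h2

theorem mem_range_iff_int' {x : M} : x ∈ (algebraMap R' M).range ↔ IsIntegral (Oinf F) x := by
  constructor
  · rintro ⟨y, rfl⟩
    exact (Algebra.IsIntegral.isIntegral y).algebraMap
  · intro h
    have h2 : IsIntegral R' x := h.tower_top
    exact IsIntegrallyClosed.isIntegral_iff.mp h2

theorem sigma_t (σ : M ≃ₐ[RatFunc F] M) : σ (tM F M) = tM F M := by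
  rw [tM, AlgEquiv.commutes]

include F in
theorem sigma_range (σ : M ≃ₐ[RatFunc F] M) {x : M} (hx : x ∈ (algebraMap R M).range) :
    σ x ∈ (algebraMap R M).range := by
  rw [mem_range_iff_int (F := F)] at hx ⊢
  exact hx.map (σ.toAlgHom.restrictScalars F[X])

include F in
theorem sigma_range' (σ : M ≃ₐ[RatFunc F] M) {x : M} (hx : x ∈ (algebraMap R' M).range) :
    σ x ∈ (algebraMap R' M).range := by
  rw [mem_range_iff_int' (F := F)] at hx ⊢
  exact hx.map (σ.toAlgHom.restrictScalars (Oinf F))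

theorem sigma_Lk (σ : M ≃ₐ[RatFunc F] M) {k : ℕ} {x : M} (hx : x ∈ Lk F M R R' k) : σ x ∈ Lk F M R R' k := by
  rw [mem_Lk] at *
  refine ⟨sigma_range σ hx.1, ?_⟩
  have := sigma_range' σ hx.2
  rwa [map_mul, map_pow, map_inv₀, sigma_t] at this

variable (R) in
/-- places where Frobenius acts as `σ` -/
def Xs (σ : M ≃ₐ[RatFunc F] M) (Q : ℕ) : Set (HeightOneSpectrum R) :=
  {v | ∀ b b' : R, algebraMap R M b' = σ (algebraMap R M b) → b ^ Q - b' ∈ v.asIdeal}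

theorem frob_sum {F R J : Type*} [Field F] [Finite F] [CommRing R] [Algebra F R] (s : Finset J) (k : ℕ) (x : J → R) :
    (∑ j ∈ s, x j) ^ (Nat.card F ^ k) = ∑ j ∈ s, x j ^ (Nat.card F ^ k) := by
  letI := Fintype.ofFinite F
  have h : ∀ x : R, ((FiniteField.frobeniusAlgHom F R) ^ k) x = x ^ (Nat.card F ^ k) := by
    intro x
    rw [AlgHom.coe_pow, FiniteField.coe_frobeniusAlgHom, pow_iterate, Nat.card_eq_fintype_card]
  simp only [← h, map_sum]

theorem stepanov_core [Finite F] [FiniteDimensional (RatFunc F) M]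
    (hconst : ∀ z : M, IsAlgebraic F z → ∃ c : F, algebraMap F M c = z)
    (h0 : Nat.card (Ls M (0 : Pl R R' → ℤ)) = Nat.card F) (W : Pl R R' →₀ ℤ)
    (hW : Ss M W = ⊤) (l : ℕ) (hl : Nat.card (Ls M W) = Nat.card F ^ l)
    (σ : M ≃ₐ[RatFunc F] M) {a c k s N : ℕ} (hcs : Module.finrank (RatFunc F) M * c < Nat.card F ^ s)
    (hN : Nat.card (Lk F M R R' c) = Nat.card F ^ N)
    (hcard : Nat.card (Lk F M R R' (a + c * Nat.card F ^ k)) < Nat.card (Lk F M R R' a) ^ N)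
    (T : Finset (HeightOneSpectrum R)) (hT : ∀ v ∈ T, v ∈ Xs R σ (Nat.card F ^ (k + s))) :
    ∑ v ∈ T, plDeg (Nat.card F) (.inl v : Pl R R') ≤ Module.finrank (RatFunc F) M * (a * Nat.card F ^ s + c) := by
  have hfin := Lk_finite (F := F) (R := R) (R' := R') h0
  have : Finite (LkF F M R R' c) := hfin c
  have hNr : Module.finrank F (LkF F M R R' c) = N := by
    have h1 : Nat.card (LkF F M R R' c) = _ := Module.natCard_eq_pow_finrank (K := F)
    exact Nat.pow_right_injective Finite.one_lt_card (h1.symm.trans hN)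
  let bs := Module.finBasis F (LkF F M R R' c)
  let C : Fin (Module.finrank F (LkF F M R R' c)) → M := fun j => (bs j : M)
  have hC : LinearIndependent F C := bs.linearIndependent.map' (LkF F M R R' c).subtype (Submodule.ker_subtype _)
  have hCc : ∀ j, C j ∈ Lk F M R R' c := fun j => (bs j).2
  set Q := Nat.card F ^ k with hQ
  set Q' := Nat.card F ^ s with hQ'
  let Ψ : (Fin (Module.finrank F (LkF F M R R' c)) → Lk F M R R' a) → Lk F M R R' (a + c * Q) :=
    fun A => ⟨∑ j, σ (A j) * C j ^ Q, AddSubgroup.sum_mem _ fun j _ => Lk_mul (sigma_Lk σ (A j).2) (Lk_pow (hCc j) Q)⟩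
  have hninj : ¬ Function.Injective Ψ := by
    intro hinj
    have := hfin (a + c * Q)
    have := Nat.card_le_card_of_injective Ψ hinj
    rw [Nat.card_fun, Nat.card_fin, hNr] at this
    omega
  rw [Function.Injective] at hninj
  push Not at hninj
  obtain ⟨A1, A2, hA, hne⟩ := hninj
  let A : Fin (Module.finrank F (LkF F M R R' c)) → Lk F M R R' a := fun j => A1 j - A2 j
  have hA0 : ∑ j, σ (A j) * C j ^ Q = 0 := by
    have h1 := congrArg Subtype.val hA
    simp only [Ψ] at h1
    rw [← sub_eq_zero, ← Finset.sum_sub_distrib] at h1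
    rw [← h1]
    exact Finset.sum_congr rfl fun j _ => by simp [A, sub_mul]
  choose AR hAR using fun j => (mem_Lk.mp (A j).2).1
  choose CR hCR using fun j => (mem_Lk.mp (hCc j)).1
  choose AS hAS using fun j => (mem_Lk.mp (sigma_Lk σ (A j).2)).1
  have hex : ∃ j, AR j ≠ 0 := by
    by_contra hcon
    push Not at hcon
    apply hne
    ext j
    have := hAR j
    rw [hcon j, map_zero] at this
    simp only [A, AddSubgroup.coe_sub] at this
    exact (sub_eq_zero.mp this.symm)
  have hu := indep hconst h0 W hW l hl hcs C hC hCc AR hex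
  have huL : ∑ j, (algebraMap R M (AR j)) ^ Q' * C j ∈ Lk F M R R' (a * Q' + c) := by
    refine AddSubgroup.sum_mem _ fun j _ => Lk_mul ?_ (hCc j)
    rw [hAR]
    exact Lk_pow (A j).2 Q'
  set uR : R := ∑ j, AR j ^ Q' * CR j with huR
  have huM : algebraMap R M uR = ∑ j, (algebraMap R M (AR j)) ^ Q' * C j := by
    rw [huR, map_sum]; exact Finset.sum_congr rfl fun j _ => by rw [map_mul, map_pow, hCR]
  rw [← huM] at hu huL
  have hzero : ∑ j, AS j * CR j ^ Q = 0 := by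
    apply IsFractionRing.injective R M
    rw [map_sum, map_zero, ← hA0]
    exact Finset.sum_congr rfl fun j _ => by rw [map_mul, map_pow, hCR, hAS]
  have hcnt := zero_count h0 W hW l hl hu huL T (fun _ => 1) (by
    intro v hv
    refine vlog_le_of_mem (by rintro h; rw [h, map_zero] at hu; exact hu rfl) ?_
    rw [pow_one]
    apply v.isPrime.mem_of_pow_mem Q
    rw [huR, frob_sum (F := F)]
    have e : ∑ j, (AR j ^ Q' * CR j) ^ Q = ∑ j, (AR j ^ (Nat.card F ^ (k + s)) - AS j) * CR j ^ Q := by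
      rw [← sub_zero (∑ j, (AR j ^ Q' * CR j) ^ Q), ← hzero, ← Finset.sum_sub_distrib]
      refine Finset.sum_congr rfl fun j _ => ?_
      rw [sub_mul, mul_pow, ← pow_mul, pow_add, mul_comm Q']
    rw [e]
    refine Ideal.sum_mem _ fun j _ => Ideal.mul_mem_right _ _ (hT v hv _ _ ?_)
    rw [hAS, hAR])
  simpa using hcnt
end Curve7

set_option linter.all false
/-! ## Part 5d: Stepanov bound -/
section Curve8
open Polynomial IsDedekindDomain WithZero

variable {F : Type*} [Field F] {M : Type*} [Field M] [Algebra (RatFunc F) M]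
  [Algebra F M] [IsScalarTower F (RatFunc F) M]
  [Algebra F[X] M] [IsScalarTower F[X] (RatFunc F) M]
  {R R' : Type*} [CommRing R] [IsDedekindDomain R] [Algebra R M] [IsFractionRing R M]
  [Algebra F[X] R] [Module.Finite F[X] R] [IsScalarTower F[X] R M] 
  [Algebra F R] [IsScalarTower F R M]
  [CommRing R'] [IsDedekindDomain R'] [Algebra R' M] [IsFractionRing R' M]
  [Algebra (Oinf F) R'] [Module.Finite (Oinf F) R'] [IsScalarTower (Oinf F) R' M] 
  [Algebra F R'] [IsScalarTower F R' M]

theorem lk_dim [Finite F] [FiniteDimensional (RatFunc F) M]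
    (h0 : Nat.card (Ls M (0 : Pl R R' → ℤ)) = Nat.card F) (w : ℕ)
    (hW : Ss M (w • Tinf F M R R') = ⊤) (l : ℕ) (hl : Nat.card (Ls M (w • Tinf F M R R')) = Nat.card F ^ l) :
    ∃ lk : ℕ → ℕ, ∀ k, Nat.card (Lk F M R R' k) = Nat.card F ^ lk k ∧
      (Module.finrank (RatFunc F) M * k - Module.finrank (RatFunc F) M * w + l : ℤ) ≤ lk k ∧
      (w ≤ k → (lk k : ℤ) = Module.finrank (RatFunc F) M * k - Module.finrank (RatFunc F) M * w + l) := by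
  have hq : 1 < Nat.card F := Finite.one_lt_card
  choose lk hlk1 hlk using card_Lk (F := F) (M := M) (R := R) (R' := R') h0
  refine ⟨lk, fun k => ⟨hlk k, ?_⟩⟩
  have hq1 : (1 : ℚ) < Nat.card F := by exact_mod_cast hq
  have hW' : Ss M (w • Tinf F M R R' : Pl R R' →₀ ℤ) = ⊤ := hW
  have hl' : Nat.card (Ls M (w • Tinf F M R R' : Pl R R' →₀ ℤ)) = Nat.card F ^ l := hl
  have h1 := card_Ls (M := M) (curve_hpow F) hq (by rw [h0]; omega) (w • Tinf F M R R') hW' l hl' (k • Tinf F M R R')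
  rw [dvDeg_nsmul, dvDeg_nsmul, deg_Tinf] at h1
  have h2 : (Nat.card (Lk F M R R' k) : ℚ) = _ := h1
  rw [hlk k] at h2
  rw [Nat.cast_pow] at h2
  constructor
  · rw [← zpow_le_zpow_iff_right₀ hq1, zpow_natCast, h2]
    have hi : (Ss M (k • Tinf F M R R')).index ≠ 0 := by
      intro h
      have h3 : (Nat.card F : ℚ) ^ lk k ≠ 0 := pow_ne_zero _ (by linarith)
      apply h3
      rw [h2]
      have : ((Ss M (k • Tinf F M R R' : Pl R R' →₀ ℤ)).index : ℚ) = 0 := by exact_mod_cast h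
      rw [this, mul_zero]
    have : (1 : ℚ) ≤ ((Ss M (k • Tinf F M R R' : Pl R R' →₀ ℤ)).index : ℚ) := by exact_mod_cast Nat.one_le_iff_ne_zero.mpr hi
    rw [mul_comm (Module.finrank (RatFunc F) M : ℤ), mul_comm (Module.finrank (RatFunc F) M : ℤ)]
    exact le_mul_of_one_le_right (zpow_nonneg (by linarith) _) this
  · intro hwk
    have ht : Ss M (k • Tinf F M R R' : Pl R R' →₀ ℤ) = ⊤ := by
      rw [eq_top_iff, ← hW]
      refine Ss_mono fun v => ?_
      simp only [Finsupp.smul_apply, Pi.smul_apply, nsmul_eq_mul]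
      have := Tinf_nonneg (F := F) (M := M) v
      have h5 : (w : ℤ) ≤ k := by exact_mod_cast hwk
      exact mul_le_mul_of_nonneg_right h5 this
    rw [ht, AddSubgroup.index_top, Nat.cast_one, mul_one, ← zpow_natCast] at h2
    have := zpow_right_injective₀ (by linarith) hq1.ne' h2
    rw [this]; ring

theorem stepanov_numeric {n E w l Q Q' : ℕ} (hn : 1 ≤ n) (hE : E = n * w) (hl : 1 ≤ l) (hQQ : Q ≤ Q')
    (hQ' : 2 * (n + E + 1) ≤ Q') (lk : ℕ → ℕ) (h1 : ∀ k : ℕ, (n * k - n * w + l : ℤ) ≤ lk k)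
    (h2 : ∀ k, w ≤ k → (lk k : ℤ) = n * k - n * w + l) {K a c : ℕ} (hK : K = n + E + 2 * (1 + E) + 1)
    (ha : a = (Q + K) / n) (hc : c = (Q' - 1) / n) :
    n * c < Q' ∧ lk (a + c * Q) < lk a * lk c ∧ n * (a * Q' + c) ≤ Q * Q' + (K + 1) * Q' := by
  have hc1 : n * c ≤ Q' - 1 := by rw [hc]; exact Nat.mul_div_le _ _
  have hc2 : Q' - 1 < n * c + n := by rw [hc]; have := Nat.lt_mul_div_succ (Q' - 1) hn; rw [mul_add, mul_one] at this; exact this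
  have ha1 : n * a ≤ Q + K := by rw [ha]; exact Nat.mul_div_le _ _
  have ha2 : Q + K < n * a + n := by rw [ha]; have := Nat.lt_mul_div_succ (Q + K) hn; rw [mul_add, mul_one] at this; exact this
  have haw : w ≤ a := by
    by_contra h
    push Not at h
    have : n * (a + 1) ≤ n * w := Nat.mul_le_mul_left _ h
    rw [mul_add] at this
    omega
  refine ⟨by omega, ?_, ?_⟩
  · have e1 := h2 a haw
    have e2 := h1 c
    have e3 := h2 (a + c * Q) (by omega)
    zify
    rw [e3]
    have hE' : (E : ℤ) = n * w := by exact_mod_cast hE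
    rw [← hE'] at *
    have hb1 : (Q' : ℤ) ≤ n * c + n := by zify at hc2; omega
    have ha3 : (Q + 2 * E + 5 : ℤ) ≤ lk a := by
      rw [e1]; zify at ha2 hK; omega
    have hb2 : (n * c - E + 1 : ℤ) ≤ lk c := by
      zify at hl
      linarith
    have hx : (0 : ℤ) ≤ n * c - E := by zify at hQ'; linarith
    have h5 : (Q + 2 * E + 5 : ℤ) * (n * c - E) ≤ lk a * (lk c - 1) :=
      mul_le_mul ha3 (by linarith) hx (by positivity)
    push_cast
    have h6 : (n * c * Q : ℤ) < (Q + 2 * E + 5) * (n * c - E) := by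
      have h7 : (Q' : ℤ) ≤ 2 * (n * c - E) := by zify at hQ'; linarith
      have h8 : (Q : ℤ) ≤ Q' := by exact_mod_cast hQQ
      have h9 : (0 : ℤ) ≤ E := by positivity
      have h10 : (E : ℤ) * Q ≤ E * (2 * (n * c - E)) := mul_le_mul_of_nonneg_left (h8.trans h7) h9
      have h11 : (1 : ℤ) ≤ n * c - E := by zify at hQ' hn; linarith
      nlinarith
    nlinarith [e1]
  · have : n * (a * Q' + c) = n * a * Q' + n * c := by ring
    rw [this]
    have := Nat.mul_le_mul_right Q' ha1
    have h3 : (Q + K) * Q' = Q * Q' + K * Q' := by ring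
    have h4 : (K + 1) * Q' = K * Q' + Q' := by ring
    omega

theorem tpow_ne [Finite F] {m : ℕ} (hm : 1 ≤ m) : (tM F M) ^ (Nat.card F ^ m) - tM F M ≠ 0 := by
  letI := Fintype.ofFinite F
  have h : (X ^ (Nat.card F ^ m) - X : F[X]) ≠ 0 := by
    apply FiniteField.X_pow_card_pow_sub_X_ne_zero F (by omega) Finite.one_lt_card
  have h2 : aeval (tM F M) (X ^ (Nat.card F ^ m) - X : F[X]) ≠ 0 := by
    rw [tM_poly]
    intro h3
    exact h (algMapM_inj (M := M) (by rw [h3, map_zero]))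
  simpa using h2

theorem tpow_Lk [Finite F] {m : ℕ} : (tM F M) ^ (Nat.card F ^ m) - tM F M ∈ Lk F M R R' (Nat.card F ^ m) := by
  have hp : 1 ≤ Nat.card F ^ m := Nat.one_le_pow _ _ Nat.card_pos
  refine AddSubgroup.sub_mem _ ?_ (Lk_mono hp Lk_t)
  have := Lk_pow (Lk_t (F := F) (M := M) (R := R) (R' := R')) (Nat.card F ^ m)
  rwa [one_mul] at this

/-- `t` as an element of `R` -/
noncomputable def tR (F R : Type*) [Field F] [CommRing R] [Algebra F[X] R] : R := algebraMap F[X] R X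

theorem tR_map : algebraMap R M (tR F R) = tM F M := by
  rw [tR, ← IsScalarTower.algebraMap_apply, ← tM_poly, aeval_X]

theorem Xs_t {σ : M ≃ₐ[RatFunc F] M} {Q : ℕ} {v : HeightOneSpectrum R} (hv : v ∈ Xs R σ Q) :
    (tR F R) ^ Q - tR F R ∈ v.asIdeal := by
  apply hv
  rw [tR_map, sigma_t]

theorem stepanov_bound [Finite F] [FiniteDimensional (RatFunc F) M]
    (hconst : ∀ z : M, IsAlgebraic F z → ∃ c : F, algebraMap F M c = z)
    (h0 : Nat.card (Ls M (0 : Pl R R' → ℤ)) = Nat.card F) (w : ℕ)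
    (hW : Ss M (w • Tinf F M R R') = ⊤) :
    ∃ Cst : ℝ, 0 ≤ Cst ∧ ∀ (σ : M ≃ₐ[RatFunc F] M) (m : ℕ), 1 ≤ m →
      ∀ T : Finset (HeightOneSpectrum R), (∀ v ∈ T, v ∈ Xs R σ (Nat.card F ^ m)) →
      ((∑ v ∈ T, plDeg (Nat.card F) (.inl v : Pl R R') : ℕ) : ℝ) ≤
        (Nat.card F : ℝ) ^ m + Cst * √(Nat.card F) ^ m := by
  have hq : 1 < Nat.card F := Finite.one_lt_card
  obtain ⟨l, hl1, hl⟩ := card_Lk (F := F) (M := M) (R := R) (R' := R') h0 w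
  obtain ⟨lk, hlk⟩ := lk_dim h0 w hW l hl
  set q := Nat.card F with hqd
  set n := Module.finrank (RatFunc F) M with hn
  have hn1 : 1 ≤ n := Module.finrank_pos
  obtain ⟨E, hE⟩ : ∃ E, E = n * w := ⟨_, rfl⟩
  obtain ⟨K, hK⟩ : ∃ K, K = n + E + 2 * (1 + E) + 1 := ⟨_, rfl⟩
  have hsq : (1 : ℝ) ≤ √q := by rw [Real.one_le_sqrt]; exact_mod_cast hq.le
  have hsqq : √(q : ℝ) ^ 2 = q := Real.sq_sqrt (by positivity)
  have hW' : Ss M (w • Tinf F M R R' : Pl R R' →₀ ℤ) = ⊤ := hW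
  refine ⟨(K + 1) * √q + n * (2 * (n + E + 1)), by positivity, ?_⟩
  intro σ m hm T hT
  set Q := q ^ (m / 2) with hQ
  set Q' := q ^ (m - m / 2) with hQ'
  have hQQ' : Q * Q' = q ^ m := by rw [hQ, hQ', ← pow_add]; congr 1; omega
  have hle : Q ≤ Q' := Nat.pow_le_pow_right (by omega) (by omega)
  have hQR : (Q : ℝ) ≤ √q ^ m := by
    rw [hQ]; push_cast; nth_rewrite 1 [← hsqq]; rw [← pow_mul]; exact pow_le_pow_right₀ hsq (by omega)
  have hQ'R : (Q' : ℝ) ≤ √q * √q ^ m := by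
    rw [hQ', ← pow_succ']; push_cast; nth_rewrite 1 [← hsqq]; rw [← pow_mul]; exact pow_le_pow_right₀ hsq (by omega)
  have hpos : (0 : ℝ) ≤ √q ^ m := by positivity
  by_cases hth : 2 * (n + E + 1) ≤ Q'
  · obtain ⟨s1, s2, s3⟩ := stepanov_numeric (Q := Q) hn1 hE (show 1 ≤ l by omega) hle hth lk
      (fun k => (hlk k).2.1) (fun k => (hlk k).2.2) hK rfl rfl
    have := stepanov_core hconst h0 (w • Tinf F M R R') hW' l hl σ (a := (Q + K) / n) (c := (Q' - 1) / n) (k := m / 2)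
      (s := m - m / 2) (N := lk ((Q' - 1) / n)) s1 (hlk _).1 (by
        rw [(hlk _).1, (hlk _).1, ← pow_mul]; exact Nat.pow_lt_pow_right hq s2) T (by
        rw [show m / 2 + (m - m / 2) = m by omega]; exact hT)
    have h2 := this.trans s3
    have h3 : ((∑ v ∈ T, plDeg q (.inl v : Pl R R') : ℕ) : ℝ) ≤ ((Q * Q' + (K + 1) * Q' : ℕ) : ℝ) := by exact_mod_cast h2
    refine h3.trans ?_
    rw [hQQ']
    push_cast
    have h5 : ((K : ℝ) + 1) * Q' ≤ (K + 1) * (√q * √q ^ m) := mul_le_mul_of_nonneg_left hQ'R (by positivity)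
    have h6 : 0 ≤ (n * (2 * (n + E + 1)) : ℝ) * √q ^ m := by positivity
    nlinarith
  · push Not at hth
    have h1 := zero_count h0 (w • Tinf F M R R') hW' l hl (tpow_ne (M := M) hm) tpow_Lk T (fun _ => 1) (by
      intro v hv
      rw [← tR_map (R := R), ← map_pow, ← map_sub]
      refine vlog_le_of_mem ?_ ?_
      · intro h
        have := tpow_ne (F := F) (M := M) hm
        rw [← tR_map (R := R), ← map_pow, ← map_sub, h, map_zero] at this
        exact this rfl
      · rw [pow_one]; exact Xs_t (hT v hv))
    have h2 : ∑ v ∈ T, plDeg q (.inl v : Pl R R') ≤ n * q ^ m := by simpa using h1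
    have h3 : ((∑ v ∈ T, plDeg q (.inl v : Pl R R') : ℕ) : ℝ) ≤ n * (Q * Q') := by
      rw [← hQQ'] at h2; exact_mod_cast h2
    refine h3.trans ?_
    have h4 : (Q' : ℝ) ≤ 2 * (n + E + 1) := by exact_mod_cast hth.le
    have h5 : (Q * Q' : ℝ) ≤ √q ^ m * (2 * (n + E + 1)) := mul_le_mul hQR h4 (by positivity) hpos
    have h6 : (n * (Q * Q') : ℝ) ≤ n * (√q ^ m * (2 * (n + E + 1))) := mul_le_mul_of_nonneg_left h5 (by positivity)
    have h7 : (0 : ℝ) ≤ (K + 1) * √q * √q ^ m := by positivity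
    have h8 : (0 : ℝ) ≤ (q : ℝ) ^ m := by positivity
    nlinarith
end Curve8

set_option linter.all false
/-! ## Part 6a: inertia-type estimate -/
section Frob6
open Polynomial IsDedekindDomain WithZero

theorem frob_add {F R : Type*} [Field F] [Finite F] [CommRing R] [Algebra F R] (k : ℕ) (x y : R) :
    (x + y) ^ (Nat.card F ^ k) = x ^ (Nat.card F ^ k) + y ^ (Nat.card F ^ k) := by
  have := frob_sum (F := F) (Finset.univ : Finset (Fin 2)) k ![x, y]
  simpa [Fin.sum_univ_two] using this

theorem frob_sub {F R : Type*} [Field F] [Finite F] [CommRing R] [Algebra F R] (k : ℕ) (x y : R) :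
    (x - y) ^ (Nat.card F ^ k) = x ^ (Nat.card F ^ k) - y ^ (Nat.card F ^ k) := by
  have := frob_add (F := F) k (x - y) y
  rw [sub_add_cancel] at this
  rw [this]; ring

theorem frob_poly {F : Type*} [Field F] [Finite F] (k : ℕ) (c : F[X]) :
    (X ^ (Nat.card F ^ k) - X : F[X]) ∣ c ^ (Nat.card F ^ k) - c := by
  letI := Fintype.ofFinite F
  have e : (c ^ (Nat.card F ^ k)) = c.comp (X ^ (Nat.card F ^ k)) := by
    induction c using Polynomial.induction_on' with
    | add p r hp hr => rw [frob_add (F := F), hp, hr, add_comp]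
    | monomial i a =>
      rw [← C_mul_X_pow_eq_monomial, mul_pow, ← C_pow, Nat.card_eq_fintype_card, FiniteField.pow_card_pow]
      rw [mul_comp, C_comp, X_pow_comp, ← pow_mul, ← pow_mul, mul_comm i]
  rw [e]
  have := Polynomial.sub_dvd_eval_sub (X ^ (Nat.card F ^ k) : F[X]) X (c.map C)
  simpa [comp, eval_map, eval₂_C_X] using this

/-- choice of an element adapted to a place -/
theorem adapted_element {F R : Type*} [Field F] [Finite F] [CommRing R] [IsDedekindDomain R] [Algebra F R]
    (v : HeightOneSpectrum R) [Finite (R ⧸ v.asIdeal)] {J : Type*} [Fintype J] (τ : J → (R ≃+* R)) (k : ℕ) (hk : 1 ≤ k) :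
    ∃ b : R, ∀ j, (¬ (∀ x, x ^ (Nat.card F ^ k) - τ j x ∈ v.asIdeal) → b ^ (Nat.card F ^ k) - τ j b ∉ v.asIdeal) ∧
      b ^ (Nat.card F ^ k) - τ j b ∉ v.asIdeal ^ 2 := by
  classical
  have hq : 1 < Nat.card F := Finite.one_lt_card
  set Q := Nat.card F ^ k with hQ
  have hQ2 : 2 ≤ Q := by
    calc 2 ≤ Nat.card F := hq
      _ = Nat.card F ^ 1 := (pow_one _).symm
      _ ≤ _ := Nat.pow_le_pow_right (by omega) hk
  have hmax := v.isMaximal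
  have hprime := v.isPrime
  letI : Field (R ⧸ v.asIdeal) := Ideal.Quotient.field v.asIdeal
  obtain ⟨u, hu⟩ := IsCyclic.exists_generator (α := (R ⧸ v.asIdeal)ˣ)
  obtain ⟨g, hg⟩ := Ideal.Quotient.mk_surjective (I := v.asIdeal) u.1
  have hgv : g ∉ v.asIdeal := by
    intro h
    rw [← Ideal.Quotient.eq_zero_iff_mem, hg] at h
    exact u.ne_zero h
  obtain ⟨π, hπ⟩ := v.intValuation_exists_uniformizer
  have hπ1 : π ∈ v.asIdeal := by
    rw [← pow_one v.asIdeal, ← v.intValuation_le_pow_iff_mem, hπ]; simp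
  have hπ2 : π ∉ v.asIdeal ^ 2 := by
    rw [← v.intValuation_le_pow_iff_mem, hπ, not_le]; exact exp_lt_exp.mpr (by norm_num)
  let bad : Finset J := Finset.univ.filter fun j => v.asIdeal.comap (τ j) ≠ v.asIdeal
  have hcm : ∀ j, (v.asIdeal.comap (τ j)).IsMaximal := fun j => Ideal.comap_isMaximal_of_equiv (τ j)
  have hcop : IsCoprime (v.asIdeal ^ 2) (∏ j ∈ bad, v.asIdeal.comap (τ j)) := by
    refine IsCoprime.prod_right fun j hj => ?_
    refine IsCoprime.pow_left (Ideal.isCoprime_of_isMaximal ?_)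
    exact (Finset.mem_filter.mp hj).2.symm
  obtain ⟨i, hi, z, hz, hiz⟩ := Ideal.isCoprime_iff_exists.mp hcop
  have hle2 : v.asIdeal ^ 2 ≤ v.asIdeal := Ideal.pow_le_self (by norm_num)
  have hzbad : ∀ j, v.asIdeal.comap (τ j) ≠ v.asIdeal → z ∈ v.asIdeal.comap (τ j) := fun j hj =>
    (Ideal.le_of_dvd (Finset.dvd_prod_of_mem (fun j => v.asIdeal.comap (τ j)) (a := j) (s := bad)
      (Finset.mem_filter.mpr ⟨Finset.mem_univ j, hj⟩))) hz
  set q := Nat.card F with hqd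
  set b := z * (g ^ q + π) with hb
  have hb2 : b - (g ^ q + π) ∈ v.asIdeal ^ 2 := by
    have : b - (g ^ q + π) = - (i * (g ^ q + π)) := by rw [hb, eq_sub_of_add_eq' hiz]; ring
    rw [this]; exact neg_mem (Ideal.mul_mem_right _ _ hi)
  have hb1 : b - g ^ q ∈ v.asIdeal := by
    have : b - g ^ q = (b - (g ^ q + π)) + π := by ring
    rw [this]; exact add_mem (hle2 hb2) hπ1
  have hfr1 : ∀ x y : R, (x - y) ^ q = x ^ q - y ^ q := by
    intro x y; have := frob_sub (F := F) 1 x y; simpa using this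
  have hX2 : ∀ j, (∀ x, x ^ Q - τ j x ∈ v.asIdeal) → b ^ Q - τ j b ∉ v.asIdeal ^ 2 := by
    intro j hj hmem
    have hle : v.asIdeal ≤ v.asIdeal.comap (τ j) := by
      intro x hx
      rw [Ideal.mem_comap]
      have h1 := sub_mem (Ideal.pow_mem_of_mem _ hx Q (by omega)) (hj x)
      simpa using h1
    have heq : v.asIdeal.comap (τ j) = v.asIdeal := (hmax.eq_of_le (hcm j).ne_top hle).symm
    have heq2 : (v.asIdeal ^ 2).comap (τ j) = v.asIdeal ^ 2 := by
      rw [← Ideal.map_symm, Ideal.map_pow, Ideal.map_symm, heq]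
    have hpw : ∀ {y : R} {N : ℕ}, 2 ≤ N → y ∈ v.asIdeal → y ^ N ∈ v.asIdeal ^ 2 := fun hN hy =>
      Ideal.pow_le_pow_right hN (Ideal.pow_mem_pow hy _)
    apply hπ2
    rw [← heq2, Ideal.mem_comap]
    have h1 : (b - (g ^ q + π)) ^ Q ∈ v.asIdeal ^ 2 := Ideal.pow_mem_of_mem _ hb2 _ (by omega)
    have h2 : τ j (b - (g ^ q + π)) ∈ v.asIdeal ^ 2 := by
      rw [← heq2, Ideal.mem_comap] at hb2; exact hb2
    have h3 : (g ^ Q - τ j g) ^ q ∈ v.asIdeal ^ 2 := hpw hq (hj g)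
    have h4 : π ^ Q ∈ v.asIdeal ^ 2 := hpw hQ2 hπ1
    rw [frob_sub (F := F), frob_add (F := F)] at h1
    rw [hfr1] at h3
    rw [map_sub, map_add, map_pow] at h2
    have e : τ j π = (b ^ Q - ((g ^ q) ^ Q + π ^ Q)) - (b ^ Q - τ j b) - (τ j b - (τ j g ^ q + τ j π)) +
        ((g ^ Q) ^ q - τ j g ^ q) + π ^ Q := by
      rw [← pow_mul, ← pow_mul, mul_comm q Q]; ring
    change (τ j) π ∈ _
    rw [e]
    exact add_mem (add_mem (sub_mem (sub_mem h1 hmem) h2) h3) h4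
  have hX1 : ∀ j, ¬ (∀ x, x ^ Q - τ j x ∈ v.asIdeal) → b ^ Q - τ j b ∉ v.asIdeal := by
    intro j hj hmem
    by_cases heq : v.asIdeal.comap (τ j) = v.asIdeal
    · apply hj
      have hτ : ∀ {y}, y ∈ v.asIdeal → τ j y ∈ v.asIdeal := fun {y} hy => by
        rw [← heq, Ideal.mem_comap] at hy; exact hy
      have h1 : (b - g ^ q) ^ Q ∈ v.asIdeal := Ideal.pow_mem_of_mem _ hb1 _ (by omega)
      have h2 := hτ hb1
      rw [frob_sub (F := F)] at h1
      rw [map_sub, map_pow] at h2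
      have h3 : (g ^ Q - τ j g) ^ q ∈ v.asIdeal := by
        rw [hfr1]
        have e : (g ^ Q) ^ q - τ j g ^ q = (b ^ Q - τ j b) - (b ^ Q - (g ^ q) ^ Q) + (τ j b - τ j g ^ q) := by
          rw [← pow_mul, ← pow_mul, mul_comm q Q]; ring
        rw [e]
        exact add_mem (sub_mem hmem h1) h2
      have h4 : g ^ Q - τ j g ∈ v.asIdeal := hprime.mem_of_pow_mem _ h3
      intro x
      by_cases hx : x ∈ v.asIdeal
      · exact sub_mem (Ideal.pow_mem_of_mem _ hx _ (by omega)) (hτ hx)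
      · have hx0 : (Ideal.Quotient.mk v.asIdeal x) ≠ 0 := by rwa [Ne, Ideal.Quotient.eq_zero_iff_mem]
        obtain ⟨N, hN⟩ := (Submonoid.mem_powers_iff _ _).mp (mem_powers_iff_mem_zpowers.mpr (hu (Units.mk0 _ hx0)))
        have hN' : Ideal.Quotient.mk v.asIdeal (g ^ N) = Ideal.Quotient.mk v.asIdeal x := by
          rw [map_pow, hg, ← Units.val_pow_eq_pow_val, hN]; rfl
        have hN2 : g ^ N - x ∈ v.asIdeal := Ideal.Quotient.eq.mp hN'
        have h5 := hτ hN2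
        rw [map_sub, map_pow] at h5
        have h6 : g ^ Q ^ 1 - τ j g ∣ (g ^ Q) ^ N - (τ j g) ^ N := by rw [pow_one]; exact sub_dvd_pow_sub_pow _ _ _
        rw [pow_one] at h6
        have h7 := v.asIdeal.mem_of_dvd h6 h4
        have h8 : (g ^ N) ^ Q - x ^ Q ∈ v.asIdeal := v.asIdeal.mem_of_dvd (sub_dvd_pow_sub_pow _ _ _) hN2
        have e : x ^ Q - τ j x = ((g ^ Q) ^ N - (τ j g) ^ N) - ((g ^ N) ^ Q - x ^ Q) + (τ j g ^ N - τ j x) := by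
          rw [← pow_mul, ← pow_mul, mul_comm N Q]; ring
        rw [e]
        exact add_mem (sub_mem h7 h8) h5
    · have h1 : τ j b ∈ v.asIdeal := by
        rw [hb, map_mul]
        exact Ideal.mul_mem_right _ _ (Ideal.mem_comap.mp (hzbad j heq))
      have h2 : b ^ Q ∈ v.asIdeal := by
        have := add_mem hmem h1; rwa [sub_add_cancel] at this
      have h3 := hprime.mem_of_pow_mem _ h2
      have h4 := sub_mem h3 hb1
      rw [sub_sub_cancel] at h4
      exact hgv (hprime.mem_of_pow_mem _ h4)
  refine ⟨b, fun j => ⟨hX1 j, ?_⟩⟩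
  by_cases hj : ∀ x, x ^ Q - τ j x ∈ v.asIdeal
  · exact hX2 j hj
  · exact fun h => hX1 j hj (hle2 h)
end Frob6

set_option linter.all false
/-! ## Part 6b: multiplicity estimate -/
section Curve9
open Polynomial IsDedekindDomain WithZero

variable {F : Type*} [Field F] {M : Type*} [Field M] [Algebra (RatFunc F) M]
  [Algebra F M] [IsScalarTower F (RatFunc F) M]
  [Algebra F[X] M] [IsScalarTower F[X] (RatFunc F) M]
  {R R' : Type*} [CommRing R] [IsDedekindDomain R] [Algebra R M] [IsFractionRing R M]
  [Algebra F[X] R] [Module.Finite F[X] R] [IsScalarTower F[X] R M] 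
  [Algebra F R] [IsScalarTower F R M]
  [CommRing R'] [IsDedekindDomain R'] [Algebra R' M] [IsFractionRing R' M]
  [Algebra (Oinf F) R'] [Module.Finite (Oinf F) R'] [IsScalarTower (Oinf F) R' M] 
  [Algebra F R'] [IsScalarTower F R' M]

theorem isIntClos : IsIntegralClosure R F[X] M :=
  ⟨IsFractionRing.injective R M, fun {x} => by
    rw [← mem_range_iff_int (F := F) (R := R)]; exact RingHom.mem_range⟩

theorem exists_tau [FiniteDimensional (RatFunc F) M] : ∃ τ : (M ≃ₐ[RatFunc F] M) → (R ≃+* R), ∀ σ x,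
    algebraMap R M (τ σ x) = σ (algebraMap R M x) := by
  haveI : IsIntegralClosure R F[X] M := isIntClos
  exact ⟨fun σ => (galRestrict F[X] (RatFunc F) M R σ).toRingEquiv, fun σ x =>
    algebraMap_galRestrict_apply F[X] σ x⟩

theorem galois_prod [Finite F] [FiniteDimensional (RatFunc F) M] [IsGalois (RatFunc F) M]
    (τ : (M ≃ₐ[RatFunc F] M) → (R ≃+* R)) (hτ : ∀ σ x, algebraMap R M (τ σ x) = σ (algebraMap R M x))
    (k : ℕ) (b : R) :
    (tR F R) ^ (Nat.card F ^ k) - tR F R ∣ ∏ σ, (b ^ (Nat.card F ^ k) - τ σ b) := by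
  set Q := Nat.card F ^ k with hQ
  have hinjR := IsFractionRing.injective R M
  have h1 : ∃ p : F[X][X], p.map (algebraMap F[X] M) = MulSemiringAction.charpoly (M ≃ₐ[RatFunc F] M) (algebraMap R M b) := by
    have : MulSemiringAction.charpoly (M ≃ₐ[RatFunc F] M) (algebraMap R M b) ∈ lifts (algebraMap F[X] M) := by
      rw [Polynomial.lifts_iff_coeff_lifts]
      intro i
      set c := (MulSemiringAction.charpoly (M ≃ₐ[RatFunc F] M) (algebraMap R M b)).coeff i with hc
      have hf : c ∈ Set.range (algebraMap (RatFunc F) M) := by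
        rw [IsGalois.mem_range_algebraMap_iff_fixed]
        intro σ
        exact MulSemiringAction.smul_coeff_charpoly _ _ σ
      obtain ⟨d, hd⟩ := hf
      have hcR : c ∈ (algebraMap R M).range := by
        have : MulSemiringAction.charpoly (M ≃ₐ[RatFunc F] M) (algebraMap R M b) =
            (∏ σ, (X - C (τ σ b))).map (algebraMap R M) := by
          rw [MulSemiringAction.charpoly_eq, Polynomial.map_prod]
          refine Finset.prod_congr rfl fun σ _ => ?_
          simp [hτ, AlgEquiv.smul_def]
        rw [hc, this, coeff_map]
        exact ⟨_, rfl⟩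
      rw [mem_range_iff_int (F := F), ← hd] at hcR
      have hdi : IsIntegral F[X] d := (isIntegral_algHom_iff (IsScalarTower.toAlgHom F[X] (RatFunc F) M)
        (algebraMap (RatFunc F) M).injective).mp hcR
      obtain ⟨e, he⟩ := IsIntegrallyClosed.isIntegral_iff.mp hdi
      exact ⟨e, by rw [IsScalarTower.algebraMap_apply F[X] (RatFunc F) M, he, hd]⟩
    exact (Polynomial.mem_lifts _).mp this
  obtain ⟨p, hp⟩ := h1
  have hpR : p.map (algebraMap F[X] R) = ∏ σ, (X - C (τ σ b)) := by
    apply Polynomial.map_injective _ hinjR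
    rw [Polynomial.map_map, ← IsScalarTower.algebraMap_eq, hp, MulSemiringAction.charpoly_eq, Polynomial.map_prod]
    refine Finset.prod_congr rfl fun σ _ => ?_
    simp [hτ, AlgEquiv.smul_def]
  have e1 : eval b (p.map (algebraMap F[X] R)) = 0 := by
    rw [hpR, eval_prod]
    refine Finset.prod_eq_zero (Finset.mem_univ 1) ?_
    have : τ 1 b = b := hinjR (by rw [hτ]; rfl)
    simp [this]
  have e2 : eval (b ^ Q) (p.map (algebraMap F[X] R)) = ∏ σ, (b ^ Q - τ σ b) := by
    rw [hpR, eval_prod]; simp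
  rw [← e2, ← sub_zero (eval (b ^ Q) _), ← zero_pow (M₀ := R) (n := Q) (pow_pos Nat.card_pos _).ne', ← e1,
    eval_eq_sum_range, eval_eq_sum_range, frob_sum (F := F), ← Finset.sum_sub_distrib]
  refine Finset.dvd_sum fun i _ => ?_
  rw [mul_pow, ← pow_mul, ← pow_mul, mul_comm i Q, ← sub_mul]
  refine Dvd.dvd.mul_right ?_ _
  rw [coeff_map, ← map_pow, ← map_sub, tR, ← map_pow, ← map_sub]
  refine map_dvd _ ?_
  rw [← dvd_neg, neg_sub]
  exact frob_poly k _

theorem vlog_ge_of_notMem {v : HeightOneSpectrum R} {y : R} {e : ℕ} (h : y ∉ v.asIdeal ^ (e + 1)) :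
    -(e : ℤ) ≤ vlog R (algebraMap R M y) v := by
  by_contra hcon
  push Not at hcon
  have hy : algebraMap R M y ≠ 0 := by
    intro h0
    rw [map_eq_zero_iff _ (IsFractionRing.injective R M)] at h0
    exact h (by rw [h0]; exact zero_mem _)
  apply h
  rw [← v.intValuation_le_pow_iff_mem, ← v.valuation_of_algebraMap (K := M), ← exp_vlog hy]
  exact exp_le_exp.mpr (by push_cast; omega)

theorem vlog_prod {J : Type*} (s : Finset J) (y : J → M) (hy : ∀ j ∈ s, y j ≠ 0) (v : HeightOneSpectrum R) :
    vlog R (∏ j ∈ s, y j) v = ∑ j ∈ s, vlog R (y j) v := by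
  classical
  induction s using Finset.induction_on with
  | empty => simp [vlog]
  | insert j s hj ih =>
    have h1 : ∀ i ∈ s, y i ≠ 0 := fun i hi => hy i (Finset.mem_insert_of_mem hi)
    rw [Finset.prod_insert hj, Finset.sum_insert hj, vlog_mul (hy j (Finset.mem_insert_self _ _))
      (Finset.prod_ne_zero_iff.mpr h1), Pi.add_apply, ih h1]

open scoped Classical in
theorem mult_le [Finite F] [FiniteDimensional (RatFunc F) M] [IsGalois (RatFunc F) M] {m : ℕ} (hm : 1 ≤ m)
    (v : HeightOneSpectrum R) :
    - vlog R ((tM F M) ^ (Nat.card F ^ m) - tM F M) v ≤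
      ((Finset.univ.filter fun σ : M ≃ₐ[RatFunc F] M => v ∈ Xs R σ (Nat.card F ^ m)).card : ℤ) := by
  obtain ⟨τ, hτ⟩ := exists_tau (F := F) (M := M) (R := R)
  have := resF_finite (F := F) v
  have hXs : ∀ σ, v ∈ Xs R σ (Nat.card F ^ m) ↔ ∀ x, x ^ (Nat.card F ^ m) - τ σ x ∈ v.asIdeal := by
    intro σ
    constructor
    · intro h x; exact h x _ (hτ σ x)
    · intro h x x' hx'
      rw [IsFractionRing.injective R M (hx'.trans (hτ σ x).symm)]; exact h x
  obtain ⟨b, hb⟩ := adapted_element (F := F) v τ m hm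
  obtain ⟨z, hz⟩ := galois_prod (F := F) τ hτ m b
  set Q := Nat.card F ^ m
  have hne : ∀ σ, algebraMap R M (b ^ Q - τ σ b) ≠ 0 := by
    intro σ h
    rw [map_eq_zero_iff _ (IsFractionRing.injective R M)] at h
    exact (hb σ).2 (by rw [h]; exact zero_mem _)
  have hzM := congrArg (algebraMap R M) hz
  rw [map_prod, map_mul, map_sub, map_pow, tR_map] at hzM
  have hpne : ∏ σ, algebraMap R M (b ^ Q - τ σ b) ≠ 0 := Finset.prod_ne_zero_iff.mpr fun σ _ => hne σ
  have hz0 : algebraMap R M z ≠ 0 := by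
    intro h; rw [hzM, h, mul_zero] at hpne; exact hpne rfl
  have hv := congrArg (fun x => vlog R x v) hzM
  rw [vlog_prod _ _ (fun σ _ => hne σ), vlog_mul (tpow_ne hm) hz0, Pi.add_apply] at hv
  have hzv : vlog R (algebraMap R M z) v ≤ 0 := by
    have := vlog_le_of_mem (M := M) (v := v) (y := z) (e := 0) (by rintro rfl; simp at hz0) (by simp)
    simpa using this
  have hsum : ∑ σ : M ≃ₐ[RatFunc F] M, (if v ∈ Xs R σ Q then (-1 : ℤ) else 0) ≤
      ∑ σ, vlog R (algebraMap R M (b ^ Q - τ σ b)) v := by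
    refine Finset.sum_le_sum fun σ _ => ?_
    split_ifs with h
    · have := vlog_ge_of_notMem (M := M) (v := v) (y := b ^ Q - τ σ b) (e := 1) (hb σ).2
      simpa using this
    · rw [hXs] at h
      have := vlog_ge_of_notMem (M := M) (v := v) (y := b ^ Q - τ σ b) (e := 0) (by rw [zero_add, pow_one]; exact (hb σ).1 h)
      simpa using this
  rw [hv] at hsum
  rw [← Finset.sum_filter] at hsum
  simp only [Finset.sum_neg_distrib, Finset.sum_const, nsmul_eq_mul, mul_one] at hsum
  linarith
end Curve9

set_option linter.all false
/-! ## Part 6c: rough point count bounds -/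
section Curve10
open Polynomial IsDedekindDomain WithZero

variable {F : Type*} [Field F] {M : Type*} [Field M] [Algebra (RatFunc F) M]
  [Algebra F M] [IsScalarTower F (RatFunc F) M]
  [Algebra F[X] M] [IsScalarTower F[X] (RatFunc F) M]
  {R R' : Type*} [CommRing R] [IsDedekindDomain R] [Algebra R M] [IsFractionRing R M]
  [Algebra F[X] R] [Module.Finite F[X] R] [IsScalarTower F[X] R M] 
  [Algebra F R] [IsScalarTower F R M]
  [CommRing R'] [IsDedekindDomain R'] [Algebra R' M] [IsFractionRing R' M]
  [Algebra (Oinf F) R'] [Module.Finite (Oinf F) R'] [IsScalarTower (Oinf F) R' M] 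
  [Algebra F R'] [IsScalarTower F R' M]

theorem zero_count_ge [Finite F] [FiniteDimensional (RatFunc F) M]
    (h0 : Nat.card (Ls M (0 : Pl R R' → ℤ)) = Nat.card F) (W : Pl R R' →₀ ℤ)
    (hW : Ss M W = ⊤) (l : ℕ) (hl : Nat.card (Ls M W) = Nat.card F ^ l)
    {k : ℕ} {x : M} (hx : x ≠ 0) (hxk : ∀ v : HeightOneSpectrum R', (k : ℤ) * vlog R' (tM F M) v ≤ vlog R' x v)
    (T : Finset (HeightOneSpectrum R))
    (e : HeightOneSpectrum R → ℕ) (he : ∀ v ∈ T, -(e v : ℤ) ≤ vlog R x v) (he' : ∀ v ∉ T, 0 ≤ vlog R x v) :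
    Module.finrank (RatFunc F) M * k ≤ ∑ v ∈ T, e v * plDeg (Nat.card F) (.inl v : Pl R R') := by
  classical
  have h1 := dvDeg_pdiv (curve_hpow F) Finite.one_lt_card h0 W hW l hl hx
  have h2 : dvDeg (Nat.card F) (k • Tinf F M R R' - ∑ v ∈ T, Finsupp.single (.inl v : Pl R R') (e v : ℤ)) ≤ dvDeg (Nat.card F) (pdiv R R' x) := by
    refine dvDeg_mono _ fun P => ?_
    simp only [Finsupp.coe_sub, Pi.sub_apply, Finsupp.coe_finset_sum, Finset.sum_apply]
    rcases P with v | v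
    · simp only [Finsupp.single_apply, Sum.inl.injEq, Finset.sum_ite_eq']
      split_ifs with hv
      · rw [Finsupp.smul_apply, Tinf_inl, smul_zero, pdiv_inl]
        have := he v hv; omega
      · rw [Finsupp.smul_apply, Tinf_inl, smul_zero, pdiv_inl]
        have := he' v hv; omega
    · have := hxk v
      simpa [Finsupp.single_apply, Tinf_inr, pdiv_inr] using this
  rw [h1, dvDeg_sub, dvDeg_nsmul, deg_Tinf, dvDeg_sum] at h2
  simp only [dvDeg_single] at h2
  rw [mul_comm]
  zify
  linarith

theorem tinf_pos (v : HeightOneSpectrum R') : 1 ≤ vlog R' (tM F M) v := by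
  have h1 := unif_mem (F := F) v
  have h2 : vlog R' (algebraMap R' M (algebraMap (Oinf F) R' (unif F))) v ≤ -((1 : ℕ) : ℤ) := by
    refine vlog_le_of_mem ?_ (by rwa [pow_one])
    intro h
    have h3 := tM_inv (F := F) (M := M) (R' := R')
    rw [h, map_zero] at h3
    exact inv_ne_zero (tM_ne) h3
  rw [← tM_inv, vlog_inv] at h2
  simp at h2
  omega

theorem tpow_inf [Finite F] {m : ℕ} (hm : 1 ≤ m) (v : HeightOneSpectrum R') :
    ((Nat.card F ^ m : ℕ) : ℤ) * vlog R' (tM F M) v ≤ vlog R' ((tM F M) ^ (Nat.card F ^ m) - tM F M) v := by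
  set Q := Nat.card F ^ m with hQ
  have hQ2 : 2 ≤ Q := by
    calc 2 ≤ Nat.card F := Finite.one_lt_card
      _ = Nat.card F ^ 1 := (pow_one _).symm
      _ ≤ _ := Nat.pow_le_pow_right Nat.card_pos hm
  set s : R' := algebraMap (Oinf F) R' (unif F) with hs
  have hsM : algebraMap R' M s = (tM F M)⁻¹ := tM_inv.symm
  have ht : tM F M ≠ 0 := tM_ne
  have e : (tM F M) ^ Q - tM F M = (tM F M) ^ Q * algebraMap R' M (1 - s ^ (Q - 1)) := by
    rw [map_sub, map_one, map_pow, hsM, mul_sub, mul_one, inv_pow]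
    congr 1
    obtain ⟨k, hk⟩ : ∃ k, Q = k + 1 := ⟨Q - 1, by omega⟩
    rw [hk, Nat.add_sub_cancel, pow_succ]
    field_simp
  have hn : (1 - s ^ (Q - 1)) ∉ v.asIdeal ^ (0 + 1) := by
    rw [zero_add, pow_one]
    intro h
    have h2 : s ^ (Q - 1) ∈ v.asIdeal := Ideal.pow_mem_of_mem _ (unif_mem v) _ (by omega)
    have := add_mem h h2
    rw [sub_add_cancel] at this
    exact v.isPrime.ne_top ((Ideal.eq_top_iff_one _).mpr this)
  have h3 := vlog_ge_of_notMem (M := M) hn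
  have hne : algebraMap R' M (1 - s ^ (Q - 1)) ≠ 0 := by
    intro h
    have := tpow_ne (F := F) (M := M) hm
    rw [← hQ, e, h, mul_zero] at this
    exact this rfl
  rw [e, vlog_mul (pow_ne_zero _ ht) hne, Pi.add_apply, vlog_pow]
  simp at h3 ⊢
  linarith

theorem mem_Xs_one [Finite F] {m : ℕ} (v : HeightOneSpectrum R) :
    v ∈ Xs R (1 : M ≃ₐ[RatFunc F] M) (Nat.card F ^ m) ↔ plDeg (Nat.card F) (.inl v : Pl R R') ∣ m := by
  have hq : 1 < Nat.card F := Finite.one_lt_card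
  have hc : Nat.card (R ⧸ v.asIdeal) = _ := resCard_eq (curve_hpow F) hq (Sum.inl v : Pl R R')
  have := resF_finite (F := F) v
  have hmax := v.isMaximal
  letI : Field (R ⧸ v.asIdeal) := Ideal.Quotient.field v.asIdeal
  letI := Fintype.ofFinite (R ⧸ v.asIdeal)
  set d := plDeg (Nat.card F) (.inl v : Pl R R') with hd
  have h1 : v ∈ Xs R (1 : M ≃ₐ[RatFunc F] M) (Nat.card F ^ m) ↔ ∀ x : R ⧸ v.asIdeal, x ^ (Nat.card F ^ m) = x := by
    constructor
    · intro h x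
      obtain ⟨x, rfl⟩ := Ideal.Quotient.mk_surjective x
      rw [← map_pow, Ideal.Quotient.eq]
      exact h x x rfl
    · intro h b b' hb
      have : b' = b := IsFractionRing.injective R M (by rw [hb]; rfl)
      rw [this, ← Ideal.Quotient.eq, map_pow]; exact h _
  rw [h1]
  constructor
  · intro h
    obtain ⟨u, hu⟩ := IsCyclic.exists_generator (α := (R ⧸ v.asIdeal)ˣ)
    have ho : orderOf u = Nat.card F ^ d - 1 := by
      rw [orderOf_eq_card_of_forall_mem_zpowers hu, Nat.card_units, hc]
    have h2 : u ^ (Nat.card F ^ m - 1) = 1 := by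
      have h3 : u ^ (Nat.card F ^ m) = u := by
        ext; rw [Units.val_pow_eq_pow_val]; exact h _
      have h4 : u ^ (Nat.card F ^ m - 1) * u = 1 * u := by
        rw [← pow_succ, Nat.sub_add_cancel (Nat.one_le_pow _ _ Nat.card_pos), h3, one_mul]
      exact mul_right_cancel h4
    have h3 := orderOf_dvd_of_pow_eq_one h2
    rw [ho] at h3
    have h4 := Nat.pow_sub_one_gcd_pow_sub_one (Nat.card F) d m
    rw [Nat.gcd_eq_left h3] at h4
    have h5 : Nat.card F ^ d = Nat.card F ^ (d.gcd m) := by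
      have := Nat.one_le_pow d _ (Nat.card_pos (α := F))
      have := Nat.one_le_pow (d.gcd m) _ (Nat.card_pos (α := F))
      omega
    have h6 := Nat.pow_right_injective hq h5
    rw [h6]; exact Nat.gcd_dvd_right _ _
  · rintro ⟨e, rfl⟩ x
    rw [pow_mul, ← hc, Nat.card_eq_fintype_card, FiniteField.pow_card_pow]

open scoped Classical in
theorem point_bound [Finite F] [FiniteDimensional (RatFunc F) M] [IsGalois (RatFunc F) M]
    (hconst : ∀ z : M, IsAlgebraic F z → ∃ c : F, algebraMap F M c = z)
    (h0 : Nat.card (Ls M (0 : Pl R R' → ℤ)) = Nat.card F) (w : ℕ)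
    (hW : Ss M (w • Tinf F M R R') = ⊤) (S : ℕ → Finset (Pl R R'))
    (hS : ∀ d P, P ∈ S d ↔ plDeg (Nat.card F) P ≤ d) :
    ∃ C : ℝ, ∀ m, 1 ≤ m → |(ptCount (plDeg (Nat.card F)) S m : ℝ) - (Nat.card F : ℝ) ^ m| ≤ C * √(Nat.card F) ^ m := by
  have hq : 1 < Nat.card F := Finite.one_lt_card
  obtain ⟨Cst, hCst, hst⟩ := stepanov_bound hconst h0 w hW
  obtain ⟨l, hl1, hl⟩ := card_Lk (F := F) (M := M) (R := R) (R' := R') h0 w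
  have hW' : Ss M (w • Tinf F M R R' : Pl R R' →₀ ℤ) = ⊤ := hW
  set q := Nat.card F with hqd
  set n := Module.finrank (RatFunc F) M with hn
  have hn1 : 1 ≤ n := Module.finrank_pos
  have hsq : (1 : ℝ) ≤ √q := by rw [Real.one_le_sqrt]; exact_mod_cast hq.le
  refine ⟨n * Cst + n, fun m hm => ?_⟩
  have hsm : (1 : ℝ) ≤ √q ^ m := one_le_pow₀ hsq
  set A := (S m).filter (fun P => plDeg q P ∣ m) with hA
  have hN : ptCount (plDeg q) S m = ∑ v ∈ A.toLeft, plDeg q (.inl v : Pl R R') + ∑ v ∈ A.toRight, plDeg q (.inr v : Pl R R') := by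
    rw [ptCount, ← hA]
    conv_lhs => rw [← Finset.toLeft_disjSum_toRight (u := A)]
    rw [Finset.sum_disjSum]
  have hright : ∑ v ∈ A.toRight, plDeg q (.inr v : Pl R R') ≤ n := by
    have h2 : dvDeg q (∑ v ∈ A.toRight, Finsupp.single (.inr v : Pl R R') (1 : ℤ)) ≤ dvDeg q (Tinf F M R R') := by
      refine dvDeg_mono _ fun P => ?_
      simp only [Finsupp.coe_finset_sum, Finset.sum_apply]
      rcases P with v | v
      · simp [Finsupp.single_apply, Tinf_inl]
      · simp only [Finsupp.single_apply, Sum.inr.injEq, Finset.sum_ite_eq', Tinf_inr]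
        have := tinf_pos (F := F) (M := M) v
        split_ifs <;> omega
    rw [deg_Tinf, dvDeg_sum] at h2
    simp only [dvDeg_single, one_mul] at h2
    exact_mod_cast h2
  have hleft := hst 1 m hm A.toLeft (by
    intro v hv
    rw [Finset.mem_toLeft, hA, Finset.mem_filter] at hv
    exact (mem_Xs_one (R' := R') v).mpr hv.2)
  -- lower bound
  have hTne : (tR F R) ^ (q ^ m) - tR F R ≠ 0 := by
    intro h
    have := tpow_ne (F := F) (M := M) hm
    rw [← tR_map (R := R), ← map_pow, ← map_sub, ← hqd, h, map_zero] at this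
    exact this rfl
  set V := (finite_containing hTne).toFinset with hV
  have hVm : ∀ v, v ∈ V ↔ (tR F R) ^ (q ^ m) - tR F R ∈ v.asIdeal := fun v => by
    rw [hV, Set.Finite.mem_toFinset]; rfl
  have hlow := zero_count_ge h0 (w • Tinf F M R R') hW' l hl (tpow_ne (M := M) hm) (tpow_inf hm) V
    (fun v => (Finset.univ.filter fun σ : M ≃ₐ[RatFunc F] M => v ∈ Xs R σ (Nat.card F ^ m)).card)
    (fun v _ => by have := mult_le (F := F) (M := M) hm v; linarith)
    (fun v hv => by
      rw [← tR_map (R := R), ← map_pow, ← map_sub]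
      have := vlog_ge_of_notMem (M := M) (v := v) (y := (tR F R) ^ (q ^ m) - tR F R) (e := 0) (by
        rw [zero_add, pow_one]; exact fun h => hv ((hVm v).mpr h))
      simpa using this)
  have hswap : ∑ v ∈ V, (Finset.univ.filter fun σ : M ≃ₐ[RatFunc F] M => v ∈ Xs R σ (Nat.card F ^ m)).card *
      plDeg (Nat.card F) (.inl v : Pl R R') = ∑ σ : M ≃ₐ[RatFunc F] M, ∑ v ∈ V.filter (fun v => v ∈ Xs R σ (Nat.card F ^ m)),
        plDeg (Nat.card F) (.inl v : Pl R R') := by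
    simp_rw [Finset.card_filter, Finset.sum_mul, Finset.sum_filter]
    rw [Finset.sum_comm]
    refine Finset.sum_congr rfl fun σ _ => Finset.sum_congr rfl fun v _ => ?_
    split_ifs <;> simp
  rw [hswap, ← Finset.add_sum_erase _ _ (Finset.mem_univ 1)] at hlow
  have hrest : ((∑ σ ∈ Finset.univ.erase (1 : M ≃ₐ[RatFunc F] M), ∑ v ∈ V.filter (fun v => v ∈ Xs R σ (Nat.card F ^ m)),
        plDeg (Nat.card F) (.inl v : Pl R R') : ℕ) : ℝ) ≤ (n - 1) * ((q : ℝ) ^ m + Cst * √q ^ m) := by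
    rw [Nat.cast_sum]
    refine (Finset.sum_le_card_nsmul _ _ _ fun σ _ => hst σ m hm _ (fun v hv => (Finset.mem_filter.mp hv).2)).trans ?_
    rw [Finset.card_erase_of_mem (Finset.mem_univ _), Finset.card_univ, ← Nat.card_eq_fintype_card,
      IsGalois.card_aut_eq_finrank, nsmul_eq_mul, Nat.cast_sub hn1, Nat.cast_one]
  have h1le : ∑ v ∈ V.filter (fun v => v ∈ Xs R (1 : M ≃ₐ[RatFunc F] M) (Nat.card F ^ m)), plDeg q (.inl v : Pl R R') ≤
      ∑ v ∈ A.toLeft, plDeg q (.inl v : Pl R R') := by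
    refine Finset.sum_le_sum_of_subset fun v hv => ?_
    have h2 := (mem_Xs_one (R' := R') v).mp (Finset.mem_filter.mp hv).2
    rw [Finset.mem_toLeft, hA, Finset.mem_filter, hS]
    exact ⟨Nat.le_of_dvd (by omega) h2, h2⟩
  have hlowR : (n : ℝ) * (q : ℝ) ^ m ≤ ((∑ v ∈ A.toLeft, plDeg q (.inl v : Pl R R') : ℕ) : ℝ) + (n - 1) * ((q : ℝ) ^ m + Cst * √q ^ m) := by
    have h2 := hlow.trans (Nat.add_le_add_right h1le _)
    have h3 : ((n * q ^ m : ℕ) : ℝ) ≤ _ := Nat.cast_le.mpr h2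
    rw [Nat.cast_add] at h3
    push_cast at h3 hrest ⊢
    linarith
  have hrightR : ((∑ v ∈ A.toRight, plDeg q (.inr v : Pl R R') : ℕ) : ℝ) ≤ n := by exact_mod_cast hright
  have hright0 : (0 : ℝ) ≤ ((∑ v ∈ A.toRight, plDeg q (.inr v : Pl R R') : ℕ) : ℝ) := by positivity
  have hn1' : (1 : ℝ) ≤ n := by exact_mod_cast hn1
  have hCs : 0 ≤ Cst * √q ^ m := by positivity
  have hnn : (n : ℝ) ≤ n * √q ^ m := le_mul_of_one_le_right (by positivity) hsm
  rw [hN, Nat.cast_add, abs_le]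
  constructor
  · nlinarith
  · nlinarith
end Curve10

set_option linter.all false
/-! ## Part 7a: the Weil bound for the splitting field -/
section Curve11
open Polynomial IsDedekindDomain WithZero

variable {F : Type*} [Field F] {M : Type*} [Field M] [Algebra (RatFunc F) M]
  [Algebra F M] [IsScalarTower F (RatFunc F) M]
  [Algebra F[X] M] [IsScalarTower F[X] (RatFunc F) M]
  {R R' : Type*} [CommRing R] [IsDedekindDomain R] [Algebra R M] [IsFractionRing R M]
  [Algebra F[X] R] [Module.Finite F[X] R] [IsScalarTower F[X] R M] 
  [Algebra F R] [IsScalarTower F R M]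
  [CommRing R'] [IsDedekindDomain R'] [Algebra R' M] [IsFractionRing R' M]
  [Algebra (Oinf F) R'] [Module.Finite (Oinf F) R'] [IsScalarTower (Oinf F) R' M] 
  [Algebra F R'] [IsScalarTower F R' M]


theorem weil_final [Finite F] [FiniteDimensional (RatFunc F) M] [IsGalois (RatFunc F) M]
    (hconst : ∀ z : M, IsAlgebraic F z → ∃ c : F, algebraMap F M c = z)
    {r : ℕ} (hr : 0 < r) (hW : Ss M ((r - 1) • Tinf F M R R') = ⊤) (S : ℕ → Finset (Pl R R'))
    (hS : ∀ d P, P ∈ S d ↔ plDeg (Nat.card F) P ≤ d) :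
    (Nat.card F : ℝ) + 1 - (2 * Module.finrank (RatFunc F) M * ((r : ℝ) - 1) + 2 - r) * √(Nat.card F)
      ≤ (S 1).card := by
  have h0 : Nat.card (Ls M (0 : Pl R R' → ℤ)) = Nat.card F := card_L0 hconst
  obtain ⟨C, hC⟩ := point_bound hconst h0 (r - 1) hW S hS
  obtain ⟨l, hl1, hl⟩ := card_Lk (F := F) (M := M) (R := R) (R' := R') h0 (r - 1)
  have hdeg : dvDeg (Nat.card F) ((r - 1) • Tinf F M R R') = (r - 1 : ℕ) * (Module.finrank (RatFunc F) M : ℤ) := by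
    rw [dvDeg_nsmul, deg_Tinf]
  have hn : 0 < Module.finrank (RatFunc F) M := Module.finrank_pos
  obtain ⟨k, rfl⟩ : ∃ k, r = k + 1 := ⟨r - 1, by omega⟩
  simp only [Nat.add_sub_cancel] at *
  have hk : k ≤ 2 * Module.finrank (RatFunc F) M * k := by nlinarith
  have := weil_abstract (curve_hpow F) Finite.one_lt_card h0 (k • Tinf F M R R') hW l hl hS
    (2 * Module.finrank (RatFunc F) M * k - k) (by
      rw [hdeg, Nat.cast_sub hk]; push_cast; 
      have : (k : ℤ) + 1 ≤ l := by exact_mod_cast hl1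
      nlinarith) (by rw [hdeg]; positivity) C hC
  have hpt : ptCount (plDeg (Nat.card F)) S 1 = (S 1).card := by
    rw [ptCount, Finset.card_eq_sum_ones, Finset.filter_true_of_mem]
    · refine Finset.sum_congr rfl fun P hP => ?_
      have := plDeg_pos (curve_hpow F) Finite.one_lt_card P
      have := (hS 1 P).mp hP
      omega
    · intro P hP
      have := plDeg_pos (curve_hpow F) Finite.one_lt_card P
      have := (hS 1 P).mp hP
      rw [show plDeg (Nat.card F) P = 1 by omega]
  rw [hpt, Nat.cast_sub hk] at this
  push_cast at this ⊢
  refine le_trans (le_of_eq ?_) this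
  ring

/-- places of degree one give points -/
theorem exists_phi [Finite F] (v : HeightOneSpectrum R)
    (hv : plDeg (Nat.card F) (.inl v : Pl R R') ≤ 1) :
    ∃ φ : R →+* F, (∀ c, φ (algebraMap F R c) = c) ∧ ∀ y, φ y = 0 ↔ y ∈ v.asIdeal := by
  have hp := plDeg_pos (curve_hpow F) Finite.one_lt_card (.inl v : Pl R R')
  have h1 := resCard_eq (curve_hpow F) Finite.one_lt_card (.inl v : Pl R R')
  have h2 : plDeg (Nat.card F) (.inl v : Pl R R') = 1 := by omega
  rw [h2, pow_one] at h1
  have h1 : Nat.card (R ⧸ v.asIdeal) = Nat.card F := h1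
  have := resF_finite (F := F) v
  have := v.isMaximal
  letI := Ideal.Quotient.field v.asIdeal
  have hb : Function.Bijective (algebraMap F (R ⧸ v.asIdeal)) := by
    have := Fintype.ofFinite F
    have := Fintype.ofFinite (R ⧸ v.asIdeal)
    rw [Fintype.bijective_iff_injective_and_card]
    refine ⟨(algebraMap F (R ⧸ v.asIdeal)).injective, ?_⟩
    rw [← Nat.card_eq_fintype_card, ← Nat.card_eq_fintype_card, h1]
  let e := RingEquiv.ofBijective _ hb
  refine ⟨(e.symm : (R ⧸ v.asIdeal) →+* F).comp (Ideal.Quotient.mk v.asIdeal), fun c => ?_, fun y => ?_⟩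
  · show e.symm (e c) = c
    simp
  · rw [← Ideal.Quotient.eq_zero_iff_mem]
    show e.symm _ = 0 ↔ _
    rw [EmbeddingLike.map_eq_zero_iff]

end Curve11

theorem good_or_double {F R ι : Type*} [Field F] [CommRing R] [IsDedekindDomain R] [Algebra F R] [Fintype ι]
    [DecidableEq ι] [DecidableEq F]
    (I : Ideal R) [I.IsPrime] (hI : I ≠ ⊥) (φ : R →+* F) (hφ : ∀ c, φ (algebraMap F R c) = c) (hφI : ∀ y, φ y = 0 ↔ y ∈ I)
    (f g : Polynomial F) (hcop : IsCoprime f g) (t l : R) (y : ι → R)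
    (hl : φ l ≠ 0) (hid : ∏ i, (Polynomial.C l * Polynomial.X - Polynomial.C (y i)) =
      Polynomial.C (l ^ (Fintype.card ι - 1)) * (f.map (algebraMap F R) - Polynomial.C t * g.map (algebraMap F R))) :
    (∃ s : Finset F, s.card = Fintype.card ι ∧ ∀ x, x ∈ s ↔ f.eval x = φ t * g.eval x) ∨
    (∃ a : F, f.eval a = φ t * g.eval a ∧ f.derivative.eval a = φ t * g.derivative.eval a ∧ 
      t - algebraMap F R (φ t) ∈ I ^ 2) := by
  open Polynomial in
  have hφc : φ.comp (algebraMap F R) = RingHom.id F := RingHom.ext hφ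
  -- reduce
  have h1 : C (φ l ^ (Fintype.card ι - 1)) * (f - C (φ t) * g) = ∏ i, (C (φ l) * X - C (φ (y i))) := by
    have := congrArg (Polynomial.map φ) hid
    simp only [Polynomial.map_mul, Polynomial.map_sub, Polynomial.map_prod, map_C, map_X, Polynomial.map_map, hφc, Polynomial.map_id, map_pow] at this
    rw [this, Polynomial.map_pow, map_C, map_pow]
  have hroot : ∀ x, f.eval x = φ t * g.eval x ↔ ∃ i, x = φ (y i) / φ l := by
    intro x
    have := congrArg (eval x) h1
    simp only [eval_mul, eval_sub, eval_prod, eval_C, eval_X] at this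
    rw [← sub_eq_zero]
    have h3 : (f.eval x - φ t * g.eval x = 0) ↔ φ l ^ (Fintype.card ι - 1) * (f.eval x - φ t * g.eval x) = 0 := by
      simp [hl]
    rw [h3, this, Finset.prod_eq_zero_iff]
    simp only [Finset.mem_univ, true_and, sub_eq_zero]
    refine exists_congr fun i => ?_
    rw [eq_div_iff hl, mul_comm]
  by_cases hinj : Function.Injective (fun i => φ (y i) / φ l)
  · left
    refine ⟨Finset.univ.image (fun i => φ (y i) / φ l), ?_, ?_⟩
    · rw [Finset.card_image_of_injective _ hinj, Finset.card_univ]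
    · intro x
      rw [hroot]; simp [eq_comm]
  · right
    simp only [Function.Injective] at hinj
    push Not at hinj
    obtain ⟨i, j, hij, hne⟩ := hinj
    have ha : f.eval (φ (y i) / φ l) = φ t * g.eval (φ (y i) / φ l) := (hroot _).mpr ⟨i, rfl⟩
    set a := φ (y i) / φ l with hadef
    have hai : φ (y i) = φ l * a := by rw [hadef]; field_simp
    have haj : φ (y j) = φ l * a := by rw [hij]; field_simp
    refine ⟨a, ha, ?_, ?_⟩
    · rw [← Finset.mul_prod_erase _ _ (Finset.mem_univ i), ← Finset.mul_prod_erase _ _ (Finset.mem_erase.mpr ⟨hne.symm, Finset.mem_univ j⟩)] at h1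
      have := congrArg (fun p => eval a (derivative p)) h1
      simp only [derivative_mul, derivative_C, derivative_sub, eval_add, eval_mul, eval_sub, eval_C, eval_X, derivative_X, hai, haj, zero_mul, zero_add, mul_one, eval_one, sub_self, mul_zero, add_zero, eval_zero, sub_zero] at this
      have h4 := (mul_eq_zero.mp this).resolve_left (pow_ne_zero _ hl)
      exact sub_eq_zero.mp h4
    · rw [← Finset.mul_prod_erase _ _ (Finset.mem_univ i), ← Finset.mul_prod_erase _ _ (Finset.mem_erase.mpr ⟨hne.symm, Finset.mem_univ j⟩)] at hid
      have := congrArg (eval (algebraMap F R a)) hid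
      simp only [eval_mul, eval_sub, eval_C, eval_X, eval_map_algebraMap, aeval_algebraMap_apply, coe_aeval_eq_eval] at this
      rw [ha, map_mul] at this
      have h5 : l ^ (Fintype.card ι - 1) * algebraMap F R (g.eval a) * (t - algebraMap F R (φ t)) ∈ I ^ 2 := by
        have h6 : l ^ (Fintype.card ι - 1) * algebraMap F R (g.eval a) * (t - algebraMap F R (φ t)) = 
          -(l ^ (Fintype.card ι - 1) * (algebraMap F R (φ t) * algebraMap F R (g.eval a) - t * algebraMap F R (g.eval a))) := by ring
        rw [h6, ← this, neg_mem_iff, ← mul_assoc]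
        refine Ideal.mul_mem_right _ _ ?_
        rw [sq]
        refine Ideal.mul_mem_mul ?_ ?_
        · rw [← hφI, map_sub, map_mul, hφ, hai, sub_self]
        · rw [← hφI, map_sub, map_mul, hφ, haj, sub_self]
      refine (Ideal.IsPrime.mul_mem_pow _ h5).resolve_left ?_
      rw [← hφI, map_mul, map_pow, hφ]
      refine mul_ne_zero (pow_ne_zero _ hl) ?_
      intro hg
      obtain ⟨u, w, huw⟩ := hcop
      have := congrArg (eval a) huw
      simp [ha, hg] at this

set_option linter.all false
/-! ## Part 7b: splitting data -/
section Curve12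
open Polynomial IsDedekindDomain WithZero

variable {F : Type*} [Field F] {M : Type*} [Field M] [Algebra (RatFunc F) M]
  [Algebra F M] [IsScalarTower F (RatFunc F) M]
  [Algebra F[X] M] [IsScalarTower F[X] (RatFunc F) M]
  {R R' : Type*} [CommRing R] [IsDedekindDomain R] [Algebra R M] [IsFractionRing R M]
  [Algebra F[X] R] [Module.Finite F[X] R] [IsScalarTower F[X] R M] 
  [Algebra F R] [IsScalarTower F R M]
  [CommRing R'] [IsDedekindDomain R'] [Algebra R' M] [IsFractionRing R' M]
  [Algebra (Oinf F) R'] [Module.Finite (Oinf F) R'] [IsScalarTower (Oinf F) R' M] 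
  [Algebra F R'] [IsScalarTower F R' M]


theorem split_data {f g : F[X]} {r : ℕ} (hd : max f.natDegree g.natDegree = r + 1)
    {P : (RatFunc F)[X]}
    (hP : P = f.map (algebraMap F (RatFunc F)) - C RatFunc.X * g.map (algebraMap F (RatFunc F)))
    [P.IsSplittingField (RatFunc F) M] :
    ∃ y : Fin (r + 1) → R, ∏ i, (C (algebraMap F R (f.coeff (r + 1)) - tR F R * algebraMap F R (g.coeff (r + 1))) * X - C (y i)) =
      C ((algebraMap F R (f.coeff (r + 1)) - tR F R * algebraMap F R (g.coeff (r + 1))) ^ r) *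
        (f.map (algebraMap F R) - C (tR F R) * g.map (algebraMap F R)) := by
  have hPd := P_natDegree hd (by omega) hP
  have hP0 : P ≠ 0 := by rintro rfl; simp at hPd
  have hs := IsSplittingField.splits M P
  have hcard := hs.natDegree_eq_card_roots
  rw [natDegree_map, hPd] at hcard
  have hroot : ∀ y ∈ (P.map (algebraMap (RatFunc F) M)).roots, aeval y P = 0 := by
    intro y hy
    rw [mem_roots (map_ne_zero hP0), IsRoot, eval_map_algebraMap] at hy
    exact hy
  have hprod := hs.eq_prod_roots
  obtain ⟨L, hL⟩ := Quot.exists_rep (P.map (algebraMap (RatFunc F) M)).roots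
  change (L : Multiset M) = _ at hL
  rw [← hL] at hcard hroot hprod
  rw [Multiset.coe_card] at hcard
  set p : F[X][X] := f.map C - C X * g.map C with hp
  have hpP : p.map (algebraMap F[X] (RatFunc F)) = P := by
    rw [hp, hP, Polynomial.map_sub, Polynomial.map_mul, map_C, Polynomial.map_map, Polynomial.map_map, RatFunc.algebraMap_X]
    rfl
  have hpd : p.natDegree = r + 1 := by
    rw [← hPd, ← hpP, natDegree_map_eq_of_injective (IsFractionRing.injective F[X] (RatFunc F))]
  have hplc : p.leadingCoeff = C (f.coeff (r + 1)) - X * C (g.coeff (r + 1)) := by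
    rw [leadingCoeff, hpd, hp, coeff_sub, coeff_C_mul, coeff_map, coeff_map]
  have hCM : ∀ c : F, algebraMap F[X] M (C c) = algebraMap F M c := by
    intro c
    rw [← tM_poly, aeval_C]
  set l : R := algebraMap F R (f.coeff (r + 1)) - tR F R * algebraMap F R (g.coeff (r + 1)) with hl
  have hlM : algebraMap R M l = algebraMap F[X] M p.leadingCoeff := by
    rw [hplc, hl, map_sub, map_sub, map_mul, map_mul, hCM, hCM, tR_map, ← IsScalarTower.algebraMap_apply,
      ← IsScalarTower.algebraMap_apply, ← tM_poly X, aeval_X]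
  have hPM : P.map (algebraMap (RatFunc F) M) = (f.map (algebraMap F M) - C (tM F M) * g.map (algebraMap F M)) := by
    rw [hP, Polynomial.map_sub, Polynomial.map_mul, map_C, Polynomial.map_map, Polynomial.map_map, ← IsScalarTower.algebraMap_eq]
    rfl
  have hlc : (P.map (algebraMap (RatFunc F) M)).leadingCoeff = algebraMap R M l := by
    rw [hlM, leadingCoeff_map, ← hpP, leadingCoeff_map_of_injective (IsFractionRing.injective F[X] (RatFunc F)),
      ← IsScalarTower.algebraMap_apply]
  have hint : ∀ i : Fin (r + 1), ∃ y : R, algebraMap R M y = algebraMap R M l * L[i] := by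
    intro i
    have h1 : aeval L[i] p = 0 := by
      have h0 : ∀ x : M, aeval x P = 0 → aeval x p = 0 := by
        intro x hx
        rwa [← hpP, aeval_map_algebraMap] at hx
      exact h0 _ (hroot L[i] (by simp))
    have h2 := isIntegral_leadingCoeff_smul p L[i] h1
    rw [Algebra.smul_def, ← hlM] at h2
    exact mem_range_iff_int.mpr h2
  choose y hy using hint
  refine ⟨y, ?_⟩
  apply map_injective (algebraMap R M) (IsFractionRing.injective R M)
  rw [Polynomial.map_prod, Polynomial.map_mul, Polynomial.map_sub, Polynomial.map_mul, map_C, map_C, Polynomial.map_map, Polynomial.map_map,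
    ← IsScalarTower.algebraMap_eq, tR_map, ← hPM, hprod, hlc]
  simp only [Polynomial.map_sub, Polynomial.map_mul, map_C, map_X, hy]
  have h3 : ∀ i : Fin (r + 1), C (algebraMap R M l) * X - C (algebraMap R M l * L[i]) = C (algebraMap R M l) * (X - C L[i]) := by
    intro i; rw [mul_sub, C_mul]
  simp only [h3]
  rw [Finset.prod_mul_distrib, Finset.prod_const, Finset.card_univ, Fintype.card_fin, pow_succ, map_pow, C_pow, mul_assoc]
  congr 2
  rw [Multiset.map_coe, Multiset.prod_coe]
  have h4 : ∀ (n : ℕ) (hn : n = L.length), ∏ x : Fin n, (X - C (L[x])) = (List.map (fun x => X - C x) L).prod := by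
    rintro n rfl
    exact Fin.prod_univ_fun_getElem L (fun x => X - C x)
  exact h4 _ hcard

/-- dichotomy for finite degree one places -/
theorem place_dichotomy [Finite F] [DecidableEq F] {f g : F[X]} (hcop : IsCoprime f g) {r : ℕ} (hd : max f.natDegree g.natDegree = r + 1)
    {P : (RatFunc F)[X]}
    (hP : P = f.map (algebraMap F (RatFunc F)) - C RatFunc.X * g.map (algebraMap F (RatFunc F)))
    [P.IsSplittingField (RatFunc F) M] (v : HeightOneSpectrum R)
    (hv : plDeg (Nat.card F) (.inl v : Pl R R') ≤ 1) :
    ∃ b : F, tR F R - algebraMap F R b ∈ v.asIdeal ∧ (f.coeff (r + 1) = b * g.coeff (r + 1) ∨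
      (∃ s : Finset F, s.card = r + 1 ∧ ∀ x, x ∈ s ↔ f.eval x = b * g.eval x) ∨
      (∃ a : F, f.eval a = b * g.eval a ∧ f.derivative.eval a = b * g.derivative.eval a ∧ 
      tR F R - algebraMap F R b ∈ v.asIdeal ^ 2)) := by
  obtain ⟨φ, h1, h2⟩ := exists_phi (F := F) (R' := R') v hv
  refine ⟨φ (tR F R), ?_, ?_⟩
  · rw [← h2, map_sub, h1, sub_self]
  rw [or_iff_not_imp_left]
  intro h3
  obtain ⟨y, hy⟩ := split_data (R := R) (M := M) hd hP
  have := v.isPrime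
  have := good_or_double v.asIdeal v.ne_bot φ h1 h2 f g hcop (tR F R) (algebraMap F R (f.coeff (r + 1)) - tR F R * algebraMap F R (g.coeff (r + 1))) y (by
    rw [map_sub, map_mul, h1, h1]
    exact sub_ne_zero.mpr h3) (by rw [Fintype.card_fin]; exact hy)
  rwa [Fintype.card_fin] at this

end Curve12

set_option linter.all false
/-! ## Part 7c: counting degree one places -/
section Curve13
open Polynomial IsDedekindDomain WithZero

variable {F : Type*} [Field F] {M : Type*} [Field M] [Algebra (RatFunc F) M]
  [Algebra F M] [IsScalarTower F (RatFunc F) M]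
  [Algebra F[X] M] [IsScalarTower F[X] (RatFunc F) M]
  {R R' : Type*} [CommRing R] [IsDedekindDomain R] [Algebra R M] [IsFractionRing R M]
  [Algebra F[X] R] [Module.Finite F[X] R] [IsScalarTower F[X] R M] 
  [Algebra F R] [IsScalarTower F R M]
  [CommRing R'] [IsDedekindDomain R'] [Algebra R' M] [IsFractionRing R' M]
  [Algebra (Oinf F) R'] [Module.Finite (Oinf F) R'] [IsScalarTower (Oinf F) R' M] 
  [Algebra F R'] [IsScalarTower F R' M]


theorem inf_count [Finite F] [FiniteDimensional (RatFunc F) M] (S : Finset (Pl R R')) :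
    S.toRight.card ≤ Module.finrank (RatFunc F) M := by
  classical
  set T := S.toRight
  have h2 : dvDeg (Nat.card F) (∑ v ∈ T, Finsupp.single (.inr v : Pl R R') (1 : ℤ)) ≤ dvDeg (Nat.card F) (Tinf F M R R') := by
    refine dvDeg_mono _ ?_
    rintro (v | v)
    · rw [Tinf_inl]; simp [Finsupp.finset_sum_apply, Finsupp.single_apply]
    · rw [Tinf_inr]
      refine le_trans ?_ (tinf_pos v)
      simp only [Finsupp.finset_sum_apply, Finsupp.single_apply, Sum.inr.injEq]
      rw [Finset.sum_ite_eq' T v]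
      split_ifs <;> simp
  rw [deg_Tinf, dvDeg_sum] at h2
  have h3 : ∀ v ∈ T, (1 : ℤ) ≤ dvDeg (Nat.card F) (Finsupp.single (.inr v : Pl R R') (1 : ℤ)) := by
    intro v _
    rw [dvDeg_single]
    have := plDeg_pos (curve_hpow F) Finite.one_lt_card (.inr v : Pl R R')
    push_cast
    omega
  have h4 := Finset.sum_le_sum h3
  simp only [Finset.sum_const, nsmul_eq_mul, mul_one] at h4
  exact_mod_cast h4.trans h2

theorem fin_count [Finite F] [FiniteDimensional (RatFunc F) M]
    (h0 : Nat.card (Ls M (0 : Pl R R' → ℤ)) = Nat.card F) (w : ℕ)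
    (hW : Ss M (w • Tinf F M R R') = ⊤) (b : F) (e : ℕ) (T : Finset (HeightOneSpectrum R))
    (hT : ∀ v ∈ T, tR F R - algebraMap F R b ∈ v.asIdeal ^ e) : e * T.card ≤ Module.finrank (RatFunc F) M := by
  obtain ⟨l, hl1, hl⟩ := card_Lk (F := F) (M := M) (R := R) (R' := R') h0 w
  have hne : tM F M - algebraMap F M b ≠ 0 := by
    intro h
    rw [← aeval_X (R := F) (tM F M), ← aeval_C (tM F M) b, ← map_sub, tM_poly, map_eq_zero_iff _ (algMapM_inj)] at h
    exact X_sub_C_ne_zero b h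
  have hmap : algebraMap R M (tR F R - algebraMap F R b) = tM F M - algebraMap F M b := by
    rw [map_sub, tR_map, ← IsScalarTower.algebraMap_apply]
  have := zero_count (k := 1) h0 (w • Tinf F M R R') hW l hl hne (by
    refine sub_mem Lk_t ?_
    exact Lk_mono (Nat.zero_le 1) (Lk_const b)) T (fun _ => e) (by
    intro v hv
    rw [← hmap]
    refine vlog_le_of_mem ?_ (hT v hv)
    intro h
    rw [h, map_zero] at hmap
    exact hne hmap.symm)
  rw [mul_one] at this
  refine le_trans ?_ this
  rw [mul_comm, ← smul_eq_mul, ← Finset.sum_const]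
  refine Finset.sum_le_sum fun v _ => ?_
  exact Nat.le_mul_of_pos_right _ (plDeg_pos (curve_hpow F) Finite.one_lt_card _)

open scoped Classical in
theorem place_count [Fintype F] [FiniteDimensional (RatFunc F) M] {f g : F[X]} (hcop : IsCoprime f g) {r : ℕ} (hd : max f.natDegree g.natDegree = r + 1)
    {P : (RatFunc F)[X]}
    (hP : P = f.map (algebraMap F (RatFunc F)) - C RatFunc.X * g.map (algebraMap F (RatFunc F)))
    [P.IsSplittingField (RatFunc F) M]
    (h0 : Nat.card (Ls M (0 : Pl R R' → ℤ)) = Nat.card F) (w : ℕ)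
    (hW : Ss M (w • Tinf F M R R') = ⊤) (S : ℕ → Finset (Pl R R'))
    (hS : ∀ d P, P ∈ S d ↔ plDeg (Nat.card F) P ≤ d) :
    2 * (S 1).card ≤ Module.finrank (RatFunc F) M * (2 +
      2 * (Finset.univ.filter fun b : F => f.coeff (r + 1) = b * g.coeff (r + 1)).card + 
      2 * (Finset.univ.filter fun b : F => f.coeff (r + 1) ≠ b * g.coeff (r + 1) ∧ 
        ∃ s : Finset F, s.card = r + 1 ∧ ∀ x, x ∈ s ↔ f.eval x = b * g.eval x).card +
      (Finset.univ.filter fun b : F => ∃ a : F, f.eval a = b * g.eval a ∧ f.derivative.eval a = b * g.derivative.eval a).card) := by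
  have hex : ∀ v : HeightOneSpectrum R, ∃ b : F, Sum.inl v ∈ S 1 → tR F R - algebraMap F R b ∈ v.asIdeal ∧ (f.coeff (r + 1) = b * g.coeff (r + 1) ∨
      (∃ s : Finset F, s.card = r + 1 ∧ ∀ x, x ∈ s ↔ f.eval x = b * g.eval x) ∨
      (∃ a : F, f.eval a = b * g.eval a ∧ f.derivative.eval a = b * g.derivative.eval a ∧ 
      tR F R - algebraMap F R b ∈ v.asIdeal ^ 2)) := by
    intro v
    by_cases hv : Sum.inl v ∈ S 1
    · obtain ⟨b, hb⟩ := place_dichotomy (R' := R') (M := M) hcop hd hP v ((hS 1 _).mp hv)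
      exact ⟨b, fun _ => hb⟩
    · exact ⟨0, fun h => absurd h hv⟩
  choose β hβ using hex
  set n := Module.finrank (RatFunc F) M
  set E : F → Prop := fun b => f.coeff (r + 1) = b * g.coeff (r + 1)
  set G : F → Prop := fun b => ∃ s : Finset F, s.card = r + 1 ∧ ∀ x, x ∈ s ↔ f.eval x = b * g.eval x
  set D : F → Prop := fun b => ∃ a : F, f.eval a = b * g.eval a ∧ f.derivative.eval a = b * g.derivative.eval a
  have hfib : ∀ b : F, 2 * ((S 1).toLeft.filter (fun v => β v = b)).card ≤ n * (2 * (if E b then 1 else 0) + 2 * (if ¬ E b ∧ G b then 1 else 0) + (if D b then 1 else 0)) := by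
    intro b
    have h1 : 1 * ((S 1).toLeft.filter (fun v => β v = b)).card ≤ n := by
      refine fin_count h0 w hW b 1 _ fun v hv => ?_
      rw [Finset.mem_filter, Finset.mem_toLeft] at hv
      rw [pow_one, ← hv.2]; exact (hβ v hv.1).1
    rw [one_mul] at h1
    by_cases hE : E b
    · rw [if_pos hE]; exact le_trans (by omega : _ ≤ n * 2) (Nat.mul_le_mul_left n (by omega))
    by_cases hG : G b
    · rw [if_pos (⟨hE, hG⟩ : ¬ E b ∧ G b)]; exact le_trans (by omega : _ ≤ n * 2) (Nat.mul_le_mul_left n (by omega))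
    rcases Finset.eq_empty_or_nonempty ((S 1).toLeft.filter (fun v => β v = b)) with h | ⟨v, hv⟩
    · rw [h]; simp
    have hall : ∀ v ∈ ((S 1).toLeft.filter (fun v => β v = b)), ∃ a : F, f.eval a = b * g.eval a ∧ f.derivative.eval a = b * g.derivative.eval a ∧ 
      tR F R - algebraMap F R b ∈ v.asIdeal ^ 2 := by
      intro v hv
      rw [Finset.mem_filter, Finset.mem_toLeft] at hv
      have := (hβ v hv.1).2
      rw [hv.2] at this
      exact (this.resolve_left hE).resolve_left hG
    have hD : D b := by
      obtain ⟨a, h1, h2, _⟩ := hall v hv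
      exact ⟨a, h1, h2⟩
    have h2 := fin_count h0 w hW b 2 _ (fun v hv => (hall v hv).choose_spec.2.2)
    rw [if_pos hD]
    exact le_trans (by omega : _ ≤ n * 1) (Nat.mul_le_mul_left n (by omega))
  have hsum : (S 1).toLeft.card = ∑ b : F, ((S 1).toLeft.filter (fun v => β v = b)).card :=
    Finset.card_eq_sum_card_fiberwise (fun v _ => Finset.mem_coe.mpr (Finset.mem_univ _))
  have hR := inf_count (F := F) (M := M) (S 1)
  have htot : (S 1).card = (S 1).toLeft.card + (S 1).toRight.card := by
    rw [Finset.card_toLeft_add_card_toRight]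
  have hL : 2 * (S 1).toLeft.card ≤ n * (2 * (Finset.univ.filter E).card + 2 * (Finset.univ.filter fun b => ¬ E b ∧ G b).card + (Finset.univ.filter D).card) := by
    rw [hsum, Finset.mul_sum]
    refine (Finset.sum_le_sum fun b _ => hfib b).trans (le_of_eq ?_)
    rw [← Finset.mul_sum, Finset.sum_add_distrib, Finset.sum_add_distrib, ← Finset.mul_sum, ← Finset.mul_sum,
      Finset.card_filter, Finset.card_filter, Finset.card_filter]
  rw [htot]
  have : n * (2 + 2 * (Finset.univ.filter E).card + 2 * (Finset.univ.filter fun b => ¬ E b ∧ G b).card + (Finset.univ.filter D).card) = 2 * n + n * (2 * (Finset.univ.filter E).card + 2 * (Finset.univ.filter fun b => ¬ E b ∧ G b).card + (Finset.univ.filter D).card) := by ring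
  calc _ ≤ 2 * n + n * (2 * (Finset.univ.filter E).card + 2 * (Finset.univ.filter fun b => ¬ E b ∧ G b).card + (Finset.univ.filter D).card) := by omega
    _ = _ := this.symm

end Curve13

set_option linter.all false
/-! ## Part 7d: polynomial counting -/
section PolyCount
open Polynomial

theorem cast_ne_of_coprime {F : Type*} [Field F] [Fintype F] {r k : ℕ} (hq : Nat.Coprime (Fintype.card F) (Nat.factorial (r + 1)))
    (hk : 0 < k) (hkr : k ≤ r + 1) : (k : F) ≠ 0 := by
  intro h
  obtain ⟨p, hp⟩ := CharP.exists F
  have hpp := CharP.char_is_prime F p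
  rw [CharP.cast_eq_zero_iff F p] at h
  have h1 : p ∣ Fintype.card F := by
    rw [← CharP.cast_eq_zero_iff F p]; exact Nat.cast_card_eq_zero F
  have h2 : p ∣ Nat.factorial (r + 1) := h.trans (Nat.dvd_factorial hk hkr)
  exact hpp.one_lt.ne' (Nat.dvd_one.mp (hq ▸ Nat.dvd_gcd h1 h2))

theorem coprime_eval {F : Type*} [Field F] {f g : F[X]} (hcop : IsCoprime f g) {a b : F} (h : f.eval a = b * g.eval a) : g.eval a ≠ 0 := by
  intro hg
  obtain ⟨u, w, huw⟩ := hcop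
  have := congrArg (eval a) huw
  simp [h, hg] at this

open scoped Classical in
theorem dbl_count {F : Type*} [Field F] [Fintype F]
    (r : ℕ) (hr : 0 < r)
    (hq : Nat.Coprime (Fintype.card F) (Nat.factorial (r + 1)))
    (f g : Polynomial F) (hcop : IsCoprime f g)
    (hdeg : max f.natDegree g.natDegree = r + 1)
    (m : ℕ) (gi : Fin m → Polynomial F) (ai : Fin m → ℕ)
    (hirr : ∀ i, Irreducible (gi i)) (hmon : ∀ i, (gi i).Monic)
    (hgine : ∀ i j, i ≠ j → gi i ≠ gi j) (hai : ∀ i, 0 < ai i)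
    (hfact : g = Polynomial.C g.leadingCoeff * ∏ i, gi i ^ ai i) :
    2 + 2 * (Finset.univ.filter fun b : F => f.coeff (r + 1) = b * g.coeff (r + 1)).card +
      (Finset.univ.filter fun b : F => ∃ a : F, f.eval a = b * g.eval a ∧ f.derivative.eval a = b * g.derivative.eval a).card
      ≤ r + 3 + ∑ i, (gi i).natDegree := by
  have hg0 : g ≠ 0 := by
    rintro rfl
    have := natDegree_eq_zero_of_isUnit (isCoprime_zero_right.mp hcop)
    simp at hdeg; omega
  have hf0 : f ≠ 0 := by
    rintro rfl
    have := natDegree_eq_zero_of_isUnit (isCoprime_zero_left.mp hcop)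
    simp at hdeg; omega
  have hW0 : wronskian f g ≠ 0 := by
    intro h
    obtain ⟨h1, h2⟩ := hcop.wronskian_eq_zero_iff.mp h
    have hc : ∀ p : F[X], derivative p = 0 → p.natDegree ≠ r + 1 := by
      intro p hp hpd
      have := congrArg (fun s => coeff s r) hp
      simp only [coeff_derivative, coeff_zero] at this
      have h3 := cast_ne_of_coprime hq (Nat.succ_pos r) le_rfl
      push_cast at h3
      have h4 := (mul_eq_zero.mp this).resolve_right h3
      rw [← hpd, coeff_natDegree, leadingCoeff_eq_zero] at h4
      rw [h4] at hpd; simp at hpd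
    have := hc f h1
    have := hc g h2
    omega
  set G0 := ∏ i, gi i ^ (ai i - 1) with hG0
  have hGm : G0.Monic := monic_prod_of_monic _ _ fun i _ => (hmon i).pow _
  have hGd : G0.natDegree + ∑ i, (gi i).natDegree = g.natDegree := by
    conv_rhs => rw [hfact]
    rw [natDegree_C_mul (leadingCoeff_ne_zero.mpr hg0), natDegree_prod_of_monic _ _ fun i _ => (hmon i).pow _,
      natDegree_prod_of_monic _ _ fun i _ => (hmon i).pow _, ← Finset.sum_add_distrib]
    refine Finset.sum_congr rfl fun i _ => ?_
    rw [natDegree_pow, natDegree_pow]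
    have := hai i
    obtain ⟨k, hk⟩ : ∃ k, ai i = k + 1 := ⟨ai i - 1, by omega⟩
    rw [hk, Nat.add_sub_cancel]; ring
  have hcopi : Pairwise (fun i j => IsCoprime (gi i ^ (ai i - 1)) (gi j ^ (ai j - 1))) := by
    intro i j hij
    refine IsCoprime.pow ?_
    refine ((hirr i).coprime_iff_not_dvd).mpr fun h => ?_
    exact hgine i j hij (eq_of_monic_of_associated (hmon i) (hmon j) ((hirr i).associated_of_dvd (hirr j) h))
  have hig : ∀ i, gi i ^ ai i ∣ g := by
    intro i
    rw [hfact]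
    exact Dvd.dvd.mul_left (Finset.dvd_prod_of_mem _ (Finset.mem_univ i)) _
  have hGg : G0 ∣ g := Finset.prod_dvd_of_coprime (fun i _ j _ h => hcopi h) fun i _ =>
    (pow_dvd_pow _ (Nat.sub_le _ _)).trans (hig i)
  have hGg' : G0 ∣ derivative g := Finset.prod_dvd_of_coprime (fun i _ j _ h => hcopi h) fun i _ =>
    pow_sub_one_dvd_derivative_of_pow_dvd (hig i)
  obtain ⟨W1, hW1⟩ : G0 ∣ wronskian f g := by
    rw [wronskian]; exact dvd_sub (hGg'.mul_left _) (hGg.mul_left _)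
  have hW10 : W1 ≠ 0 := by rintro rfl; simp at hW1; exact hW0 hW1
  have hWd : (wronskian f g).natDegree = G0.natDegree + W1.natDegree := by
    rw [hW1, natDegree_mul hGm.ne_zero hW10]
  -- the points
  have hD : (Finset.univ.filter fun b : F => ∃ a : F, f.eval a = b * g.eval a ∧ f.derivative.eval a = b * g.derivative.eval a).card ≤ W1.natDegree := by
    refine le_trans ?_ ((Multiset.toFinset_card_le W1.roots).trans (card_roots' W1))
    have hsub : (Finset.univ.filter fun b : F => ∃ a : F, f.eval a = b * g.eval a ∧ f.derivative.eval a = b * g.derivative.eval a) ⊆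
        W1.roots.toFinset.image (fun a => f.eval a / g.eval a) := by
      intro b hb
      obtain ⟨a, h1, h2⟩ := (Finset.mem_filter.mp hb).2
      have hga := coprime_eval hcop h1
      refine Finset.mem_image.mpr ⟨a, ?_, by rw [h1]; field_simp⟩
      rw [Multiset.mem_toFinset, mem_roots hW10, IsRoot]
      have h3 := congrArg (eval a) hW1
      rw [wronskian, eval_sub, eval_mul, eval_mul, eval_mul, h1, h2] at h3
      have h4 : eval a G0 * eval a W1 = 0 := by rw [← h3]; ring
      refine (mul_eq_zero.mp h4).resolve_left fun h5 => ?_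
      obtain ⟨k, hk⟩ := hGg
      rw [hk, eval_mul, h5, zero_mul] at hga
      exact hga rfl
    exact (Finset.card_le_card hsub).trans Finset.card_image_le
  by_cases hgr : g.coeff (r + 1) = 0
  · have hgd : g.natDegree ≠ r + 1 := by
      intro h
      rw [← h, coeff_natDegree, leadingCoeff_eq_zero] at hgr
      exact hg0 hgr
    have hfd : f.natDegree = r + 1 := by omega
    have hE : (Finset.univ.filter fun b : F => f.coeff (r + 1) = b * g.coeff (r + 1)) = ∅ := by
      refine Finset.filter_eq_empty_iff.mpr fun b _ h => ?_
      rw [hgr, mul_zero, ← hfd, coeff_natDegree, leadingCoeff_eq_zero] at h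
      exact hf0 h
    have := natDegree_wronskian_lt_add hW0
    rw [hE, Finset.card_empty]
    omega
  · set c := f.coeff (r + 1) / g.coeff (r + 1) with hc
    have hE : (Finset.univ.filter fun b : F => f.coeff (r + 1) = b * g.coeff (r + 1)) ⊆ {c} := by
      intro b hb
      rw [Finset.mem_singleton, hc, (Finset.mem_filter.mp hb).2]; field_simp
    have hE1 := Finset.card_le_card hE
    rw [Finset.card_singleton] at hE1
    have hgd : g.natDegree = r + 1 := le_antisymm (by omega) (le_natDegree_of_ne_zero hgr)
    have hWc : wronskian f g = wronskian (f - C c * g) g := by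
      rw [wronskian, wronskian]; simp only [derivative_sub, derivative_mul, derivative_C]; ring
    have hfc : (f - C c * g).natDegree ≤ r := by
      rw [natDegree_le_iff_coeff_eq_zero]
      intro N hN
      rw [coeff_sub, coeff_C_mul]
      rcases Nat.lt_or_ge (r + 1) N with h | h
      · rw [coeff_eq_zero_of_natDegree_lt (by omega), coeff_eq_zero_of_natDegree_lt (by omega)]; simp
      · have : N = r + 1 := by omega
        rw [this, hc]; field_simp; simp
    have := natDegree_wronskian_lt_add (hWc ▸ hW0)
    rw [← hWc] at this
    omega

end PolyCount

set_option linter.all false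
/-! ## Part 7e: Galois theory of the splitting field, and fibres -/
section GalCount
open Polynomial

theorem sep_galois {F : Type*} [Field F] [Fintype F] {r : ℕ} 
    (hq : Nat.Coprime (Fintype.card F) (Nat.factorial (r + 1)))
    (P : (RatFunc F)[X]) (hPd : P.natDegree = r + 1) : IsGalois (RatFunc F) P.SplittingField := by
  have hP0 : P ≠ 0 := by rintro rfl; simp at hPd
  have hsepx : ∀ x ∈ P.rootSet P.SplittingField, IsSeparable (RatFunc F) x := by
    intro x hx
    have hx0 := (mem_rootSet.mp hx).2
    have hint : IsIntegral (RatFunc F) x := Algebra.IsIntegral.isIntegral x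
    have hirr := minpoly.irreducible hint
    have hdvd : minpoly (RatFunc F) x ∣ P := minpoly.dvd _ _ hx0
    have hd := natDegree_le_of_dvd hdvd hP0
    have hpos := minpoly.natDegree_pos hint
    rw [IsSeparable, separable_iff_derivative_ne_zero hirr]
    intro h
    obtain ⟨k, hk⟩ : ∃ k, (minpoly (RatFunc F) x).natDegree = k + 1 := ⟨_, (Nat.succ_pred_eq_of_pos hpos).symm⟩
    have := congrArg (fun s => coeff s k) h
    simp only [coeff_derivative, coeff_zero] at this
    rw [← hk, coeff_natDegree, (minpoly.monic hint).leadingCoeff, one_mul] at this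
    refine cast_ne_of_coprime hq (Nat.succ_pos k) (by omega) ?_
    apply (algebraMap F (RatFunc F)).injective
    rw [map_natCast, map_zero]; push_cast; exact this
  have htop : IntermediateField.adjoin (RatFunc F) (P.rootSet P.SplittingField) = ⊤ := by
    rw [eq_top_iff]
    intro x _
    have h1 : x ∈ Algebra.adjoin (RatFunc F) (P.rootSet P.SplittingField) := by
      rw [IsSplittingField.adjoin_rootSet]; trivial
    exact IntermediateField.algebra_adjoin_le_adjoin _ _ h1
  have h2 := (IntermediateField.isSeparable_adjoin_iff_isSeparable _ _).mpr hsepx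
  have hsep : Algebra.IsSeparable (RatFunc F) P.SplittingField := by
    rw [htop] at h2
    exact Algebra.IsSeparable.of_algHom (RatFunc F) (⊤ : IntermediateField (RatFunc F) P.SplittingField) IntermediateField.topEquiv.symm.toAlgHom
  have hnorm : Normal (RatFunc F) P.SplittingField := inferInstance
  exact IsGalois.mk

theorem finrank_le_factorial {K : Type*} [Field K] (P : K[X]) [IsGalois K P.SplittingField] :
    Module.finrank K P.SplittingField ≤ Nat.factorial P.natDegree := by
  classical
  rw [← IsGalois.card_aut_eq_finrank]
  haveI : Fact ((P.map (algebraMap K P.SplittingField)).Splits) := ⟨IsSplittingField.splits _ _⟩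
  have h := Nat.card_le_card_of_injective _ (Gal.galActionHom_injective P P.SplittingField)
  refine le_trans h ?_
  rw [Nat.card_eq_fintype_card, Fintype.card_perm]
  refine Nat.factorial_le ?_
  rw [← Nat.card_eq_fintype_card]
  exact ncard_rootSet_le P P.SplittingField
end GalCount

set_option linter.all false
/-! ## Part 7f: fibres -/
section Fibre
open Polynomial

theorem fibre_card {F : Type*} [Field F] [Fintype F] [DecidableEq F] {f g : F[X]} (hcop : IsCoprime f g) {r : ℕ}
    (hd : max f.natDegree g.natDegree = r + 1) {b : F} (hb : f.coeff (r + 1) ≠ b * g.coeff (r + 1))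
    (s : Finset F) (hs : s.card = r + 1) (hsx : ∀ x, x ∈ s ↔ f.eval x = b * g.eval x) :
    (Finset.univ.filter (fun x : Option F => ratEval f g x = some b)).card = r + 1 := by
  rw [← hs, ← Finset.card_map (s := s) Function.Embedding.some]
  refine congrArg Finset.card (Finset.ext fun x => ?_)
  rw [Finset.mem_filter]
  simp only [Finset.mem_univ, true_and, Finset.mem_map, Function.Embedding.some_apply]
  rcases x with _ | x
  · simp only [reduceCtorEq, and_false, exists_false, iff_false]
    intro h
    simp only [ratEval] at h
    split_ifs at h with h1 h2
    · apply hb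
      have h3 : f.natDegree = r + 1 := by omega
      have h4 : g.natDegree = r + 1 := by omega
      have h5 : g.leadingCoeff ≠ 0 := by
        intro h; rw [leadingCoeff_eq_zero] at h; rw [h] at h4; simp at h4
      simp only [Option.some.injEq] at h
      rw [← h]
      conv_lhs => rw [← h3, coeff_natDegree]
      conv_rhs => rw [← h4, coeff_natDegree]
      field_simp
    · apply hb
      simp only [Option.some.injEq] at h
      rw [← h, zero_mul, coeff_eq_zero_of_natDegree_lt (by omega)]
  · simp only [Option.some.injEq, exists_eq_right, hsx, ratEval]
    constructor
    · intro h
      split_ifs at h with h1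
      simp only [Option.some.injEq] at h
      rw [← h]; field_simp
    · intro h
      have := coprime_eval hcop h
      rw [if_neg this, h]; field_simp

theorem fibre_count {F : Type*} [Field F] [Fintype F] [dF : DecidableEq F] {f g : F[X]} (hcop : IsCoprime f g) {r : ℕ}
    (hd : max f.natDegree g.natDegree = r + 1) 
    [DecidablePred fun b : F => f.coeff (r + 1) ≠ b * g.coeff (r + 1) ∧ 
        ∃ s : Finset F, s.card = r + 1 ∧ ∀ x, x ∈ s ↔ f.eval x = b * g.eval x] :
    (Finset.univ.filter fun b : F => f.coeff (r + 1) ≠ b * g.coeff (r + 1) ∧ 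
        ∃ s : Finset F, s.card = r + 1 ∧ ∀ x, x ∈ s ↔ f.eval x = b * g.eval x).card ≤
    (Finset.univ.filter (fun b : Option F =>
            (Finset.univ.filter (fun x : Option F => @ratEval _ _ dF f g x = b)).card = r + 1)).card := by
  refine Finset.card_le_card_of_injOn some ?_ (Option.some_injective F).injOn
  intro b hb
  obtain ⟨h1, s, h2, h3⟩ := (Finset.mem_filter.mp hb).2
  have := @fibre_card F _ _ dF f g hcop r hd b h1 s h2 h3
  refine Finset.mem_coe.mpr (Finset.mem_filter.mpr ⟨Finset.mem_univ _, ?_⟩)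
  exact this

/-- the final numerical estimate -/
theorem final_arith (q n N r A e s k : ℝ) (hs : s ^ 2 = q) (hs1 : 1 < s) (hr : 1 ≤ r) (hn : 0 < n) (hnk : n ≤ k)
    (hr2 : r = 1 ∧ k = 2 ∨ 2 ≤ r) (he : 0 ≤ e) (hA : 0 ≤ A)
    (h1 : q + 1 - (2 * n * (r - 1) + 2 - r) * s ≤ N)
    (h2 : 2 * N ≤ n * (r + 3 + e + 2 * A)) :
    (q - 2 * s + 1) / k - 2 * s * (r - 1) - (r + 1 + e) / 2 ≤ A := by
  have hk : 0 < k := by linarith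
  have hsq : 0 ≤ q - 2 * s + 1 := by nlinarith [sq_nonneg (s - 1)]
  rcases le_or_gt n (r * s) with h | h
  · have h3 : (q - 2 * s + 1) / k ≤ (q - 2 * s + 1) / n := by gcongr
    have h4 : (q - 2 * s + 1) / n ≤ A + 2 * s * (r - 1) + (r + 1 + e) / 2 := by
      rw [div_le_iff₀ hn]
      nlinarith
    linarith
  · have h3 : (q - 2 * s + 1) / k ≤ 2 * s * (r - 1) + (r + 1 + e) / 2 := by
      rw [div_le_iff₀ hk]
      rcases hr2 with ⟨rfl, rfl⟩ | hr2
      · nlinarith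
      · have h5 : r * s ≤ k := by linarith
        have h6 : 2 * s ≤ k := by nlinarith
        have h7 : s * (2 * s) ≤ s * k := by gcongr
        have h8 : 2 * s * 1 * k ≤ 2 * s * (r - 1) * k := by gcongr; linarith
        have h9 : 0 ≤ (r + 1 + e) / 2 * k := by positivity
        nlinarith
    linarith
end Fibre

set_option linter.all false
/-! ## Part 7g: assembling -/
section Curve14
open Polynomial IsDedekindDomain WithZero

variable {F : Type*} [Field F] {M : Type*} [Field M] [Algebra (RatFunc F) M]
  [Algebra F M] [IsScalarTower F (RatFunc F) M]
  [Algebra F[X] M] [IsScalarTower F[X] (RatFunc F) M]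
  {R R' : Type*} [CommRing R] [IsDedekindDomain R] [Algebra R M] [IsFractionRing R M]
  [Algebra F[X] R] [Module.Finite F[X] R] [IsScalarTower F[X] R M] 
  [Algebra F R] [IsScalarTower F R M]
  [CommRing R'] [IsDedekindDomain R'] [Algebra R' M] [IsFractionRing R' M]
  [Algebra (Oinf F) R'] [Module.Finite (Oinf F) R'] [IsScalarTower (Oinf F) R' M] 
  [Algebra F R'] [IsScalarTower F R' M]


theorem curve_final [Fintype F] [DecidableEq F] [FiniteDimensional (RatFunc F) M] [IsGalois (RatFunc F) M]
    (R R' : Type*) [CommRing R] [IsDedekindDomain R] [Algebra R M] [IsFractionRing R M]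
  [Algebra F[X] R] [Module.Finite F[X] R] [IsScalarTower F[X] R M] 
  [Algebra F R] [IsScalarTower F R M]
  [CommRing R'] [IsDedekindDomain R'] [Algebra R' M] [IsFractionRing R' M]
  [Algebra (Oinf F) R'] [Module.Finite (Oinf F) R'] [IsScalarTower (Oinf F) R' M] 
  [Algebra F R'] [IsScalarTower F R' M]
    (r : ℕ) (hr : 0 < r)
    (hq : Nat.Coprime (Fintype.card F) (Nat.factorial (r + 1)))
    (f g : Polynomial F) (hcop : IsCoprime f g)
    (hdeg : max f.natDegree g.natDegree = r + 1)
    (m : ℕ) (gi : Fin m → Polynomial F) (ai : Fin m → ℕ)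
    (hirr : ∀ i, Irreducible (gi i)) (hmon : ∀ i, (gi i).Monic)
    (hgine : ∀ i j, i ≠ j → gi i ≠ gi j) (hai : ∀ i, 0 < ai i)
    (hfact : g = Polynomial.C g.leadingCoeff * ∏ i, gi i ^ ai i)
    (P : Polynomial (RatFunc F))
    (hP : P = f.map (algebraMap F (RatFunc F))
        - Polynomial.C RatFunc.X * g.map (algebraMap F (RatFunc F)))
    [P.IsSplittingField (RatFunc F) M] (hn : Module.finrank (RatFunc F) M ≤ Nat.factorial (r + 1))
    (hconstfield : ∀ z : M, IsAlgebraic F z → ∃ c : F, algebraMap F M c = z) :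
    ((Fintype.card F : ℝ) - 2 * Real.sqrt (Fintype.card F) + 1) / (Nat.factorial (r + 1))
        - 2 * Real.sqrt (Fintype.card F) * ((r : ℝ) - 1)
        - ((r : ℝ) + 1 + ∑ i, ((gi i).natDegree : ℝ)) / 2
      ≤ ((Finset.univ.filter (fun b : Option F =>
            (Finset.univ.filter (fun x : Option F => ratEval f g x = b)).card = r + 1)).card
          : ℝ) := by
  have hW : Ss M ((r - 1) • Tinf F M R R') = ⊤ := W_top hcop hr hdeg hP
  have h0 : Nat.card (Ls M (0 : Pl R R' → ℤ)) = Nat.card F := card_L0 hconstfield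
  obtain ⟨S, hS⟩ := places_finite (R := R) (R' := R') F M
  have hA := weil_final hconstfield hr hW S hS
  have hB := place_count hcop hdeg hP h0 (r - 1) hW S hS
  have hC := dbl_count r hr hq f g hcop hdeg m gi ai hirr hmon hgine hai hfact
  have hnpos : 0 < Module.finrank (RatFunc F) M := Module.finrank_pos
  rw [Nat.card_eq_fintype_card] at hA
  refine final_arith _ (Module.finrank (RatFunc F) M : ℝ) ((S 1).card : ℝ) _ _ _ _ _ (Real.sq_sqrt (by positivity)) ?_ ?_ ?_ ?_ ?_ ?_ ?_ hA ?_
  · rw [← Real.sqrt_one]; exact Real.sqrt_lt_sqrt (by norm_num) (by exact_mod_cast Fintype.one_lt_card)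
  · exact_mod_cast hr
  · exact_mod_cast hnpos
  · exact_mod_cast hn
  · rcases Nat.lt_or_ge r 2 with h | h
    · left
      have : r = 1 := by omega
      subst this
      norm_num [Nat.factorial]
    · right; exact_mod_cast h
  · exact Finset.sum_nonneg fun _ _ => Nat.cast_nonneg _
  · exact Nat.cast_nonneg _
  · have hE : 2 * (S 1).card ≤ Module.finrank (RatFunc F) M * (r + 3 + ∑ i, (gi i).natDegree + 2 * (Finset.univ.filter (fun b : Option F =>
            (Finset.univ.filter (fun x : Option F => ratEval f g x = b)).card = r + 1)).card) := by
      refine hB.trans (Nat.mul_le_mul_left _ ?_)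
      have aux : ∀ a c d e A : ℕ, c ≤ A → 2 + 2 * a + d ≤ r + 3 + e → 2 + 2 * a + 2 * c + d ≤ r + 3 + e + 2 * A := by
        intros; omega
      refine aux _ _ _ _ _ ?_ hC
      convert fibre_count (F := F) hcop hdeg
    exact_mod_cast hE

end Curve14

set_option linter.all false
/-! ## Part 8: instantiation with integral closures -/
section Inst
open Polynomial

theorem ic_finite_gen (A K L : Type*) [CommRing A] [IsDomain A] [IsNoetherianRing A] [IsIntegrallyClosed A]
    [Field K] [Algebra A K] [IsFractionRing A K] [Field L] [Algebra K L] [Algebra A L] [IsScalarTower A K L]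
    [FiniteDimensional K L] [Algebra.IsSeparable K L] : Module.Finite A (integralClosure A L) :=
  IsIntegralClosure.finite A K L _

theorem curve_final_inst {F : Type*} [Field F] {M : Type*} [Field M] [Algebra (RatFunc F) M]
  [Algebra F M] [IsScalarTower F (RatFunc F) M]
  [Algebra F[X] M] [IsScalarTower F[X] (RatFunc F) M]
  [Fintype F] [DecidableEq F] [FiniteDimensional (RatFunc F) M] [IsGalois (RatFunc F) M]
    (r : ℕ) (hr : 0 < r)
    (hq : Nat.Coprime (Fintype.card F) (Nat.factorial (r + 1)))
    (f g : Polynomial F) (hcop : IsCoprime f g)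
    (hdeg : max f.natDegree g.natDegree = r + 1)
    (m : ℕ) (gi : Fin m → Polynomial F) (ai : Fin m → ℕ)
    (hirr : ∀ i, Irreducible (gi i)) (hmon : ∀ i, (gi i).Monic)
    (hgine : ∀ i j, i ≠ j → gi i ≠ gi j) (hai : ∀ i, 0 < ai i)
    (hfact : g = Polynomial.C g.leadingCoeff * ∏ i, gi i ^ ai i)
    (P : Polynomial (RatFunc F))
    (hP : P = f.map (algebraMap F (RatFunc F))
        - Polynomial.C RatFunc.X * g.map (algebraMap F (RatFunc F)))
    [P.IsSplittingField (RatFunc F) M] (hn : Module.finrank (RatFunc F) M ≤ Nat.factorial (r + 1))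
    (hconstfield : ∀ z : M, IsAlgebraic F z → ∃ c : F, algebraMap F M c = z) :
    ((Fintype.card F : ℝ) - 2 * Real.sqrt (Fintype.card F) + 1) / (Nat.factorial (r + 1))
        - 2 * Real.sqrt (Fintype.card F) * ((r : ℝ) - 1)
        - ((r : ℝ) + 1 + ∑ i, ((gi i).natDegree : ℝ)) / 2
      ≤ ((Finset.univ.filter (fun b : Option F =>
            (Finset.univ.filter (fun x : Option F => ratEval f g x = b)).card = r + 1)).card
          : ℝ) := by
  haveI t1 : IsScalarTower F F[X] M := by
    refine IsScalarTower.of_algebraMap_eq fun c => ?_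
    rw [IsScalarTower.algebraMap_apply F[X] (RatFunc F) M, ← IsScalarTower.algebraMap_apply F F[X] (RatFunc F),
      ← IsScalarTower.algebraMap_apply]
  haveI t2 : IsScalarTower (Oinf F) (RatFunc F) M := inferInstance
  haveI t3 : IsScalarTower F (Oinf F) M := by
    refine IsScalarTower.of_algebraMap_eq fun c => ?_
    rw [IsScalarTower.algebraMap_apply (Oinf F) (RatFunc F) M, ← IsScalarTower.algebraMap_apply F (Oinf F) (RatFunc F),
      ← IsScalarTower.algebraMap_apply]
  haveI d1 : IsDedekindDomain (integralClosure F[X] M) := integralClosure.isDedekindDomain F[X] (RatFunc F) M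
  haveI d2 : IsDedekindDomain (integralClosure (Oinf F) M) := integralClosure.isDedekindDomain (Oinf F) (RatFunc F) M
  haveI f1 : IsFractionRing (integralClosure F[X] M) M := integralClosure.isFractionRing_of_finite_extension (RatFunc F) M
  haveI f2 : IsFractionRing (integralClosure (Oinf F) M) M := IsIntegralClosure.isFractionRing_of_finite_extension (Oinf F) (RatFunc F) M (integralClosure (Oinf F) M)
  haveI n1 : Module.Finite F[X] (integralClosure F[X] M) := IsIntegralClosure.finite F[X] (RatFunc F) M _
  haveI n2 : Module.Finite (Oinf F) (integralClosure (Oinf F) M) := ic_finite_gen (Oinf F) (RatFunc F) M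
  haveI s1 : IsScalarTower F (integralClosure F[X] M) M := inferInstance
  haveI s2 : IsScalarTower F (integralClosure (Oinf F) M) M := inferInstance
  exact curve_final (integralClosure F[X] M) (integralClosure (Oinf F) M) r hr hq f g hcop hdeg m gi ai hirr hmon hgine hai hfact P hP hn hconstfield
end Inst
open Polynomial Finset

theorem stmt4 {F : Type*} [Field F] [Fintype F] [DecidableEq F]
    (r : ℕ) (hr : 0 < r)
    (hq : Nat.Coprime (Fintype.card F) (Nat.factorial (r + 1)))
    (f g : Polynomial F) (hcop : IsCoprime f g)
    (hdeg : max f.natDegree g.natDegree = r + 1)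
    (m : ℕ) (gi : Fin m → Polynomial F) (ai : Fin m → ℕ)
    (hirr : ∀ i, Irreducible (gi i)) (hmon : ∀ i, (gi i).Monic)
    (hgine : ∀ i j, i ≠ j → gi i ≠ gi j) (hai : ∀ i, 0 < ai i)
    (hfact : g = Polynomial.C g.leadingCoeff * ∏ i, gi i ^ ai i)
    (P : Polynomial (RatFunc F))
    (hP : P = f.map (algebraMap F (RatFunc F))
        - Polynomial.C RatFunc.X * g.map (algebraMap F (RatFunc F)))
    (hconstfield : ∀ z : P.SplittingField, IsAlgebraic F z →
        ∃ c : F, algebraMap F P.SplittingField c = z) :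
    ((Fintype.card F : ℝ) - 2 * Real.sqrt (Fintype.card F) + 1) / (Nat.factorial (r + 1))
        - 2 * Real.sqrt (Fintype.card F) * ((r : ℝ) - 1)
        - ((r : ℝ) + 1 + ∑ i, ((gi i).natDegree : ℝ)) / 2
      ≤ ((Finset.univ.filter (fun b : Option F =>
            (Finset.univ.filter (fun x : Option F => ratEval f g x = b)).card = r + 1)).card
          : ℝ) := by
  have hPd := P_natDegree hdeg (by omega) hP
  haveI := sep_galois hq P hPd
  have hn := finrank_le_factorial P
  rw [hPd] at hn
  exact curve_final_inst (M := P.SplittingField) r hr hq f g hcop hdeg m gi ai hirr hmon hgine hai hfact P hP hn hconstfield
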